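/- For every r > 0 there exist constants c = c(r) > 0 and C = C(r) > 0 with the following property. Let d ≥ 3 be an integer, ε ∈ (0,1), and let f₀ ∈ C(S^d) be nonnegative with ∫ f₀ dμ_d^* = 1, so dτ = f₀ dμ_d^* is a probability measure on S^d. Let f ∈ C(S^d), and suppose f₀f is not identically zero and there is δ > 0 with ‖f₀f‖_{d;r} := sup_{x∈S^d}[ ‖f₀f‖_∞ + min_{P∈Π_r^d} max_{y∈B(x,δ)} |f₀(y)f(y)−P(y)|/|x−y|_{d+1}^r ] < ∞. Let n be an integer with n ≥ 2(d+1), dn ≥ (d+r+1)², and √(16 r (log n)/n) ≤ δ, and set D_n = dim(Π_{2(d+2)n}^d). Let M ≥ 2 and let y₁, …, y_M be independent random points each distributed according to τ, and define σ̂(x) = (1/M) Σ_{j=1}^M f(y_j) Φ_{d;n,r}(x·y_j). If M ≥ c · 2^{−d} d^{−1/3} (‖f‖_∞/‖f₀f‖_∞) · D_n^{(2r+d)/d} · ( log D_n + (d+1) log d + d log(16e/π) + log(1/ε) ), then with probability greater than 1−ε, ‖f₀f − σ̂‖_∞ ≤ C · d^{1/6} · D_n^{−r/d} · ‖f₀f‖_{d;r}.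 -/

import Mathlib

noncomputable section

open MeasureTheory Real Set
open scoped RealInnerProductSpace

/-- Value at `x` of the orthonormalized Jacobi polynomial `p_n^{(α,β)}`. -/
def jacobiP (α β : ℝ) (n : ℕ) (x : ℝ) : ℝ :=
  Real.sqrt ((2 * (n : ℝ) + α + β + 1) / 2 ^ (α + β + 1) *
      (Real.Gamma ((n : ℝ) + α + β + 1) * (n.factorial : ℝ) /
        (Real.Gamma ((n : ℝ) + α + 1) * Real.Gamma ((n : ℝ) + β + 1)))) *
    (Real.Gamma (α + n + 1) / ((n.factorial : ℝ) * Real.Gamma (α + β + n + 1))) *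
    ∑ m ∈ Finset.range (n + 1),
      (n.choose m : ℝ) * (Real.Gamma (α + β + n + m + 1) / Real.Gamma (α + m + 1)) *
        ((x - 1) / 2) ^ m

/-- The kernel `K_n^{(α,β)}(x) = Σ_{ℓ<n} p_ℓ^{(α,β)}(1) p_ℓ^{(α,β)}(x)`. -/
def jacobiK (α β : ℝ) (n : ℕ) (x : ℝ) : ℝ :=
  ∑ ℓ ∈ Finset.range n, jacobiP α β ℓ 1 * jacobiP α β ℓ x

/-- The unit sphere `S^d ⊂ ℝ^{d+1}`. -/
abbrev Sph (d : ℕ) := Metric.sphere (0 : EuclideanSpace ℝ (Fin (d + 1))) 1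

/-- The rotation invariant Riemannian volume probability measure `μ_d^*` on `S^d`. -/
def sphMeasure (d : ℕ) : Measure (Sph d) :=
  ((volume : Measure (EuclideanSpace ℝ (Fin (d + 1)))).toSphere Set.univ)⁻¹ •
    (volume : Measure (EuclideanSpace ℝ (Fin (d + 1)))).toSphere

/-- `f : S^d → ℝ` is the restriction to the sphere of an algebraic polynomial in `d+1`
variables of total degree `< n`, i.e. `f ∈ Π_n^d`. -/
def IsSphPoly (d : ℕ) (n : ℝ) (f : Sph d → ℝ) : Prop :=
  ∃ p : MvPolynomial (Fin (d + 1)) ℝ, (p.totalDegree : ℝ) < n ∧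
    ∀ y : Sph d, f y = MvPolynomial.eval (fun i => (y : EuclideanSpace ℝ (Fin (d + 1))) i) p

/-- Integral of `f` with respect to a signed measure (via the Jordan decomposition). -/
def sInt {X : Type*} [MeasurableSpace X] (ν : SignedMeasure X) (f : X → ℝ) : ℝ :=
  (∫ x, f x ∂ν.toJordanDecomposition.posPart) - ∫ x, f x ∂ν.toJordanDecomposition.negPart

/-- Integral of `f` over a set `s` with respect to a signed measure. -/
def sIntOn {X : Type*} [MeasurableSpace X] (ν : SignedMeasure X) (s : Set X) (f : X → ℝ) : ℝ :=
  (∫ x in s, f x ∂ν.toJordanDecomposition.posPart) -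
    ∫ x in s, f x ∂ν.toJordanDecomposition.negPart

/-- `ν` is a quadrature measure of order `n` on `S^d`. -/
def IsQuadrature (d : ℕ) (n : ℝ) (ν : SignedMeasure (Sph d)) : Prop :=
  ∀ f : Sph d → ℝ, IsSphPoly d n f → sInt ν f = ∫ y, f y ∂sphMeasure d

/-- `ν` satisfies the Marcinkiewicz-Zygmund inequality of order `n` with constant `c`;
`ν ∈ MZ(d;n)` means this holds for some `c`, and `|||ν|||_{d;n}` is the least such `c`. -/
def IsMZ (d : ℕ) (n : ℝ) (ν : SignedMeasure (Sph d)) (c : ℝ) : Prop :=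
  ∀ f : Sph d → ℝ, IsSphPoly d (n / 2) f →
    (∫ y, (f y) ^ 2 ∂ν.totalVariation) ≤ c * ∫ y, (f y) ^ 2 ∂sphMeasure d

/-- `ω_d`, the volume of `S^d`. -/
def omegaS (d : ℕ) : ℝ := 2 * Real.pi ^ (((d : ℝ) + 1) / 2) / Real.Gamma (((d : ℝ) + 1) / 2)

/-- The reproducing kernel `K_{d;n}` of `Π_n^d`. -/
def sphK (d n : ℕ) (x : ℝ) : ℝ :=
  (omegaS d / omegaS (d - 1)) * jacobiK ((d : ℝ) / 2 - 1) ((d : ℝ) / 2 - 1) n x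

/-- The kernel `Φ̃_{d;n,r}`. -/
def PhiTilde (d n : ℕ) (r : ℝ) (x : ℝ) : ℝ :=
  sphK d ((d + 2) * n) x *
    (jacobiP ((d : ℝ) / 2 + r) ((d : ℝ) / 2 - 2) (d * n) x /
      jacobiP ((d : ℝ) / 2 + r) ((d : ℝ) / 2 - 2) (d * n) 1)

/-- The kernel `Φ_{d;n,r}`. -/
def Phi (d n : ℕ) (r : ℝ) (x : ℝ) : ℝ := PhiTilde d n r x * ((1 + x) / 2) ^ n

/-- The inner product `x·y` of two points of `S^d`. -/
def ip {d : ℕ} (x y : Sph d) : ℝ :=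
  ⟪(x : EuclideanSpace ℝ (Fin (d + 1))), (y : EuclideanSpace ℝ (Fin (d + 1)))⟫

/-- The operator `σ_{d;n,r}(ν, f)`. -/
def sigmaOp (d n : ℕ) (r : ℝ) (ν : SignedMeasure (Sph d)) (f : Sph d → ℝ) (x : Sph d) : ℝ :=
  sInt ν (fun y => f y * Phi d n r (ip x y))

/-- The operator `σ̃_{d;n,r}(ν, f)`. -/
def sigmaTildeOp (d n : ℕ) (r : ℝ) (ν : SignedMeasure (Sph d)) (f : Sph d → ℝ) (x : Sph d) : ℝ :=
  sInt ν (fun y => f y * PhiTilde d n r (ip x y))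

/-- The uniform (supremum) norm `‖f‖_∞`. -/
def supNorm {X : Type*} (f : X → ℝ) : ℝ := sSup (Set.range fun x => |f x|)

/-- `E_{d;n}(f)`, the degree of approximation of `f` from `Π_n^d` in the uniform norm. -/
def bestApprox (d : ℕ) (n : ℝ) (f : Sph d → ℝ) : ℝ :=
  sInf {t | ∃ g, IsSphPoly d n g ∧ ∀ y, |f y - g y| ≤ t}

/-- `dim Π_n^d = (2n+d−2)·Γ(n+d−1)/(Γ(n)·Γ(d+1))` (for `n ≥ 2`). -/
def dimPi (d n : ℕ) : ℝ :=
  (2 * (n : ℝ) + d - 2) * Real.Gamma ((n : ℝ) + d - 1) /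
    (Real.Gamma n * Real.Gamma ((d : ℝ) + 1))

/-- rising factorial -/
def rf (a : ℝ) : ℕ → ℝ
  | 0 => 1
  | m + 1 => rf a m * (a + m)

theorem rf_zero (a : ℝ) : rf a 0 = 1 := rfl
theorem rf_succ (a : ℝ) (m : ℕ) : rf a (m + 1) = rf a m * (a + m) := rfl

theorem rf_succ_left (a : ℝ) (m : ℕ) : rf a (m + 1) = a * rf (a + 1) m := by
  induction m with
  | zero => simp [rf]
  | succ k ih => rw [rf_succ, ih, rf_succ]; push_cast; ring

theorem rf_pos {a : ℝ} (ha : 0 < a) (m : ℕ) : 0 < rf a m := by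
  induction m with
  | zero => simp [rf]
  | succ k ih => rw [rf_succ]; positivity

theorem rf_Gamma {a : ℝ} (ha : 0 < a) (m : ℕ) : Real.Gamma (a + m) = Real.Gamma a * rf a m := by
  induction m with
  | zero => simp [rf]
  | succ k ih =>
    rw [rf_succ]; push_cast
    rw [← add_assoc, Real.Gamma_add_one (by positivity), ih]; ring

theorem rf_mono {a b : ℝ} (ha : 0 < a) (hab : a ≤ b) (m : ℕ) : rf a m ≤ rf b m := by
  induction m with
  | zero => simp [rf]
  | succ k ih =>
    rw [rf_succ, rf_succ]
    have := rf_pos ha k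
    have := rf_pos (ha.trans_le hab) k
    gcongr

theorem rf_one (n : ℕ) : rf 1 n = n.factorial := by
  induction n with
  | zero => simp [rf]
  | succ k ih => rw [rf_succ, ih, Nat.factorial_succ]; push_cast; ring

theorem rf_neg_zero (j n : ℕ) (h : j < n) : rf (-(j : ℝ)) n = 0 := by
  induction n with
  | zero => omega
  | succ k ih =>
    rw [rf_succ]
    rcases Nat.lt_succ_iff_lt_or_eq.mp h with h | h
    · rw [ih h]; ring
    · rw [h]; ring

theorem rf_neg (a : ℝ) (n : ℕ) : rf (-a - n + 1) n = (-1) ^ n * rf a n := by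
  induction n generalizing a with
  | zero => simp [rf]
  | succ k ih =>
    rw [rf_succ_left a, rf_succ]
    have := ih (a + 1)
    have e : -(a + 1) - (k : ℝ) + 1 = -a - ((k + 1 : ℕ) : ℝ) + 1 := by push_cast; ring
    rw [e] at this
    rw [this]; push_cast; ring

/-- Chu-Vandermonde -/
theorem vdm (n : ℕ) (b c : ℝ) (hc : 0 < c) :
    ∑ m ∈ Finset.range (n + 1), (-1 : ℝ) ^ m * (n.choose m : ℝ) * rf b m / rf c m
      = rf (c - b) n / rf c n := by
  induction n generalizing b c with
  | zero => simp [rf]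
  | succ k ih =>
    have h1 := ih b c hc
    have h2 := ih (b + 1) (c + 1) (by linarith)
    rw [Finset.sum_range_succ'] 
    have e : ∀ m ∈ Finset.range (k + 1),
        (-1 : ℝ) ^ (m + 1) * ((k + 1).choose (m + 1) : ℝ) * rf b (m + 1) / rf c (m + 1) =
        (-1 : ℝ) ^ (m + 1) * (k.choose (m + 1) : ℝ) * rf b (m + 1) / rf c (m + 1)
        - (b / c) * ((-1 : ℝ) ^ m * (k.choose m : ℝ) * rf (b + 1) m / rf (c + 1) m) := by
      intro m _
      have p1 := (rf_pos (show 0 < c + 1 by linarith) m).ne'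
      rw [Nat.choose_succ_succ, rf_succ_left b, rf_succ_left c]; push_cast
      field_simp; ring
    rw [Finset.sum_congr rfl e, Finset.sum_sub_distrib, ← Finset.mul_sum, h2]
    have h3 : ∑ m ∈ Finset.range (k + 1), (-1 : ℝ) ^ (m + 1) * (k.choose (m + 1) : ℝ) * rf b (m + 1) / rf c (m + 1)
        = rf (c - b) k / rf c k - 1 := by
      rw [← h1, Finset.sum_range_succ' (fun m => (-1 : ℝ) ^ m * (k.choose m : ℝ) * rf b m / rf c m), Finset.sum_range_succ]
      simp [rf]
    rw [h3]
    have e1 : c + 1 - (b + 1) = c - b := by ring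
    have p1 := (rf_pos (show 0 < c + 1 by linarith) k).ne'
    have p2 := (rf_pos hc k).ne'
    have p3 : rf c k * (c + k) = c * rf (c + 1) k := by rw [← rf_succ, rf_succ_left]
    have p4 : c + (k:ℝ) ≠ 0 := by positivity
    rw [e1, rf_succ (c - b), rf_succ c]
    have p5 : rf (c + 1) k = rf c k * (c + k) / c := by rw [p3]; field_simp
    rw [p5]
    simp [rf]
    field_simp; ring

open Polynomial in
/-- normalized Jacobi polynomial in the variable y = (1-x)/2 -/
def jF (n : ℕ) (α β : ℝ) : Polynomial ℝ :=
  ∑ m ∈ Finset.range (n + 1),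
    C ((-1 : ℝ) ^ m * (n.choose m : ℝ) * rf (n + α + β + 1) m / rf (α + 1) m) * X ^ m

theorem jF_coeff (n : ℕ) (α β : ℝ) (m : ℕ) : (jF n α β).coeff m =
    (-1 : ℝ) ^ m * (n.choose m : ℝ) * rf (n + α + β + 1) m / rf (α + 1) m := by
  unfold jF
  simp only [Polynomial.finsetSum_coeff, Polynomial.coeff_C_mul, Polynomial.coeff_X_pow]
  simp only [mul_ite, mul_one, mul_zero, Finset.sum_ite_eq, Finset.mem_range]
  split_ifs with h
  · rfl
  · rw [Nat.choose_eq_zero_of_lt (by omega)]; simp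

theorem jF_eval (n : ℕ) (α β y : ℝ) : (jF n α β).eval y = ∑ m ∈ Finset.range (n + 1),
    ((-1 : ℝ) ^ m * (n.choose m : ℝ) * rf (n + α + β + 1) m / rf (α + 1) m) * y ^ m := by
  unfold jF; simp [Polynomial.eval_finsetSum]

theorem jF_natDegree (n : ℕ) (α β : ℝ) : (jF n α β).natDegree ≤ n := by
  refine Polynomial.natDegree_le_iff_coeff_eq_zero.mpr fun m hm => ?_
  rw [jF_coeff, Nat.choose_eq_zero_of_lt hm]; simp

theorem jF_zero (n : ℕ) (α β : ℝ) : (jF n α β).eval 0 = 1 := by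
  rw [← Polynomial.coeff_zero_eq_eval_zero, jF_coeff]; simp [rf]

theorem jF_one (n : ℕ) (α β : ℝ) (hα : -1 < α) :
    (jF n α β).eval 1 = (-1) ^ n * rf (β + 1) n / rf (α + 1) n := by
  rw [jF_eval]
  simp only [one_pow, mul_one]
  rw [vdm n _ _ (by linarith), ← rf_neg]
  congr 2; ring

theorem jF_deriv_zero (n : ℕ) (α β : ℝ) :
    (Polynomial.derivative (jF n α β)).eval 0 = - (n * (n + α + β + 1)) / (α + 1) := by
  rw [← Polynomial.coeff_zero_eq_eval_zero, Polynomial.coeff_derivative, jF_coeff]; simp [rf]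

open Polynomial in
theorem jF_ode (n : ℕ) (α β : ℝ) (hα : -1 < α) :
    X * (1 - X) * derivative (derivative (jF n α β))
      + (C (α + 1) - C (α + β + 2) * X) * derivative (jF n α β)
      + C ((n : ℝ) * (n + α + β + 1)) * jF n α β = 0 := by
  have hrec : ∀ m : ℕ, ((m : ℝ) + 1) * (α + 1 + m) * (jF n α β).coeff (m + 1)
      = -((n : ℝ) - m) * (n + α + β + 1 + m) * (jF n α β).coeff m := by
    intro m
    rw [jF_coeff, jF_coeff, rf_succ, rf_succ]
    have h1 := (rf_pos (show 0 < α + 1 by linarith) m).ne'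
    have h2 : α + 1 + (m : ℝ) ≠ 0 := by
      have : (0 : ℝ) ≤ m := by positivity
      linarith
    have h3 : (n.choose (m + 1) : ℝ) * (m + 1) = n.choose m * ((n : ℝ) - m) := by
      rcases le_or_gt m n with h | h
      · have := Nat.choose_succ_right_eq n m
        have h4 : ((n - m : ℕ) : ℝ) = (n : ℝ) - m := by push_cast [h]; ring
        rw [← h4]; exact_mod_cast this
      · rw [Nat.choose_eq_zero_of_lt h, Nat.choose_eq_zero_of_lt (by omega)]; simp
    field_simp
    rw [pow_succ]
    linear_combination (-1 : ℝ) ^ m * (-1) * rf (n + α + β + 1) m * (n + α + β + 1 + m) * h3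
  have hX : ∀ (p : Polynomial ℝ), X * (1 - X) * p = X * p - X * (X * p) := by intro p; ring
  have hY : (C (α + 1) - C (α + β + 2) * X) * derivative (jF n α β) =
    C (α + 1) * derivative (jF n α β) - C (α + β + 2) * (X * derivative (jF n α β)) := by ring
  rw [hX, hY]
  ext m
  have r := hrec m
  rcases m with _ | _ | m <;>
  · simp only [coeff_add, coeff_sub, coeff_C_mul, coeff_X_mul, coeff_X_mul_zero, coeff_derivative, coeff_zero]
    push_cast at r ⊢
    linear_combination r

/-- Jacobi weight on [0,1] -/
def jw (a b y : ℝ) : ℝ := y ^ a * (1 - y) ^ b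

theorem jw_nonneg (a b : ℝ) {y : ℝ} (h : y ∈ Icc (0:ℝ) 1) : 0 ≤ jw a b y := by
  have := h.1; have := h.2
  unfold jw
  exact mul_nonneg (rpow_nonneg h.1 _) (rpow_nonneg (by linarith) _)

theorem jw_measurable (a b : ℝ) : Measurable (jw a b) := by
  unfold jw; fun_prop

theorem jw_intervalIntegrable {a b : ℝ} (ha : -1 < a) (hb : -1 < b) :
    IntervalIntegrable (jw a b) volume 0 1 := by
  have h := Complex.betaIntegral_convergent (u := ((a + 1 : ℝ) : ℂ)) (v := ((b + 1 : ℝ) : ℂ))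
    (by simp; linarith) (by simp; linarith)
  rw [intervalIntegrable_iff_integrableOn_Ioc_of_le zero_le_one] at h ⊢
  refine h.norm.congr ?_
  refine (ae_restrict_iff' measurableSet_Ioc).mpr (Filter.Eventually.of_forall fun y hy => ?_)
  have h0 : 0 ≤ y := hy.1.le
  have h1 : 0 ≤ 1 - y := by linarith [hy.2]
  have e : (y : ℂ) ^ (((a + 1 : ℝ) : ℂ) - 1) * (1 - (y : ℂ)) ^ (((b + 1 : ℝ) : ℂ) - 1) = ((jw a b y : ℝ) : ℂ) := by
    unfold jw
    rw [Complex.ofReal_mul, Complex.ofReal_cpow h0, Complex.ofReal_cpow h1]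
    push_cast; ring_nf
  beta_reduce
  rw [e, Complex.norm_real, Real.norm_eq_abs, abs_of_nonneg (jw_nonneg a b ⟨h0, hy.2⟩)]

theorem jw_integral {a b : ℝ} (ha : -1 < a) (hb : -1 < b) :
    ∫ y in (0:ℝ)..1, jw a b y = Real.Gamma (a + 1) * Real.Gamma (b + 1) / Real.Gamma (a + b + 2) := by
  have h := ProbabilityTheory.beta_eq_betaIntegralReal (a + 1) (b + 1) (by linarith) (by linarith)
  unfold ProbabilityTheory.beta at h
  have e2 : a + 1 + (b + 1) = a + b + 2 := by ring
  rw [e2] at h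
  rw [h]
  have : Complex.betaIntegral ((a + 1 : ℝ) : ℂ) ((b + 1 : ℝ) : ℂ) = ((∫ y in (0:ℝ)..1, jw a b y : ℝ) : ℂ) := by
    unfold Complex.betaIntegral
    rw [← intervalIntegral.integral_ofReal]
    refine intervalIntegral.integral_congr fun y hy => ?_
    rw [uIcc_of_le zero_le_one] at hy
    have h1 : 0 ≤ 1 - y := by linarith [hy.2]
    unfold jw
    rw [Complex.ofReal_mul, Complex.ofReal_cpow hy.1, Complex.ofReal_cpow h1]
    push_cast; ring_nf
  rw [this, Complex.ofReal_re]

theorem jw_mul_integrable {a b : ℝ} (ha : -1 < a) (hb : -1 < b) {g : ℝ → ℝ} (hg : ContinuousOn g (Icc 0 1)) :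
    IntervalIntegrable (fun y => jw a b y * g y) volume 0 1 := by
  refine (jw_intervalIntegrable ha hb).mul_continuousOn ?_
  rwa [uIcc_of_le zero_le_one]

/-- weighted integral -/
def Lw (a b : ℝ) (g : ℝ → ℝ) : ℝ := ∫ y in (0:ℝ)..1, jw a b y * g y

theorem Lw_add {a b : ℝ} (ha : -1 < a) (hb : -1 < b) {g h : ℝ → ℝ} (hg : ContinuousOn g (Icc 0 1))
    (hh : ContinuousOn h (Icc 0 1)) : Lw a b (fun y => g y + h y) = Lw a b g + Lw a b h := by
  unfold Lw
  rw [← intervalIntegral.integral_add (jw_mul_integrable ha hb hg) (jw_mul_integrable ha hb hh)]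
  simp only [mul_add]

theorem Lw_const_mul {a b : ℝ} (c : ℝ) (g : ℝ → ℝ) : Lw a b (fun y => c * g y) = c * Lw a b g := by
  unfold Lw
  rw [← intervalIntegral.integral_const_mul]
  congr 1; ext y; ring

theorem Lw_sum {a b : ℝ} (ha : -1 < a) (hb : -1 < b) {ι : Type*} (s : Finset ι) (g : ι → ℝ → ℝ)
    (hg : ∀ i, ContinuousOn (g i) (Icc 0 1)) :
    Lw a b (fun y => ∑ i ∈ s, g i y) = ∑ i ∈ s, Lw a b (g i) := by
  unfold Lw
  rw [← intervalIntegral.integral_finsetSum (fun i _ => jw_mul_integrable ha hb (hg i))]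
  simp only [Finset.mul_sum]

theorem Lw_mono {a b : ℝ} (ha : -1 < a) (hb : -1 < b) {g h : ℝ → ℝ} (hg : ContinuousOn g (Icc 0 1))
    (hh : ContinuousOn h (Icc 0 1)) (hgh : ∀ y ∈ Icc (0:ℝ) 1, g y ≤ h y) : Lw a b g ≤ Lw a b h := by
  unfold Lw
  refine intervalIntegral.integral_mono_on zero_le_one (jw_mul_integrable ha hb hg) (jw_mul_integrable ha hb hh) ?_
  intro y hy
  exact mul_le_mul_of_nonneg_left (hgh y hy) (jw_nonneg a b hy)

theorem Lw_congr {a b a' b' : ℝ} {g h : ℝ → ℝ}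
    (H : ∀ y ∈ Ioo (0:ℝ) 1, jw a b y * g y = jw a' b' y * h y) : Lw a b g = Lw a' b' h := by
  unfold Lw
  rw [intervalIntegral.integral_of_le zero_le_one, intervalIntegral.integral_of_le zero_le_one,
    ← integral_Ioc_eq_integral_Ioo.symm, ← integral_Ioc_eq_integral_Ioo.symm]
  exact setIntegral_congr_fun measurableSet_Ioo H

theorem Lw_mono_pow {a b : ℝ} (ha : -1 < a) (hb : -1 < b) (m j : ℕ) :
    Lw a b (fun y => y ^ m * (1 - y) ^ j) =
      Real.Gamma (a + m + 1) * Real.Gamma (b + j + 1) / Real.Gamma (a + b + m + j + 2) := by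
  have : Lw a b (fun y => y ^ m * (1 - y) ^ j) = Lw (a + m) (b + j) (fun _ => 1) := by
    refine Lw_congr fun y hy => ?_
    unfold jw
    have h1 : 0 < 1 - y := by linarith [hy.2]
    rw [rpow_add hy.1, rpow_add h1, rpow_natCast, rpow_natCast]; ring
  rw [this]
  unfold Lw
  simp only [mul_one]
  rw [jw_integral (by have : (0:ℝ) ≤ m := by positivity
                      linarith) (by have : (0:ℝ) ≤ j := by positivity
                                    linarith)]
  congr 2; ring

theorem jF_moment (n j : ℕ) {α β : ℝ} (ha : -1 < α) (hb : -1 < β) :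
    Lw α β (fun y => (jF n α β).eval y * (1 - y) ^ j) =
      Real.Gamma (α + 1) * Real.Gamma (β + j + 1) / Real.Gamma (α + β + j + 2) *
        (rf (j + 1 - n) n / rf (α + β + j + 2) n) := by
  have hj : (0:ℝ) ≤ j := by positivity
  have e1 : (fun y => (jF n α β).eval y * (1 - y) ^ j) = fun y => ∑ m ∈ Finset.range (n + 1),
      (((-1 : ℝ) ^ m * (n.choose m : ℝ) * rf (n + α + β + 1) m / rf (α + 1) m) * (y ^ m * (1 - y) ^ j)) := by
    ext y; rw [jF_eval, Finset.sum_mul]; refine Finset.sum_congr rfl fun m _ => by ring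
  rw [e1, Lw_sum ha hb _ _ (fun i => by fun_prop)]
  have e2 : (j : ℝ) + 1 - n = (α + β + j + 2) - (n + α + β + 1) := by ring
  rw [e2, ← vdm n _ _ (by linarith), Finset.mul_sum]
  refine Finset.sum_congr rfl fun m _ => ?_
  rw [Lw_const_mul, Lw_mono_pow ha hb]
  have g1 : Real.Gamma (α + m + 1) = Real.Gamma (α + 1) * rf (α + 1) m := by
    rw [← rf_Gamma (by linarith)]; congr 1; ring
  have g2 : Real.Gamma (α + β + m + j + 2) = Real.Gamma (α + β + j + 2) * rf (α + β + j + 2) m := by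
    rw [← rf_Gamma (by linarith)]; congr 1; ring
  rw [g1, g2]
  have p1 := (rf_pos (show 0 < α + 1 by linarith) m).ne'
  have p2 := (rf_pos (show 0 < α + β + j + 2 by linarith) m).ne'
  have p3 := (Real.Gamma_pos_of_pos (show 0 < α + β + j + 2 by linarith)).ne'
  field_simp

theorem jF_orth (n : ℕ) {α β : ℝ} (ha : -1 < α) (hb : -1 < β) (q : Polynomial ℝ) (hq : q.natDegree < n) :
    Lw α β (fun y => (jF n α β).eval y * q.eval y) = 0 := by
  set p := q.comp (1 - Polynomial.X) with hp
  have hpd : p.natDegree < n := by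
    refine lt_of_le_of_lt (Polynomial.natDegree_comp_le) ?_
    refine lt_of_le_of_lt ?_ hq
    have : (1 - Polynomial.X : Polynomial ℝ).natDegree ≤ 1 := by
      compute_degree
    nlinarith
  have hqp : ∀ y, q.eval y = p.eval (1 - y) := by intro y; simp [hp, Polynomial.eval_comp]
  have e1 : (fun y => (jF n α β).eval y * q.eval y) = fun y => ∑ j ∈ Finset.range n,
      p.coeff j * ((jF n α β).eval y * (1 - y) ^ j) := by
    ext y
    rw [hqp, Polynomial.eval_eq_sum_range' hpd, Finset.mul_sum]
    refine Finset.sum_congr rfl fun m _ => by ring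
  rw [e1, Lw_sum ha hb _ _ (fun i => by fun_prop)]
  refine Finset.sum_eq_zero fun j hj => ?_
  rw [Lw_const_mul, jF_moment n j ha hb]
  have hj := Finset.mem_range.mp hj
  have : (j : ℝ) + 1 - n = -((n - 1 - j : ℕ) : ℝ) := by
    rw [Nat.sub_sub, Nat.cast_sub (by omega)]; push_cast; ring
  rw [this, rf_neg_zero _ _ (by omega)]; simp

/-- the squared norm -/
def jh (n : ℕ) (α β : ℝ) : ℝ := n.factorial * Real.Gamma (α + 1) ^ 2 * Real.Gamma (n + β + 1) /
  ((2 * n + α + β + 1) * Real.Gamma (n + α + β + 1) * Real.Gamma (n + α + 1))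

theorem jF_mul_orth (n : ℕ) {α β : ℝ} (ha : -1 < α) (hb : -1 < β) (q : Polynomial ℝ) (hq : q.natDegree ≤ n) :
    Lw α β (fun y => (jF n α β).eval y * q.eval y) = q.coeff n * (-1) ^ n *
      Lw α β (fun y => (jF n α β).eval y * (1 - y) ^ n) := by
  by_cases hn : n = 0
  · subst hn
    obtain ⟨c, hc⟩ : ∃ c, q = Polynomial.C c := ⟨q.coeff 0, Polynomial.eq_C_of_natDegree_le_zero hq⟩
    rw [hc]; simp
    rw [← Lw_const_mul]; congr 1; ext y; ring
  set l : Polynomial ℝ := Polynomial.C (q.coeff n * (-1) ^ n) * (1 - Polynomial.X) ^ n with hl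
  have hX : (1 - Polynomial.X : Polynomial ℝ) = Polynomial.C (-1) * (Polynomial.X - Polynomial.C 1) := by
    simp
  have hlc : l.coeff n = q.coeff n := by
    rw [hl, Polynomial.coeff_C_mul, hX, mul_pow, ← Polynomial.C_pow, Polynomial.coeff_C_mul]
    have : ((Polynomial.X - Polynomial.C (1:ℝ)) ^ n).coeff n = 1 := by
      have h := ((Polynomial.monic_X_sub_C (1:ℝ)).pow n)
      have h2 : ((Polynomial.X - Polynomial.C (1:ℝ)) ^ n).natDegree = n := by
        rw [Polynomial.natDegree_pow, Polynomial.natDegree_X_sub_C, mul_one]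
      have := h.coeff_natDegree
      rwa [h2] at this
    rw [this, mul_one, mul_assoc, ← mul_pow]; simp
  have hld : l.natDegree ≤ n := by
    rw [hl]
    have h1 : (1 - Polynomial.X : Polynomial ℝ).natDegree ≤ 1 := by compute_degree
    refine (Polynomial.natDegree_C_mul_le _ _).trans ((Polynomial.natDegree_pow_le).trans ?_)
    nlinarith
  have hd : (q - l).natDegree < n := by
    have : (q - l).natDegree ≤ n := (Polynomial.natDegree_sub_le _ _).trans (max_le hq hld)
    rcases this.lt_or_eq with h | h
    · exact h
    · exfalso
      have h0 : (q - l).coeff n = 0 := by rw [Polynomial.coeff_sub, hlc, sub_self]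
      have : (q - l).leadingCoeff = 0 := by rw [Polynomial.leadingCoeff, h, h0]
      rw [Polynomial.leadingCoeff_eq_zero] at this
      rw [this] at h; simp at h; exact hn h.symm
  have h1 := jF_orth n ha hb (q - l) hd
  have e : (fun y => (jF n α β).eval y * q.eval y) =
    fun y => (jF n α β).eval y * (q - l).eval y + (q.coeff n * (-1) ^ n) * ((jF n α β).eval y * (1 - y) ^ n) := by
    ext y; simp [hl]; ring
  rw [e, Lw_add ha hb (by fun_prop) (by fun_prop), h1, zero_add, Lw_const_mul]

theorem jF_norm (n : ℕ) {α β : ℝ} (ha : -1 < α) (hb : -1 < β) (hab : 0 < α + β + 1) :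
    Lw α β (fun y => (jF n α β).eval y ^ 2) = jh n α β := by
  have e : (fun y => (jF n α β).eval y ^ 2) = fun y => (jF n α β).eval y * (jF n α β).eval y := by
    ext y; ring
  have hn : (0:ℝ) ≤ n := by positivity
  rw [e, jF_mul_orth n ha hb _ (jF_natDegree n α β), jF_moment n n ha hb, jF_coeff]
  have e1 : (n : ℝ) + 1 - n = 1 := by ring
  rw [e1, rf_one, Nat.choose_self]
  have s1 : ((-1:ℝ)) ^ n * (-1) ^ n = 1 := by rw [← mul_pow]; simp
  unfold jh
  have g1 : Real.Gamma (n + α + 1) = Real.Gamma (α + 1) * rf (α + 1) n := by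
    rw [← rf_Gamma (by linarith)]; congr 1; ring
  have g2 : Real.Gamma (2 * n + α + β + 1) = Real.Gamma (n + α + β + 1) * rf (n + α + β + 1) n := by
    rw [← rf_Gamma (by linarith)]; congr 1; ring
  have g3 : Real.Gamma (2 * n + α + β + 2) = Real.Gamma (α + β + n + 2) * rf (α + β + n + 2) n := by
    rw [← rf_Gamma (by linarith)]; congr 1; ring
  have g4 : Real.Gamma (2 * n + α + β + 2) = (2 * n + α + β + 1) * Real.Gamma (2 * n + α + β + 1) := by
    rw [← Real.Gamma_add_one (by linarith)]; congr 1; ring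
  rw [g4, g2] at g3
  have p1 := (rf_pos (show 0 < α + 1 by linarith) n).ne'
  have p2 := (rf_pos (show 0 < α + β + n + 2 by linarith) n).ne'
  have p3 := (Real.Gamma_pos_of_pos (show 0 < α + β + n + 2 by linarith)).ne'
  have p4 := (Real.Gamma_pos_of_pos (show 0 < n + α + β + 1 by linarith)).ne'
  have p5 := (Real.Gamma_pos_of_pos (show 0 < α + 1 by linarith)).ne'
  have p6 : 2 * n + α + β + 1 ≠ 0 := by linarith
  have p7 := (Real.Gamma_pos_of_pos (show 0 < n + α + 1 by linarith)).ne'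
  rw [g1]
  have e5 : β + n + 1 = n + β + 1 := by ring
  have e6 : Real.Gamma (n + α + β + 1) * rf (n + α + β + 1) n * (2 * n + α + β + 1) =
      Real.Gamma (α + β + n + 2) * rf (α + β + n + 2) n := by rw [← g3]; ring
  rw [e5, div_mul_div_comm, ← e6]
  have p8 := (rf_pos (show 0 < n + α + β + 1 by linarith) n).ne'
  field_simp
  rw [sq, s1]; simp

theorem jF_shift (n : ℕ) {α β : ℝ} (ha : 0 < α) (hb : -1 < β) :
    Lw (α - 1) (β + 1) (fun y => (jF n α β).eval y ^ 2) =
      (2 * n + β + 1) / α * Lw α β (fun y => (jF n α β).eval y ^ 2) := by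
  set u := jF n α β with hu
  set u' := Polynomial.derivative u with hu'
  have ha' : -1 < α := by linarith
  -- orthogonality piece
  have h1 : Lw α β (fun y => u.eval y * ((1 - Polynomial.X) * u').eval y) =
      - n * Lw α β (fun y => u.eval y ^ 2) := by
    have e : (fun y => u.eval y ^ 2) = fun y => u.eval y * u.eval y := by ext y; ring
    rw [e, hu, jF_mul_orth n ha' hb _ (jF_natDegree n α β), ← hu, jF_mul_orth n ha' hb, ← hu]
    · have : ((1 - Polynomial.X) * u').coeff n = - n * u.coeff n := by
        have hz : u.coeff (n + 1) = 0 :=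
          Polynomial.coeff_eq_zero_of_natDegree_lt (Nat.lt_succ_of_le (jF_natDegree n α β))
        rw [sub_mul, one_mul, Polynomial.coeff_sub, hu', Polynomial.coeff_derivative, hz]
        rcases n with _ | n
        · simp
        · rw [Polynomial.coeff_X_mul, Polynomial.coeff_derivative]; push_cast; ring
      rw [this]; ring
    · by_cases hn : n = 0
      · subst hn
        have : u' = 0 := by
          rw [hu', Polynomial.derivative_of_natDegree_zero]
          exact Nat.le_zero.mp (jF_natDegree 0 α β)
        rw [this]; simp
      · have h2 : (1 - Polynomial.X : Polynomial ℝ).natDegree ≤ 1 := by compute_degree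
        have h3 : u'.natDegree ≤ n - 1 := (Polynomial.natDegree_derivative_le u).trans
          (Nat.sub_le_sub_right (jF_natDegree n α β) 1)
        refine (Polynomial.natDegree_mul_le).trans ?_
        omega
  -- integration by parts
  set G : ℝ → ℝ := fun y => y ^ α * (1 - y) ^ (β + 1) * u.eval y ^ 2 with hG
  set G' : ℝ → ℝ := fun y => α * (jw (α - 1) (β + 1) y * u.eval y ^ 2) +
    (2 * (jw α β y * (u.eval y * ((1 - Polynomial.X) * u').eval y)) -
      (β + 1) * (jw α β y * u.eval y ^ 2)) with hG'
  have hder : ∀ y ∈ Ioo (0:ℝ) 1, HasDerivAt G (G' y) y := by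
    intro y hy
    have hy1 : 0 < 1 - y := by linarith [hy.2]
    have d1 : HasDerivAt (fun y : ℝ => y ^ α) (α * y ^ (α - 1)) y :=
      Real.hasDerivAt_rpow_const (Or.inl hy.1.ne')
    have d2 : HasDerivAt (fun y : ℝ => (1 - y) ^ (β + 1)) (-1 * (β + 1) * (1 - y) ^ (β + 1 - 1)) y := by
      have := ((hasDerivAt_id y).const_sub 1)
      exact this.rpow_const (Or.inl hy1.ne')
    have d3 : HasDerivAt (fun y : ℝ => u.eval y ^ 2) (2 * u.eval y * u'.eval y) y := by
      have := (u.hasDerivAt y).fun_pow 2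
      simpa using this
    have := (d1.mul d2).mul d3
    refine this.congr_deriv ?_
    simp only [hG', jw]
    have e1 : y ^ α = y ^ (α - 1) * y := by
      rw [← rpow_add_one hy.1.ne']; congr 1; ring
    have e2 : (1 - y) ^ (β + 1) = (1 - y) ^ β * (1 - y) := by
      rw [← rpow_add_one hy1.ne']
    have e3 : β + 1 - 1 = β := by ring
    simp only [Pi.mul_apply]
    rw [e3, e2]
    simp
    ring
  have i1 := jw_mul_integrable (a := α - 1) (b := β + 1) (by linarith) (by linarith)
    (g := fun y => u.eval y ^ 2) (by fun_prop)
  have i2 := jw_mul_integrable ha' hb (g := fun y => u.eval y * ((1 - Polynomial.X) * u').eval y) (by fun_prop)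
  have i3 := jw_mul_integrable ha' hb (g := fun y => u.eval y ^ 2) (by fun_prop)
  have hint : IntervalIntegrable G' volume 0 1 :=
    (i1.const_mul α).add ((i2.const_mul 2).sub (i3.const_mul (β + 1)))
  have hcont : ContinuousOn G (Icc 0 1) := by
    have c1 : Continuous fun y : ℝ => y ^ α := Real.continuous_rpow_const ha.le
    have c2 : Continuous fun y : ℝ => (1 - y) ^ (β + 1) :=
      (Real.continuous_rpow_const (by linarith)).comp (continuous_const.sub continuous_id)
    have c3 : Continuous fun y : ℝ => u.eval y ^ 2 := by fun_prop
    exact ((c1.mul c2).mul c3).continuousOn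
  have ftc := intervalIntegral.integral_eq_sub_of_hasDerivAt_of_le zero_le_one hcont hder hint
  have hG0 : G 1 - G 0 = 0 := by
    simp only [hG]
    rw [zero_rpow ha.ne', sub_self, zero_rpow (by linarith)]; simp
  rw [hG0, hG', intervalIntegral.integral_add (i1.const_mul α) ((i2.const_mul 2).sub (i3.const_mul (β + 1))),
    intervalIntegral.integral_sub (i2.const_mul 2) (i3.const_mul (β + 1)),
    intervalIntegral.integral_const_mul, intervalIntegral.integral_const_mul,
    intervalIntegral.integral_const_mul] at ftc
  change α * Lw (α - 1) (β + 1) (fun y => u.eval y ^ 2) + (2 * Lw α β (fun y => u.eval y * ((1 - Polynomial.X) * u').eval y)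
    - (β + 1) * Lw α β (fun y => u.eval y ^ 2)) = 0 at ftc
  rw [h1] at ftc
  field_simp
  linear_combination ftc

theorem jF_ode_eval (n : ℕ) {α β : ℝ} (ha : -1 < α) (y : ℝ) :
    y * (1 - y) * ((jF n α β).derivative.derivative).eval y =
      - (n * (n + α + β + 1)) * (jF n α β).eval y
      - ((α + 1) - (α + β + 2) * y) * ((jF n α β).derivative).eval y := by
  have h := congrArg (Polynomial.eval y) (jF_ode n (α := α) (β := β) ha)
  simp at h
  linear_combination h

/-- Sonin function -/
def jS (n : ℕ) (α β y : ℝ) : ℝ := (jF n α β).eval y ^ 2 +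
  y * (1 - y) * ((jF n α β).derivative).eval y ^ 2 / (n * (n + α + β + 1))

theorem jS_hasDeriv (n : ℕ) {α β : ℝ} (ha : -1 < α) (hl : 0 < (n:ℝ) * (n + α + β + 1)) (y : ℝ) :
    HasDerivAt (jS n α β) (((jF n α β).derivative).eval y ^ 2 / (n * (n + α + β + 1)) *
      (-(2 * α + 1) + 2 * (α + β + 1) * y)) y := by
  have h1 := (jF n α β).hasDerivAt y
  have h2 := ((jF n α β).derivative).hasDerivAt y
  have h3 : HasDerivAt (fun y : ℝ => y * (1 - y)) (1 - 2 * y) y := by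
    have := (hasDerivAt_id y).mul ((hasDerivAt_id y).const_sub 1)
    refine this.congr_deriv ?_
    simp; ring
  have h4 := (h1.fun_pow 2).add ((h3.mul (h2.fun_pow 2)).div_const ((n:ℝ) * (n + α + β + 1)))
  refine h4.congr_deriv ?_
  have ode := jF_ode_eval n (β := β) ha y
  generalize (n:ℝ) * (n + α + β + 1) = l at *
  simp only [Nat.cast_ofNat, Nat.add_one_sub_one, pow_one]
  have hl' := hl.ne'
  field_simp
  linear_combination (2 * ((jF n α β).derivative).eval y) * ode

theorem jF_sq_le_jS (n : ℕ) {α β y : ℝ} (hl : 0 < (n:ℝ) * (n + α + β + 1)) (hy : y ∈ Icc (0:ℝ) 1) :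
    (jF n α β).eval y ^ 2 ≤ jS n α β y := by
  have : 0 ≤ 1 - y := by linarith [hy.2]
  have := hy.1
  unfold jS
  have : 0 ≤ y * (1 - y) * ((jF n α β).derivative).eval y ^ 2 / (n * (n + α + β + 1)) := by positivity
  linarith

theorem jS_antitone (n : ℕ) {α β a b : ℝ} (ha : -1 < α) (hl : 0 < (n:ℝ) * (n + α + β + 1)) (hab : a ≤ b)
    (h : ∀ y ∈ Icc a b, -(2 * α + 1) + 2 * (α + β + 1) * y ≤ 0) : jS n α β b ≤ jS n α β a := by
  have : AntitoneOn (jS n α β) (Icc a b) := by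
    refine antitoneOn_of_deriv_nonpos (convex_Icc a b)
      (fun y _ => (jS_hasDeriv n ha hl y).continuousAt.continuousWithinAt)
      (fun y _ => (jS_hasDeriv n ha hl y).differentiableAt.differentiableWithinAt) ?_
    intro y hy
    rw [interior_Icc] at hy
    rw [(jS_hasDeriv n ha hl y).deriv]
    exact mul_nonpos_of_nonneg_of_nonpos (by positivity) (h y ⟨hy.1.le, hy.2.le⟩)
  exact this (left_mem_Icc.mpr hab) (right_mem_Icc.mpr hab) hab

theorem jS_monotone (n : ℕ) {α β a b : ℝ} (ha : -1 < α) (hl : 0 < (n:ℝ) * (n + α + β + 1)) (hab : a ≤ b)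
    (h : ∀ y ∈ Icc a b, 0 ≤ -(2 * α + 1) + 2 * (α + β + 1) * y) : jS n α β a ≤ jS n α β b := by
  have : MonotoneOn (jS n α β) (Icc a b) := by
    refine monotoneOn_of_deriv_nonneg (convex_Icc a b)
      (fun y _ => (jS_hasDeriv n ha hl y).continuousAt.continuousWithinAt)
      (fun y _ => (jS_hasDeriv n ha hl y).differentiableAt.differentiableWithinAt) ?_
    intro y hy
    rw [interior_Icc] at hy
    rw [(jS_hasDeriv n ha hl y).deriv]
    exact mul_nonneg (by positivity) (h y ⟨hy.1.le, hy.2.le⟩)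
  exact this (left_mem_Icc.mpr hab) (right_mem_Icc.mpr hab) hab

theorem jF_le_one (n : ℕ) {α β y : ℝ} (hb : -(1/2) ≤ β) (hab : β ≤ α) (hy : y ∈ Icc (0:ℝ) 1) :
    |(jF n α β).eval y| ≤ 1 := by
  rw [← sq_le_one_iff_abs_le_one]
  rcases Nat.eq_zero_or_pos n with h0 | hn
  · subst h0
    rw [jF_eval]; simp [rf_zero]
  have hn' : (1:ℝ) ≤ n := by exact_mod_cast hn
  have hl : 0 < (n:ℝ) * (n + α + β + 1) := by
    apply mul_pos <;> linarith
  have ha : -1 < α := by linarith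
  refine (jF_sq_le_jS n hl hy).trans ?_
  rcases le_total (-(2 * α + 1) + 2 * (α + β + 1) * y) 0 with h | h
  · refine (jS_antitone n ha hl hy.1 ?_).trans ?_
    · intro z hz
      nlinarith [hz.2]
    · unfold jS; rw [jF_zero]; simp
  · refine (jS_monotone n ha hl hy.2 ?_).trans ?_
    · intro z hz
      nlinarith [hz.1]
    · unfold jS; rw [jF_one n α β ha]
      simp only [sub_self, mul_zero, zero_mul, zero_div, add_zero]
      rw [div_pow, mul_pow, ← pow_mul, mul_comm n 2, pow_mul]
      simp only [even_two, Even.neg_pow, one_pow, one_mul]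
      have p1 := rf_pos (show 0 < α + 1 by linarith) n
      have p2 := rf_pos (show 0 < β + 1 by linarith) n
      rw [div_le_one (by positivity)]
      exact pow_le_pow_left₀ p2.le (rf_mono (by linarith) (by linarith) n) 2

theorem barrier {φ φ' : ℝ → ℝ} {b : ℝ} (hd : ∀ y, HasDerivAt φ (φ' y) y) (h0 : 0 < φ 0)
    (H : ∀ y ∈ Ioc 0 b, (∀ z ∈ Ico 0 y, 0 < φ z) → φ y = 0 → 0 < φ' y) :
    ∀ y ∈ Icc 0 b, 0 < φ y := by
  by_contra! hcon
  obtain ⟨y0, hy0, hy0'⟩ := hcon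
  have hc : Continuous φ := continuous_iff_continuousAt.mpr fun y => (hd y).continuousAt
  have hK : IsCompact (Icc 0 b ∩ φ ⁻¹' Iic 0) := isCompact_Icc.inter_right (isClosed_Iic.preimage hc)
  obtain ⟨s, hs, hl⟩ := hK.exists_isLeast ⟨y0, hy0, hy0'⟩
  have hs0 : φ s ≤ 0 := hs.2
  have hpos : ∀ z ∈ Ico 0 s, 0 < φ z := by
    intro z hz
    by_contra! hz'
    exact absurd (hl ⟨⟨hz.1, hz.2.le.trans hs.1.2⟩, hz'⟩) (not_le.mpr hz.2)
  have hspos : 0 < s := by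
    rcases hs.1.1.lt_or_eq with h | h
    · exact h
    · rw [← h] at hs0; linarith
  have hmem : Ioo 0 s ∈ nhdsWithin s (Iio s) := Ioo_mem_nhdsLT hspos
  have hse : φ s = 0 := by
    refine le_antisymm hs0 ?_
    refine ge_of_tendsto (hc.continuousAt.continuousWithinAt (s := Iio s)) ?_
    filter_upwards [hmem] with z hz
    exact (hpos z ⟨hz.1.le, hz.2⟩).le
  have hp := H s ⟨hspos, hs.1.2⟩ hpos hse
  have ht := (hasDerivAt_iff_tendsto_slope.mp (hd s)).mono_left
    (nhdsWithin_mono s (show Iio s ⊆ {s}ᶜ from fun z hz => ne_of_lt hz))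
  have : φ' s ≤ 0 := by
    refine le_of_tendsto ht ?_
    filter_upwards [hmem] with z hz
    rw [slope_def_field, hse, sub_zero]
    exact div_nonpos_of_nonneg_of_nonpos (hpos z ⟨hz.1.le, hz.2⟩).le (by linarith [hz.2])
  linarith

set_option maxHeartbeats 1000000 in
theorem jF_decay (n : ℕ) (hn : 1 ≤ n) {α β y1 : ℝ} (hb : -(1/2) ≤ β) (hab : β ≤ α) (h0 : 0 < y1)
    (h1 : y1 ≤ 1 / 16) (h2 : 8 * ((n:ℝ) * (n + α + β + 1)) * y1 ≤ (α + 1) ^ 2) {y : ℝ}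
    (hy : y ∈ Icc y1 (1/2)) :
    (jF n α β).eval y ^ 2 ≤ 3 * Real.exp (-((n:ℝ) * (n + α + β + 1) / (α + 1) * y1)) := by
  have hn' : (1:ℝ) ≤ n := by exact_mod_cast hn
  have ha : -1 < α := by linarith
  have ha1 : 0 < α + 1 := by linarith
  have hl : 0 < (n:ℝ) * (n + α + β + 1) := by apply mul_pos <;> linarith
  have hdz := jF_deriv_zero n α β
  have hz := jF_zero n α β
  have ode := fun y => jF_ode_eval n (α := α) (β := β) ha y
  have hu := fun y => (jF n α β).hasDerivAt y
  have hu' := fun y => ((jF n α β).derivative).hasDerivAt y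
  set l := (n:ℝ) * (n + α + β + 1) with hldef
  set u : ℝ → ℝ := fun y => (jF n α β).eval y with hudef
  set v : ℝ → ℝ := fun y => ((jF n α β).derivative).eval y with hvdef
  set w : ℝ → ℝ := fun y => ((jF n α β).derivative.derivative).eval y with hwdef
  change ∀ y, HasDerivAt u (v y) y at hu
  change ∀ y, HasDerivAt v (w y) y at hu'
  change ∀ y, y * (1 - y) * w y = -l * u y - ((α + 1) - (α + β + 2) * y) * v y at ode
  change u 0 = 1 at hz
  change v 0 = _ at hdz
  change u y ^ 2 ≤ _
  set μ := l / (α + 1) with hμ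
  have hμp : 0 < μ := by positivity
  have hμa : μ * (α + 1) = l := by rw [hμ]; field_simp
  have hv0 : v 0 = -μ := by rw [hdz, hμ, neg_div]
  have hμ8 : 8 * μ * y1 ≤ α + 1 := by
    rw [hμ, mul_div_assoc', div_mul_eq_mul_div, div_le_iff₀ ha1]; nlinarith
  -- exponential integrating
  have hexp : ∀ (A : ℝ) (y : ℝ), HasDerivAt (fun y => Real.exp (A * y) * u y)
      (Real.exp (A * y) * (A * u y + v y)) y := by
    intro A y
    have e1 : HasDerivAt (fun y : ℝ => Real.exp (A * y)) (Real.exp (A * y) * (A * 1)) y :=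
      ((hasDerivAt_id y).const_mul A).exp
    refine (e1.mul (hu y)).congr_deriv ?_
    ring
  have upos : ∀ b, 0 ≤ b → (∀ z ∈ Ico 0 b, 0 < 4 * μ * u z + v z) → 0 < u b := by
    intro b hb0 hb
    have : MonotoneOn (fun y => Real.exp (4 * μ * y) * u y) (Icc 0 b) := by
      refine monotoneOn_of_deriv_nonneg (convex_Icc 0 b)
        (fun y _ => (hexp _ y).continuousAt.continuousWithinAt)
        (fun y _ => (hexp _ y).differentiableAt.differentiableWithinAt) ?_
      intro z hz
      rw [interior_Icc] at hz
      rw [(hexp _ z).deriv]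
      exact (mul_pos (Real.exp_pos _) (hb z ⟨hz.1.le, hz.2⟩)).le
    have h := this (left_mem_Icc.mpr hb0) (right_mem_Icc.mpr hb0) hb0
    simp only [mul_zero, Real.exp_zero, hz, one_mul] at h
    by_contra! hneg
    have := mul_nonpos_of_nonneg_of_nonpos (Real.exp_pos (4 * μ * b)).le hneg
    linarith
  have hφ : ∀ y ∈ Icc 0 y1, 0 < 4 * μ * u y + v y := by
    refine barrier (φ := fun y => 4 * μ * u y + v y) (φ' := fun y => 4 * μ * v y + w y)
      (fun y => ((hu y).const_mul _).add (hu' y)) ?_ ?_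
    · simp only [hz, hv0]; linarith
    · intro z hz hzp hz0
      beta_reduce at hz0 hzp
      have hup := upos z hz.1.le hzp
      have hv : v z = -(4 * μ * u z) := by linarith
      have hz1 : 0 < z * (1 - z) := mul_pos hz.1 (by linarith [hz.2])
      have key : z * (1 - z) * (4 * μ * v z + w z) =
          u z * (3 * l - (16 * μ ^ 2 * z * (1 - z) + 4 * μ * (α + β + 2) * z)) := by
        rw [mul_add, ode z, hv, ← hμa]; ring
      have i1 : 16 * μ ^ 2 * z * (1 - z) ≤ 2 * l := by
        have : 16 * μ ^ 2 * z * (1 - z) ≤ 16 * μ ^ 2 * y1 := by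
          have : z * (1 - z) ≤ y1 := by nlinarith [hz.1, hz.2]
          have : 16 * μ ^ 2 * (z * (1 - z)) ≤ 16 * μ ^ 2 * y1 := by gcongr
          linarith
        have : 16 * μ ^ 2 * y1 ≤ 2 * (μ * (α + 1)) := by
          nlinarith [mul_le_mul_of_nonneg_left hμ8 hμp.le]
        linarith
      have i2 : 4 * μ * (α + β + 2) * z ≤ l / 2 := by
        have : 4 * μ * (α + β + 2) * z ≤ 4 * μ * (2 * (α + 1)) * (1 / 16) := by
          have := hz.1.le
          have : z ≤ 1 / 16 := hz.2.trans h1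
          have : α + β + 2 ≤ 2 * (α + 1) := by linarith
          gcongr
        nlinarith
      have : 0 < z * (1 - z) * (4 * μ * v z + w z) := by
        rw [key]; apply mul_pos hup; linarith
      exact (pos_iff_pos_of_mul_pos this).mp hz1
  have hup : ∀ y ∈ Icc 0 y1, 0 < u y := fun y hy => upos y hy.1 fun z hz => hφ z ⟨hz.1, hz.2.le.trans hy.2⟩
  have hψ : ∀ y ∈ Icc 0 y1, 0 < -(μ / 2 * u y + v y) := by
    refine barrier (φ := fun y => -(μ / 2 * u y + v y)) (φ' := fun y => -(μ / 2 * v y + w y))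
      (fun y => (((hu y).const_mul _).add (hu' y)).neg) ?_ ?_
    · simp only [hz, hv0]; linarith
    · intro z hz hzp hz0
      beta_reduce at hz0 hzp
      have hup := hup z ⟨hz.1.le, hz.2⟩
      have hv : v z = -(μ / 2 * u z) := by linarith
      have hz1 : 0 < z * (1 - z) := mul_pos hz.1 (by linarith [hz.2])
      have key : z * (1 - z) * (-(μ / 2 * v z + w z)) =
          u z * (l / 2 + (μ ^ 2 / 4 * (z * (1 - z)) + μ / 2 * (α + β + 2) * z)) := by
        have := ode z
        rw [hv, ← hμa] at this
        rw [hv, ← hμa]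
        linear_combination -this
      have : 0 < z * (1 - z) * (-(μ / 2 * v z + w z)) := by
        rw [key]; apply mul_pos hup
        have : 0 < α + β + 2 := by linarith
        have := hz.1
        positivity
      exact (pos_iff_pos_of_mul_pos this).mp hz1
  have hule : u y1 ≤ Real.exp (-(μ / 2 * y1)) := by
    have : AntitoneOn (fun y => Real.exp (μ / 2 * y) * u y) (Icc 0 y1) := by
      refine antitoneOn_of_deriv_nonpos (convex_Icc 0 y1)
        (fun y _ => (hexp _ y).continuousAt.continuousWithinAt)
        (fun y _ => (hexp _ y).differentiableAt.differentiableWithinAt) ?_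
      intro z hz
      rw [interior_Icc] at hz
      rw [(hexp _ z).deriv]
      have := hψ z ⟨hz.1.le, hz.2.le⟩
      exact mul_nonpos_of_nonneg_of_nonpos (Real.exp_pos _).le (by linarith)
    have h := this (left_mem_Icc.mpr h0.le) (right_mem_Icc.mpr h0.le) h0.le
    simp only [mul_zero, Real.exp_zero, hz, one_mul] at h
    rw [Real.exp_neg, ← one_div, le_div_iff₀ (Real.exp_pos _)]; linarith
  have hy1m : y1 ∈ Icc 0 y1 := right_mem_Icc.mpr h0.le
  have hS : jS n α β y1 ≤ 3 * u y1 ^ 2 := by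
    change u y1 ^ 2 + y1 * (1 - y1) * v y1 ^ 2 / l ≤ _
    have p1 := hφ y1 hy1m
    have p2 := hψ y1 hy1m
    have p3 := hup y1 hy1m
    have hv2 : v y1 ^ 2 ≤ (4 * μ * u y1) ^ 2 := by
      apply sq_le_sq'
      · linarith
      · have : 0 < μ / 2 * u y1 := by positivity
        have : 0 < 4 * μ * u y1 := by positivity
        linarith
    have : y1 * (1 - y1) * v y1 ^ 2 / l ≤ 2 * u y1 ^ 2 := by
      rw [div_le_iff₀ hl]
      have a1 : y1 * (1 - y1) * v y1 ^ 2 ≤ y1 * (4 * μ * u y1) ^ 2 := by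
        have : y1 * (1 - y1) ≤ y1 := by nlinarith
        gcongr
      have a2 : y1 * (4 * μ * u y1) ^ 2 = (8 * μ * y1) * (2 * μ * u y1 ^ 2) := by ring
      have a3 : (8 * μ * y1) * (2 * μ * u y1 ^ 2) ≤ (α + 1) * (2 * μ * u y1 ^ 2) := by gcongr
      rw [← hμa]; nlinarith
    linarith
  have hSy : u y ^ 2 ≤ jS n α β y := jF_sq_le_jS n hl ⟨h0.le.trans hy.1, by linarith [hy.2]⟩
  have hSS : jS n α β y ≤ jS n α β y1 := by
    refine jS_antitone n ha hl hy.1 ?_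
    intro z hz
    have hz2 : z ≤ 1 / 2 := hz.2.trans hy.2
    have := mul_le_mul_of_nonneg_left hz2 (show 0 ≤ α + β + 1 by linarith)
    linarith
  have hfin : u y1 ^ 2 ≤ Real.exp (-(μ * y1)) := by
    have : Real.exp (-(μ * y1)) = Real.exp (-(μ / 2 * y1)) ^ 2 := by
      rw [← Real.exp_nat_mul]; congr 1; push_cast; ring
    rw [this]
    exact pow_le_pow_left₀ (hup y1 hy1m).le hule 2
  linarith

instance sphMeasure_prob (d : ℕ) : IsProbabilityMeasure (sphMeasure d) := by
  constructor
  unfold sphMeasure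
  rw [Measure.smul_apply, smul_eq_mul]
  refine ENNReal.inv_mul_cancel ?_ (measure_ne_top _ _)
  rw [Ne, Measure.measure_univ_eq_zero]
  exact Measure.toSphere_ne_zero _

theorem sph_integrable {d : ℕ} {F : Sph d → ℝ} (hF : Continuous F) : Integrable F (sphMeasure d) :=
  hF.integrable_of_hasCompactSupport (HasCompactSupport.of_compactSpace F)

theorem polar_int {d : ℕ} (F : EuclideanSpace ℝ (Fin (d + 1)) → ℝ) (k : ℝ → ℝ) :
    ∫ x : EuclideanSpace ℝ (Fin (d + 1)), F (‖x‖⁻¹ • x) * k ‖x‖ =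
      (∫ y : Sph d, F y ∂(volume : Measure (EuclideanSpace ℝ (Fin (d + 1)))).toSphere) *
        ∫ r in Ioi (0:ℝ), r ^ d * k r := by
  have hdim : Module.finrank ℝ (EuclideanSpace ℝ (Fin (d + 1))) - 1 = d := by simp
  calc _ = ∫ x : ({(0)}ᶜ : Set (EuclideanSpace ℝ (Fin (d + 1)))), F (‖x.1‖⁻¹ • x.1) * k ‖x.1‖
        ∂(volume.comap Subtype.val) := by
        rw [integral_subtype_comap (measurableSet_singleton _).compl fun x ↦ F (‖x‖⁻¹ • x) * k ‖x‖,
          restrict_compl_singleton]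
    _ = ∫ x, F x.1 * k x.2 ∂(volume : Measure (EuclideanSpace ℝ (Fin (d + 1)))).toSphere.prod
          (.volumeIoiPow d) := by
        have := (volume : Measure (EuclideanSpace ℝ (Fin (d + 1)))).measurePreserving_homeomorphUnitSphereProd.integral_comp
          (Homeomorph.measurableEmbedding _)
          (g := fun x : Sph d × Ioi (0:ℝ) => F x.1 * k x.2)
        rw [hdim] at this
        rw [← this]
        simp
    _ = _ := by
        rw [integral_prod_mul (fun y : Sph d => F y) (fun r : Ioi (0:ℝ) => k r)]
        congr 1
        unfold Measure.volumeIoiPow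
        simp only [ENNReal.ofReal]
        rw [integral_withDensity_eq_integral_smul (by fun_prop)]
        rw [← integral_subtype_comap measurableSet_Ioi (fun r => r ^ d * k r)]
        refine integral_congr_ae (Filter.Eventually.of_forall fun r => ?_)
        change (Real.toNNReal (r.1 ^ d)) • k r.1 = r.1 ^ d * k r.1
        have : 0 ≤ r.1 ^ d := pow_nonneg (le_of_lt r.2) d
        rw [NNReal.smul_def, Real.coe_toNNReal _ this, smul_eq_mul]

/-- half of the surface measure -/
def kap (d : ℕ) : ℝ := ((volume : Measure (EuclideanSpace ℝ (Fin (d + 1)))).toSphere Set.univ).toReal / 2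

theorem kap_pos (d : ℕ) : 0 < kap d := by
  unfold kap
  refine div_pos (ENNReal.toReal_pos ?_ (measure_ne_top _ _)) two_pos
  rw [Ne, Measure.measure_univ_eq_zero]
  exact Measure.toSphere_ne_zero _

theorem toSphere_int (d : ℕ) (F : Sph d → ℝ) :
    ∫ y : Sph d, F y ∂(volume : Measure (EuclideanSpace ℝ (Fin (d + 1)))).toSphere =
      2 * kap d * ∫ y, F y ∂sphMeasure d := by
  unfold sphMeasure
  rw [integral_smul_measure, ENNReal.toReal_inv, smul_eq_mul]
  have h := kap_pos d
  unfold kap at *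
  have : ((volume : Measure (EuclideanSpace ℝ (Fin (d + 1)))).toSphere Set.univ).toReal ≠ 0 := by
    intro h0; rw [h0] at h; simp at h
  field_simp

theorem radial_int (q : ℕ) : ∫ r in Ioi (0:ℝ), r ^ q * Real.exp (-r ^ 2) = Real.Gamma (((q:ℝ) + 1) / 2) / 2 := by
  have := integral_rpow_mul_exp_neg_rpow (p := 2) (q := q) two_pos (by
    have : (0:ℝ) ≤ q := by positivity
    linarith)
  rw [← (by ring : 1 / 2 * Real.Gamma (((q:ℝ) + 1) / 2) = Real.Gamma (((q:ℝ) + 1) / 2) / 2), ← this]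
  refine setIntegral_congr_fun measurableSet_Ioi fun r _ => ?_
  simp

theorem gauss_sph {d : ℕ} (h : EuclideanSpace ℝ (Fin (d + 1)) → ℝ) (a : ℕ)
    (hh : ∀ (c : ℝ) x, h (c • x) = c ^ a * h x) :
    ∫ x : EuclideanSpace ℝ (Fin (d + 1)), h x * Real.exp (-‖x‖ ^ 2) =
      kap d * Real.Gamma (((d:ℝ) + a + 1) / 2) * ∫ y : Sph d, h y ∂sphMeasure d := by
  have := polar_int h (fun r => r ^ a * Real.exp (-r ^ 2))
  have e : ∀ᵐ x : EuclideanSpace ℝ (Fin (d + 1)), h (‖x‖⁻¹ • x) * (‖x‖ ^ a * Real.exp (-‖x‖ ^ 2)) =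
      h x * Real.exp (-‖x‖ ^ 2) := by
    have h0 : ∀ᵐ x : EuclideanSpace ℝ (Fin (d + 1)), x ≠ 0 := by
      rw [ae_iff]; simp
    filter_upwards [h0] with x hx
    have : ‖x‖ ≠ 0 := norm_ne_zero_iff.mpr hx
    rw [hh, inv_pow]; field_simp
  rw [integral_congr_ae e] at this
  rw [this, toSphere_int]
  have e2 : ∀ r : ℝ, r ^ d * (r ^ a * Real.exp (-r ^ 2)) = r ^ (d + a) * Real.exp (-r ^ 2) := by
    intro r; ring
  simp_rw [e2]
  rw [radial_int]; push_cast; ring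

theorem sph_rot {d : ℕ} (T : EuclideanSpace ℝ (Fin (d + 1)) ≃ₗᵢ[ℝ] EuclideanSpace ℝ (Fin (d + 1)))
    (F : EuclideanSpace ℝ (Fin (d + 1)) → ℝ) :
    ∫ y : Sph d, F (T y) ∂sphMeasure d = ∫ y : Sph d, F y ∂sphMeasure d := by
  have h1 := polar_int F (fun r => Real.exp (-r ^ 2))
  have h2 := polar_int (fun x => F (T x)) (fun r => Real.exp (-r ^ 2))
  have h3 := (LinearIsometryEquiv.measurePreserving T).integral_comp
    T.toHomeomorph.measurableEmbedding
    (g := fun x => F (‖x‖⁻¹ • x) * Real.exp (-‖x‖ ^ 2))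
  have h4 : (∫ x : EuclideanSpace ℝ (Fin (d + 1)), F (T (‖x‖⁻¹ • x)) * Real.exp (-‖x‖ ^ 2)) =
      ∫ x : EuclideanSpace ℝ (Fin (d + 1)), F (‖x‖⁻¹ • x) * Real.exp (-‖x‖ ^ 2) := by
    rw [← h3]; simp
  rw [h4, h1, toSphere_int, toSphere_int, radial_int] at h2
  have k1 := (kap_pos d).ne'
  have k2 : Real.Gamma (((d:ℝ) + 1) / 2) ≠ 0 := (Real.Gamma_pos_of_pos (by positivity)).ne'
  field_simp at h2
  exact h2.symm

theorem gauss_split {d : ℕ} (A : ℝ → ℝ) (Q : (Fin d → ℝ) → ℝ) :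
    ∫ x : EuclideanSpace ℝ (Fin (d + 1)), A (x 0) * Q (fun i => x i.succ) * Real.exp (-‖x‖ ^ 2) =
      (∫ t, A t * Real.exp (-t ^ 2)) * ∫ z : Fin d → ℝ, Q z * Real.exp (-∑ i, z i ^ 2) := by
  rw [← (PiLp.volume_preserving_toLp (Fin (d + 1))).integral_comp
    (MeasurableEquiv.toLp 2 (Fin (d+1) → ℝ)).measurableEmbedding]
  rw [← integral_prod_mul]
  have := (volume_preserving_piFinSuccAbove (fun _ : Fin (d + 1) => ℝ) 0).integral_comp
    (MeasurableEquiv.measurableEmbedding _)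
    (g := fun z : ℝ × (Fin d → ℝ) => A z.1 * Real.exp (-z.1 ^ 2) * (Q z.2 * Real.exp (-∑ i, z.2 i ^ 2)))
  rw [← Measure.volume_eq_prod, ← this]
  refine integral_congr_ae (Filter.Eventually.of_forall fun x => ?_)
  simp only [MeasurableEquiv.piFinSuccAbove_apply, Fin.insertNthEquiv_zero, Fin.consEquiv_symm_apply, EuclideanSpace.norm_sq_eq]
  rw [Fin.sum_univ_succ]
  simp only [Real.norm_eq_abs, sq_abs, Fin.tail]
  rw [neg_add, Real.exp_add]
  change _ = A (x 0) * rexp (-x 0 ^ 2) * (Q (fun i => x i.succ) * _)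
  ring_nf

abbrev Eu (d : ℕ) := EuclideanSpace ℝ (Fin (d + 1))

theorem gam_odd (m : ℕ) (hm : Odd m) : ∫ t : ℝ, t ^ m * Real.exp (-t ^ 2) = 0 := by
  have h := integral_neg_eq_self (fun t : ℝ => t ^ m * Real.exp (-t ^ 2)) volume
  have h2 : (∫ t : ℝ, (-t) ^ m * Real.exp (-(-t) ^ 2)) = - ∫ t : ℝ, t ^ m * Real.exp (-t ^ 2) := by
    rw [← integral_neg]
    congr 1; ext t
    rw [hm.neg_pow]; simp
  rw [h2] at h; linarith

theorem tail_sq_int (e b : ℕ) : ∫ z : Fin (e + 1) → ℝ, (∑ i, z i ^ 2) ^ b * Real.exp (-∑ i, z i ^ 2) =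
    kap e * Real.Gamma (((e:ℝ) + 1) / 2 + b) := by
  have h := gauss_sph (d := e) (fun x => (‖x‖ ^ 2) ^ b) (2 * b) (by
    intro c x; rw [norm_smul, mul_pow, mul_pow, Real.norm_eq_abs, sq_abs, pow_mul])
  rw [← (PiLp.volume_preserving_toLp (Fin (e + 1))).integral_comp
    (MeasurableEquiv.toLp 2 (Fin (e+1) → ℝ)).measurableEmbedding] at h
  have e1 : (∫ y : Sph e, (‖(y : Eu e)‖ ^ 2) ^ b ∂sphMeasure e) = 1 := by
    have : ∀ y : Sph e, (‖(y : Eu e)‖ ^ 2) ^ b = 1 := by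
      intro y; rw [norm_eq_of_mem_sphere y]; simp
    simp_rw [this]; simp
  rw [e1, mul_one] at h
  have e2 : ((e:ℝ) + (2 * b : ℕ) + 1) / 2 = ((e:ℝ) + 1) / 2 + b := by push_cast; ring
  rw [e2] at h
  rw [← h]
  simp only [EuclideanSpace.norm_sq_eq, Real.norm_eq_abs, sq_abs]

theorem sph_coord_sq {d : ℕ} (y : Sph d) : ∑ i : Fin d, (y : Eu d) i.succ ^ 2 = 1 - (y : Eu d) 0 ^ 2 := by
  have h := norm_eq_of_mem_sphere y
  have h2 := EuclideanSpace.norm_sq_eq (y : Eu d)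
  rw [h, Fin.sum_univ_succ] at h2
  simp only [Real.norm_eq_abs, sq_abs] at h2
  linarith

theorem gauss_tail {d : ℕ} (m a : ℕ) (Q : (Fin d → ℝ) → ℝ) (hQ : ∀ (c : ℝ) z, Q (fun i => c * z i) = c ^ a * Q z) :
    kap d * Real.Gamma (((d:ℝ) + (m + a : ℕ) + 1) / 2) *
      ∫ y : Sph d, (y : Eu d) 0 ^ m * Q (fun i => (y : Eu d) i.succ) ∂sphMeasure d =
    (∫ t, t ^ m * Real.exp (-t ^ 2)) * ∫ z : Fin d → ℝ, Q z * Real.exp (-∑ i, z i ^ 2) := by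
  rw [← gauss_split (fun t => t ^ m) Q]
  rw [gauss_sph (d := d) (fun x => x 0 ^ m * Q (fun i => x i.succ)) (m + a)]
  intro c x
  have : (fun i : Fin d => (c • x) i.succ) = fun i => c * x i.succ := by ext i; simp
  rw [this, hQ]
  simp; ring

theorem gGamma_ne (d m : ℕ) : kap d * Real.Gamma (((d:ℝ) + (m : ℕ) + 1) / 2) ≠ 0 :=
  mul_ne_zero (kap_pos d).ne' (Real.Gamma_pos_of_pos (by positivity)).ne'

theorem mono_red (e : ℕ) (s : Fin (e + 1) → ℕ) : ∃ (c : ℝ) (b : ℕ), 2 * b ≤ ∑ i, s i ∧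
    c * 0 ^ b = ∏ i, (0:ℝ) ^ s i ∧ ∀ m : ℕ,
    ∫ y : Sph (e + 1), (y : Eu (e + 1)) 0 ^ m * ∏ i, (y : Eu (e+1)) i.succ ^ s i ∂sphMeasure (e + 1) =
      c * ∫ y : Sph (e + 1), (y : Eu (e + 1)) 0 ^ m * (1 - (y : Eu (e+1)) 0 ^ 2) ^ b ∂sphMeasure (e + 1) := by
  have hQ : ∀ (c : ℝ) (z : Fin (e+1) → ℝ), (fun z : Fin (e+1) → ℝ => ∏ i, z i ^ s i) (fun i => c * z i) = c ^ (∑ i, s i) * ∏ i, z i ^ s i := by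
    intro c z
    simp only [mul_pow, Finset.prod_mul_distrib, Finset.prod_pow_eq_pow_sum]
  have key := fun m => gauss_tail (d := e+1) m (∑ i, s i) (fun z => ∏ i, z i ^ s i) hQ
  have hW : (∫ z : Fin (e+1) → ℝ, (∏ i, z i ^ s i) * Real.exp (-∑ i, z i ^ 2)) =
      ∏ i, ∫ t : ℝ, t ^ s i * Real.exp (-t ^ 2) := by
    rw [← integral_fintype_prod_volume_eq_prod]
    congr 1; ext z
    rw [Finset.prod_mul_distrib, ← Real.exp_sum, Finset.sum_neg_distrib]
  rcases Nat.even_or_odd' (∑ i, s i) with ⟨b, hb | hb⟩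
  · set W := (∫ z : Fin (e+1) → ℝ, (∏ i, z i ^ s i) * Real.exp (-∑ i, z i ^ 2)) with hWd
    have hV := tail_sq_int e b
    have hVpos : 0 < kap e * Real.Gamma (((e:ℝ) + 1) / 2 + b) :=
      mul_pos (kap_pos e) (Real.Gamma_pos_of_pos (by positivity))
    set V := ∫ z : Fin (e + 1) → ℝ, (∑ i, z i ^ 2) ^ b * Real.exp (-∑ i, z i ^ 2) with hVd
    have hV0 : V ≠ 0 := by rw [hV]; exact hVpos.ne'
    refine ⟨W / V, b, hb.ge, ?_, ?_⟩
    · by_cases h0 : ∀ i, s i = 0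
      · have hb0 : b = 0 := by
          have : ∑ i, s i = 0 := Finset.sum_eq_zero fun i _ => h0 i
          omega
        have : W = V := by rw [hWd, hVd, hb0]; simp [h0]
        rw [this, div_self hV0, hb0]; simp [h0]
      · push Not at h0
        obtain ⟨i, hi⟩ := h0
        have hb0 : b ≠ 0 := by
          have : s i ≤ ∑ i, s i := Finset.single_le_sum (fun _ _ => Nat.zero_le _) (Finset.mem_univ i)
          omega
        rw [zero_pow hb0, mul_zero, eq_comm]
        exact Finset.prod_eq_zero (Finset.mem_univ i) (zero_pow hi)
    · intro m
      have k2 := gauss_tail (d := e + 1) m (2 * b) (fun z => (∑ i, z i ^ 2) ^ b) (by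
        intro c z; simp only [mul_pow]; rw [← Finset.mul_sum, mul_pow, pow_mul])
      have k1 := key m
      rw [hb] at k1
      have e1 : ∀ y : Sph (e+1), (fun z : Fin (e+1) → ℝ => (∑ i, z i ^ 2) ^ b) (fun i => (y : Eu (e+1)) i.succ) =
          (1 - (y : Eu (e+1)) 0 ^ 2) ^ b := by
        intro y; rw [← sph_coord_sq]
      simp_rw [e1] at k2
      have hne := gGamma_ne (e + 1) (m + 2 * b)
      apply mul_left_cancel₀ hne
      change _ * _ = _ * W at k1
      change _ * _ = _ * V at k2
      rw [k1, mul_left_comm, k2]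
      field_simp
  · obtain ⟨i, hi⟩ : ∃ i, Odd (s i) := by
      by_contra! hcon
      have : Even (∑ i, s i) := Finset.even_sum _ fun i _ => Nat.not_odd_iff_even.mp (hcon i)
      rw [hb] at this
      exact (Nat.not_even_two_mul_add_one b) this
    rw [Finset.prod_eq_zero (Finset.mem_univ i) (gam_odd _ hi)] at hW
    refine ⟨0, b, by omega, ?_, ?_⟩
    · rw [zero_mul, eq_comm]
      exact Finset.prod_eq_zero (Finset.mem_univ i) (zero_pow (by rintro h; rw [h] at hi; simp at hi))
    · intro m
      have k1 := key m
      rw [hW, mul_zero] at k1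
      rw [zero_mul]
      exact (mul_eq_zero.mp k1).resolve_left (gGamma_ne _ _)

theorem cont_coord {d : ℕ} (i : Fin (d+1)) : Continuous fun y : Sph d => (y : Eu d) i := by
  fun_prop

theorem sph_red_e0 (e : ℕ) (p : MvPolynomial (Fin (e + 1 + 1)) ℝ) : ∃ P : Polynomial ℝ,
    P.natDegree ≤ p.totalDegree ∧ P.eval 1 = MvPolynomial.eval (fun i => if i = 0 then 1 else 0) p ∧
    ∀ g : Polynomial ℝ,
      ∫ y : Sph (e + 1), MvPolynomial.eval (fun i => (y : Eu (e+1)) i) p * g.eval ((y : Eu (e+1)) 0) ∂sphMeasure (e + 1) =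
      ∫ y : Sph (e + 1), P.eval ((y : Eu (e+1)) 0) * g.eval ((y : Eu (e+1)) 0) ∂sphMeasure (e + 1) := by
  choose c b hb h0 hm using mono_red e
  set P : (Fin (e+1+1) →₀ ℕ) → Polynomial ℝ := fun s =>
    Polynomial.C (c fun i => s i.succ) * (Polynomial.X ^ (s 0) * (1 - Polynomial.X ^ 2) ^ (b fun i => s i.succ)) with hP
  refine ⟨∑ s ∈ p.support, Polynomial.C (p.coeff s) * P s, ?_, ?_, ?_⟩
  · refine Polynomial.natDegree_sum_le_of_forall_le _ _ fun s hs => ?_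
    refine (Polynomial.natDegree_C_mul_le _ _).trans ((Polynomial.natDegree_C_mul_le _ _).trans ?_)
    have h1 := MvPolynomial.le_totalDegree hs
    rw [Finsupp.sum_fintype _ _ (fun _ => rfl), Fin.sum_univ_succ] at h1
    have h2 : ((1 - Polynomial.X ^ 2 : Polynomial ℝ) ^ (b fun i => s i.succ)).natDegree ≤ (b fun i => s i.succ) * 2 := by
      refine Polynomial.natDegree_pow_le.trans ?_
      gcongr
      compute_degree
    have h3 := hb fun i => s i.succ
    refine Polynomial.natDegree_mul_le.trans ?_
    rw [Polynomial.natDegree_X_pow]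
    omega
  · rw [Polynomial.eval_finsetSum, MvPolynomial.eval_eq']
    refine Finset.sum_congr rfl fun s _ => ?_
    rw [Fin.prod_univ_succ]
    simp only [hP, Polynomial.eval_mul, Polynomial.eval_C, Polynomial.eval_pow, Polynomial.eval_X, Polynomial.eval_sub, Polynomial.eval_one,
      one_pow, sub_self, one_mul, if_true, Fin.succ_ne_zero, if_false]
    rw [h0]
  · intro g
    have hX : ∀ (s : Fin (e+1+1) →₀ ℕ) (k : ℕ), ∫ y : Sph (e + 1), (∏ i, (y : Eu (e+1)) i ^ s i) * (y : Eu (e+1)) 0 ^ k ∂sphMeasure (e + 1) =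
        ∫ y : Sph (e + 1), (P s).eval ((y : Eu (e+1)) 0) * (y : Eu (e+1)) 0 ^ k ∂sphMeasure (e + 1) := by
      intro s k
      have := hm (fun i => s i.succ) (s 0 + k)
      have e1 : ∀ y : Sph (e+1), (∏ i, (y : Eu (e+1)) i ^ s i) * (y : Eu (e+1)) 0 ^ k =
          (y : Eu (e+1)) 0 ^ (s 0 + k) * ∏ i : Fin (e+1), (y : Eu (e+1)) i.succ ^ s i.succ := by
        intro y; rw [Fin.prod_univ_succ]; ring
      simp_rw [e1]
      rw [this, ← integral_const_mul]
      refine integral_congr_ae (Filter.Eventually.of_forall fun y => ?_)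
      simp [hP]; ring
    have e1 : ∀ y : Sph (e+1), MvPolynomial.eval (fun i => (y : Eu (e+1)) i) p * g.eval ((y : Eu (e+1)) 0) =
        ∑ s ∈ p.support, ∑ k ∈ Finset.range (g.natDegree + 1), (p.coeff s * g.coeff k) * ((∏ i, (y : Eu (e+1)) i ^ s i) * (y : Eu (e+1)) 0 ^ k) := by
      intro y
      rw [MvPolynomial.eval_eq', Polynomial.eval_eq_sum_range, Finset.sum_mul_sum]
      refine Finset.sum_congr rfl fun s _ => Finset.sum_congr rfl fun k _ => by ring
    have e2 : ∀ y : Sph (e+1), (∑ s ∈ p.support, Polynomial.C (p.coeff s) * P s).eval ((y : Eu (e+1)) 0) * g.eval ((y : Eu (e+1)) 0) =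
        ∑ s ∈ p.support, ∑ k ∈ Finset.range (g.natDegree + 1), (p.coeff s * g.coeff k) * ((P s).eval ((y : Eu (e+1)) 0) * (y : Eu (e+1)) 0 ^ k) := by
      intro y
      rw [Polynomial.eval_finsetSum, Polynomial.eval_eq_sum_range (p := g), Finset.sum_mul_sum]
      refine Finset.sum_congr rfl fun s _ => Finset.sum_congr rfl fun k _ => ?_
      rw [Polynomial.eval_mul, Polynomial.eval_C]; ring
    simp_rw [e1, e2]
    rw [integral_finsetSum _ (fun s _ => sph_integrable (by fun_prop)), integral_finsetSum _ (fun s _ => sph_integrable (by fun_prop))]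
    refine Finset.sum_congr rfl fun s _ => ?_
    rw [integral_finsetSum _ (fun s _ => sph_integrable (by fun_prop)), integral_finsetSum _ (fun s _ => sph_integrable (by fun_prop))]
    refine Finset.sum_congr rfl fun k _ => ?_
    rw [integral_const_mul, integral_const_mul, hX]

theorem rot_poly (d : ℕ) (T : Eu d ≃ₗᵢ[ℝ] Eu d) (p : MvPolynomial (Fin (d + 1)) ℝ) :
    ∃ q : MvPolynomial (Fin (d+1)) ℝ, q.totalDegree ≤ p.totalDegree ∧
      ∀ z : Eu d, MvPolynomial.eval (fun i => z i) q = MvPolynomial.eval (fun i => (T z) i) p := by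
  set L : Fin (d+1) → MvPolynomial (Fin (d+1)) ℝ := fun i => ∑ j, MvPolynomial.C (T (EuclideanSpace.single j 1) i) * MvPolynomial.X j with hL
  have hLd : ∀ i, (L i).totalDegree ≤ 1 := by
    intro i
    refine MvPolynomial.totalDegree_finsetSum_le fun j _ => ?_
    refine (MvPolynomial.totalDegree_mul _ _).trans ?_
    rw [MvPolynomial.totalDegree_C, MvPolynomial.totalDegree_X]
  refine ⟨∑ s ∈ p.support, MvPolynomial.C (p.coeff s) * ∏ i, L i ^ s i, ?_, ?_⟩
  · refine MvPolynomial.totalDegree_finsetSum_le fun s hs => ?_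
    refine (MvPolynomial.totalDegree_mul _ _).trans ?_
    rw [MvPolynomial.totalDegree_C, zero_add]
    refine (MvPolynomial.totalDegree_finsetProd _ _).trans ?_
    have h1 := MvPolynomial.le_totalDegree hs
    rw [Finsupp.sum_fintype _ _ (fun _ => rfl)] at h1
    refine le_trans (Finset.sum_le_sum fun i _ => ?_) h1
    refine (MvPolynomial.totalDegree_pow _ _).trans ?_
    calc s i * (L i).totalDegree ≤ s i * 1 := Nat.mul_le_mul_left _ (hLd i)
      _ = s i := mul_one _
  · intro z
    rw [MvPolynomial.eval_eq' _ p, map_sum]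
    refine Finset.sum_congr rfl fun s _ => ?_
    rw [map_mul, MvPolynomial.eval_C, map_prod]
    congr 1
    refine Finset.prod_congr rfl fun i _ => ?_
    rw [map_pow]
    congr 1
    have hz : z = ∑ j, z j • EuclideanSpace.single j (1:ℝ) := by
      ext k
      simp
      simp [Pi.single_apply]
    conv_rhs => rw [hz]
    simp only [hL, map_sum, map_mul, MvPolynomial.eval_C, MvPolynomial.eval_X, map_smul]
    simp [mul_comm]

theorem exists_rot {d : ℕ} (x : Sph d) : ∃ T : Eu d ≃ₗᵢ[ℝ] Eu d, T x = EuclideanSpace.single 0 1 :=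
  ⟨_, Submodule.reflection_sub (v := (x : Eu d)) (w := EuclideanSpace.single 0 1) (by simp)⟩

theorem ip_rot {d : ℕ} {x : Sph d} {T : Eu d ≃ₗᵢ[ℝ] Eu d} (hT : T x = EuclideanSpace.single 0 1) (y : Sph d) :
    ip x y = (T (y : Eu d)) 0 := by
  unfold ip
  rw [← T.inner_map_map, hT]; simp [EuclideanSpace.inner_single_left]

theorem sph_red (e : ℕ) (x : Sph (e+1)) (p : MvPolynomial (Fin (e + 1 + 1)) ℝ) : ∃ P : Polynomial ℝ,
    P.natDegree ≤ p.totalDegree ∧ P.eval 1 = MvPolynomial.eval (fun i => (x : Eu (e+1)) i) p ∧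
    ∀ g : Polynomial ℝ,
      ∫ y : Sph (e + 1), MvPolynomial.eval (fun i => (y : Eu (e+1)) i) p * g.eval (ip x y) ∂sphMeasure (e + 1) =
      ∫ y : Sph (e + 1), P.eval (ip x y) * g.eval (ip x y) ∂sphMeasure (e + 1) := by
  obtain ⟨T, hT⟩ := exists_rot x
  obtain ⟨q, hq, hq2⟩ := rot_poly (e+1) T.symm p
  obtain ⟨P, h1, h2, h3⟩ := sph_red_e0 e q
  refine ⟨P, h1.trans hq, ?_, ?_⟩
  · rw [h2]
    have := hq2 (EuclideanSpace.single 0 1)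
    rw [← hT, T.symm_apply_apply, hT] at this
    rw [← this]
    congr 2; ext i; simp [EuclideanSpace.single_apply]
  · intro g
    have r1 := sph_rot T (fun z => MvPolynomial.eval (fun i => (T.symm z) i) p * g.eval (z 0))
    have r2 := sph_rot T (fun z => P.eval (z 0) * g.eval (z 0))
    simp only [T.symm_apply_apply, ← hq2] at r1
    simp_rw [ip_rot hT]
    rw [r1, r2, h3]

/-- The normalising constant. -/
def bB (d : ℕ) : ℝ := Real.Gamma ((d:ℝ)/2) ^ 2 / Real.Gamma (d:ℝ)

theorem zon_b (e b : ℕ) : ∫ y : Sph (e+1), (1 - (y : Eu (e+1)) 0 ^ 2) ^ b ∂sphMeasure (e+1) =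
    Real.Gamma (((e:ℝ)+1)/2 + b) * Real.Gamma (((e:ℝ)+1)/2 + 1/2) /
      (Real.Gamma (((e:ℝ)+1)/2) * Real.Gamma (((e:ℝ)+1)/2 + b + 1/2)) := by
  have key : ∀ b : ℕ, kap (e+1) * Real.Gamma (((e:ℝ)+1)/2 + b + 1/2) *
      ∫ y : Sph (e+1), (1 - (y : Eu (e+1)) 0 ^ 2) ^ b ∂sphMeasure (e+1) =
      (∫ t : ℝ, t ^ 0 * Real.exp (-t ^ 2)) * (kap e * Real.Gamma (((e:ℝ) + 1) / 2 + b)) := by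
    intro b
    have h := gauss_tail (d := e+1) 0 (2*b) (fun z => (∑ i, z i ^ 2) ^ b) (by
      intro c z
      simp only [mul_pow, ← Finset.mul_sum]
      rw [pow_mul])
    simp only [sph_coord_sq] at h
    rw [tail_sq_int e b] at h
    rw [← h]
    have e2 : (((e+1:ℕ):ℝ) + (0 + 2 * b : ℕ) + 1) / 2 = ((e:ℝ)+1)/2 + b + 1/2 := by push_cast; ring
    rw [e2]; simp
  have h0 := key 0
  have hb := key b
  simp only [pow_zero, integral_const, probReal_univ, smul_eq_mul, mul_one, Nat.cast_zero, add_zero] at h0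
  simp only [pow_zero] at hb
  have p1 := kap_pos (e+1)
  have p2 : 0 < Real.Gamma (((e:ℝ)+1)/2 + b + 1/2) := Real.Gamma_pos_of_pos (by positivity)
  have p3 : 0 < Real.Gamma (((e:ℝ)+1)/2) := Real.Gamma_pos_of_pos (by positivity)
  rw [eq_div_iff (by positivity)]
  have : kap (e+1) * (Real.Gamma (((e:ℝ)+1)/2 + b + 1/2) *
      (∫ y : Sph (e+1), (1 - (y : Eu (e+1)) 0 ^ 2) ^ b ∂sphMeasure (e+1)) * Real.Gamma (((e:ℝ)+1)/2)) =
      kap (e+1) * (Real.Gamma (((e:ℝ)+1)/2 + b) * Real.Gamma (((e:ℝ)+1)/2 + 1/2)) := by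
    linear_combination Real.Gamma (((e:ℝ)+1)/2) * hb - Real.Gamma (((e:ℝ)+1)/2 + b) * h0
  have := mul_left_cancel₀ p1.ne' this
  linarith

theorem dup_ratio (s : ℝ) (hs : 0 < s) (b : ℕ) :
    Real.Gamma (s + b) * Real.Gamma (s + 1/2) / (Real.Gamma s * Real.Gamma (s + b + 1/2)) =
    4 ^ b * (Real.Gamma (s + b) ^ 2 / Real.Gamma (2 * s + 2 * b)) / (Real.Gamma s ^ 2 / Real.Gamma (2 * s)) := by
  have h1 := Real.Gamma_mul_Gamma_add_half_of_pos hs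
  have h2 := Real.Gamma_mul_Gamma_add_half_of_pos (s := s + b) (by positivity)
  have e1 : 2 * (s + b) = 2 * s + 2 * b := by ring
  rw [e1] at h2
  have e2 : (2:ℝ) ^ (1 - (2 * s + 2 * b)) = 2 ^ (1 - 2 * s) / 4 ^ b := by
    rw [show (1 - (2 * s + 2 * (b:ℝ))) = (1 - 2 * s) - ((2 * b : ℕ):ℝ) by push_cast; ring, rpow_sub_natCast two_ne_zero, pow_mul]
    norm_num
  rw [e2] at h2
  have p1 : 0 < Real.Gamma s := Real.Gamma_pos_of_pos hs
  have p2 : 0 < Real.Gamma (s + b) := Real.Gamma_pos_of_pos (by positivity)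
  have p3 : 0 < Real.Gamma (s + b + 1/2) := Real.Gamma_pos_of_pos (by positivity)
  have p4 : 0 < Real.Gamma (2 * s) := Real.Gamma_pos_of_pos (by positivity)
  have p5 : 0 < Real.Gamma (2 * s + 2 * b) := Real.Gamma_pos_of_pos (by positivity)
  have p6 : 0 < Real.Gamma (s + 1/2) := Real.Gamma_pos_of_pos (by positivity)
  have h1' : Real.Gamma (s + 1/2) = Real.Gamma (2 * s) * 2 ^ (1 - 2 * s) * √π / Real.Gamma s := by
    rw [← h1]; field_simp
  have h2' : Real.Gamma (s + b + 1/2) = Real.Gamma (2 * s + 2 * b) * (2 ^ (1 - 2 * s) / 4 ^ b) * √π / Real.Gamma (s + b) := by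
    rw [← h2]; field_simp
  rw [h1', h2']
  have : (0:ℝ) < 2 ^ (1 - 2 * s) := by positivity
  have : 0 < √π := by positivity
  field_simp

theorem Lw_swap (a : ℝ) (g : ℝ → ℝ) : Lw a a (fun y => g (1 - y)) = Lw a a g := by
  unfold Lw
  have := intervalIntegral.integral_comp_sub_left (a := 0) (b := 1) (fun y => jw a a y * g y) 1
  simp only [sub_self, sub_zero] at this
  rw [← this]
  congr 1; ext y
  unfold jw
  rw [mul_comm (y^a), sub_sub_cancel]

theorem zon_mono (e m : ℕ) : ∀ b : ℕ,
    ∫ y : Sph (e+1), (y : Eu (e+1)) 0 ^ m * (1 - (y : Eu (e+1)) 0 ^ 2) ^ b ∂sphMeasure (e+1) =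
    Lw (((e+1:ℕ):ℝ)/2-1) (((e+1:ℕ):ℝ)/2-1) (fun y => (1 - 2 * y) ^ m * (4 * y * (1 - y)) ^ b) / bB (e+1) := by
  have ha : -1 < ((e+1:ℕ):ℝ)/2-1 := by
    have : (0:ℝ) < ((e+1:ℕ):ℝ) := by positivity
    linarith
  induction m using Nat.twoStepInduction with
  | zero =>
    intro b
    simp only [pow_zero, one_mul]
    rw [zon_b]
    rw [dup_ratio _ (by positivity)]
    have : (fun y : ℝ => (4 * y * (1 - y)) ^ b) = fun y => 4 ^ b * (y ^ b * (1 - y) ^ b) := by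
      ext y; rw [mul_pow, mul_pow, mul_assoc]
    rw [this, Lw_const_mul, Lw_mono_pow ha ha]
    unfold bB
    have e1 : ((e+1:ℕ):ℝ)/2-1 + b + 1 = ((e:ℝ)+1)/2 + b := by push_cast; ring
    have e2 : ((e+1:ℕ):ℝ)/2-1 + (((e+1:ℕ):ℝ)/2-1) + b + b + 2 = 2 * (((e:ℝ)+1)/2) + 2 * b := by push_cast; ring
    rw [e1, e2]
    have e3 : 2 * (((e:ℝ)+1)/2) = ((e+1:ℕ):ℝ) := by push_cast; ring
    rw [e3]
    push_cast
    ring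
  | one =>
    intro b
    have h := gauss_tail (d := e+1) 1 (2*b) (fun z => (∑ i, z i ^ 2) ^ b) (by
      intro c z
      simp only [mul_pow, ← Finset.mul_sum]
      rw [pow_mul])
    simp only [sph_coord_sq] at h
    rw [gam_odd 1 (by decide), zero_mul] at h
    rw [(mul_eq_zero.1 h).resolve_left (gGamma_ne _ _)]
    have := Lw_swap (((e+1:ℕ):ℝ)/2-1) (fun y => (1 - 2 * y) ^ 1 * (4 * y * (1 - y)) ^ b)
    have e1 : (fun y : ℝ => (1 - 2 * (1 - y)) ^ 1 * (4 * (1 - y) * (1 - (1 - y))) ^ b) =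
      fun y => (-1) * ((1 - 2 * y) ^ 1 * (4 * y * (1 - y)) ^ b) := by
      ext y
      rw [show 4 * (1 - y) * (1 - (1 - y)) = 4 * y * (1 - y) by ring]; ring
    rw [e1, Lw_const_mul] at this
    have h0 : Lw (((e+1:ℕ):ℝ)/2-1) (((e+1:ℕ):ℝ)/2-1) (fun y => (1 - 2 * y) ^ 1 * (4 * y * (1 - y)) ^ b) = 0 := by linarith
    rw [h0, zero_div]
  | more m h0 h1 =>
    intro b
    have i1 : ∀ b : ℕ, Integrable (fun y : Sph (e+1) => (y : Eu (e+1)) 0 ^ m * (1 - (y : Eu (e+1)) 0 ^ 2) ^ b) (sphMeasure (e+1)) :=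
      fun b => sph_integrable (by fun_prop)
    have e1 : (fun y : Sph (e+1) => (y : Eu (e+1)) 0 ^ (m+2) * (1 - (y : Eu (e+1)) 0 ^ 2) ^ b) =
      fun y : Sph (e+1) => (y : Eu (e+1)) 0 ^ m * (1 - (y : Eu (e+1)) 0 ^ 2) ^ b - (y : Eu (e+1)) 0 ^ m * (1 - (y : Eu (e+1)) 0 ^ 2) ^ (b+1) := by
      ext y; ring
    have e2 : (fun y : ℝ => (1 - 2 * y) ^ (m+2) * (4 * y * (1 - y)) ^ b) = fun y => (1 - 2 * y) ^ m * (4 * y * (1 - y)) ^ b + (-1) * ((1 - 2 * y) ^ m * (4 * y * (1 - y)) ^ (b+1)) := by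
      ext y; ring
    rw [e1, e2, integral_sub (i1 _) (i1 _), h0, h0, Lw_add ha ha (by fun_prop) (by fun_prop), Lw_const_mul]
    ring

theorem zon_poly (e : ℕ) (p : Polynomial ℝ) :
    ∫ y : Sph (e+1), p.eval ((y : Eu (e+1)) 0) ∂sphMeasure (e+1) =
    Lw (((e+1:ℕ):ℝ)/2-1) (((e+1:ℕ):ℝ)/2-1) (fun y => p.eval (1 - 2 * y)) / bB (e+1) := by
  have ha : -1 < ((e+1:ℕ):ℝ)/2-1 := by
    have : (0:ℝ) < ((e+1:ℕ):ℝ) := by positivity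
    linarith
  simp only [Polynomial.eval_eq_sum_range]
  rw [integral_finsetSum _ (fun i _ => sph_integrable (by fun_prop)), Lw_sum ha ha _ _ (fun i => by fun_prop), Finset.sum_div]
  refine Finset.sum_congr rfl fun i _ => ?_
  rw [integral_const_mul, Lw_const_mul, mul_div_assoc]
  have := zon_mono e i 0
  simp only [pow_zero, mul_one] at this
  rw [this]

theorem ip_mem {d : ℕ} (x y : Sph d) : ip x y ∈ Icc (-1:ℝ) 1 := by
  have h := abs_real_inner_le_norm (x : Eu d) (y : Eu d)
  rw [norm_eq_of_mem_sphere x, norm_eq_of_mem_sphere y, mul_one] at h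
  exact abs_le.1 h

theorem ip_self {d : ℕ} (x : Sph d) : ip x x = 1 := by
  unfold ip
  rw [real_inner_self_eq_norm_sq, norm_eq_of_mem_sphere x, one_pow]

theorem ip_comm {d : ℕ} (x y : Sph d) : ip x y = ip y x := real_inner_comm _ _

theorem ip_cont {d : ℕ} (x : Sph d) : Continuous (fun y => ip x y) := by
  unfold ip; fun_prop

theorem ip_cont' {d : ℕ} (y : Sph d) : Continuous (fun x => ip x y) := by
  unfold ip; fun_prop

theorem bB_pos (d : ℕ) (hd : 0 < d) : 0 < bB d := by
  unfold bB
  have : (0:ℝ) < d := by exact_mod_cast hd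
  have := Real.Gamma_pos_of_pos this
  have := Real.Gamma_pos_of_pos (half_pos ‹(0:ℝ) < d›)
  positivity

theorem sph_zonal_poly (d : ℕ) (hd : 0 < d) (x : Sph d) (p : Polynomial ℝ) :
    ∫ y : Sph d, p.eval (ip x y) ∂sphMeasure d =
    Lw ((d:ℝ)/2-1) ((d:ℝ)/2-1) (fun y => p.eval (1 - 2 * y)) / bB d := by
  obtain ⟨e, rfl⟩ : ∃ e, d = e + 1 := ⟨d - 1, by omega⟩
  obtain ⟨T, hT⟩ := exists_rot x
  rw [← zon_poly]
  simp_rw [ip_rot hT]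
  exact sph_rot T (fun z => p.eval (z 0))

theorem Lw_one (d : ℕ) (hd : 0 < d) : Lw ((d:ℝ)/2-1) ((d:ℝ)/2-1) (fun _ => 1) = bB d := by
  have hd' : (0:ℝ) < d := by exact_mod_cast hd
  have := Lw_mono_pow (a := (d:ℝ)/2-1) (b := (d:ℝ)/2-1) (by linarith) (by linarith) 0 0
  simp only [pow_zero, mul_one, Nat.cast_zero, add_zero] at this
  rw [this]; unfold bB
  rw [show (d:ℝ)/2-1+1 = d/2 by ring, show (d:ℝ)/2-1+(d/2-1)+2 = d by ring, sq]

theorem Lw_abs_sub {a b : ℝ} (ha : -1 < a) (hb : -1 < b) {g h : ℝ → ℝ} (hg : ContinuousOn g (Icc 0 1))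
    (hh : ContinuousOn h (Icc 0 1)) {η : ℝ} (H : ∀ y ∈ Icc (0:ℝ) 1, |g y - h y| ≤ η) :
    |Lw a b g - Lw a b h| ≤ η * Lw a b (fun _ => 1) := by
  have h1 : Lw a b g ≤ Lw a b (fun y => h y + η * 1) :=
    Lw_mono ha hb hg (by fun_prop) (fun y hy => by have := (abs_le.1 (H y hy)).2; linarith)
  have h2 : Lw a b h ≤ Lw a b (fun y => g y + η * 1) :=
    Lw_mono ha hb hh (by fun_prop) (fun y hy => by have := (abs_le.1 (H y hy)).1; linarith)
  rw [Lw_add ha hb hh (by fun_prop), Lw_const_mul] at h1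
  rw [Lw_add ha hb hg (by fun_prop), Lw_const_mul] at h2
  rw [abs_le]; constructor <;> linarith

theorem sph_zonal (d : ℕ) (hd : 0 < d) (x : Sph d) (g : ℝ → ℝ) (hg : Continuous g) :
    ∫ y : Sph d, g ((1 - ip x y) / 2) ∂sphMeasure d =
    Lw ((d:ℝ)/2-1) ((d:ℝ)/2-1) g / bB d := by
  have hd' : (0:ℝ) < d := by exact_mod_cast hd
  have ha : -1 < (d:ℝ)/2-1 := by linarith
  have hB := bB_pos d hd
  refine eq_of_abs_sub_le_all fun ε hε => ?_
  obtain ⟨p, hp⟩ := exists_polynomial_near_of_continuousOn (-1) 1 (fun t => g ((1 - t)/2)) (by fun_prop) (ε/2) (half_pos hε)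
  have h1 := sph_zonal_poly d hd x p
  have h2 : |(∫ y : Sph d, g ((1 - ip x y) / 2) ∂sphMeasure d) - ∫ y : Sph d, p.eval (ip x y) ∂sphMeasure d| ≤ ε/2 := by
    have hc := ip_cont x
    rw [← integral_sub (sph_integrable (by fun_prop)) (sph_integrable (by fun_prop))]
    have h5 := norm_integral_le_of_norm_le_const (μ := sphMeasure d)
      (f := fun y : Sph d => g ((1 - ip x y) / 2) - p.eval (ip x y)) (C := ε/2) (Filter.Eventually.of_forall fun y => by
        rw [Real.norm_eq_abs, abs_sub_comm]; exact (hp _ (ip_mem x y)).le)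
    simpa using h5
  have h3 := Lw_abs_sub (a := (d:ℝ)/2-1) (b := (d:ℝ)/2-1) ha ha (g := g) (h := fun y => p.eval (1 - 2 * y)) (η := ε/2) hg.continuousOn (by fun_prop) (by
    intro y hy
    have := hp (1 - 2 * y) ⟨by linarith [hy.2], by linarith [hy.1]⟩
    rw [show (1 - (1 - 2 * y))/2 = y by ring, abs_sub_comm] at this
    exact this.le)
  rw [Lw_one d hd] at h3
  have h4 : |Lw ((d:ℝ)/2-1) ((d:ℝ)/2-1) g / bB d - Lw ((d:ℝ)/2-1) ((d:ℝ)/2-1) (fun y => p.eval (1 - 2 * y)) / bB d| ≤ ε / 2 := by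
    rw [← sub_div, abs_div, abs_of_pos hB, div_le_iff₀ hB]; exact h3
  rw [h1] at h2
  rw [abs_sub_comm] at h4
  calc _ ≤ _ := abs_sub_le _ (Lw ((d:ℝ)/2-1) ((d:ℝ)/2-1) (fun y => p.eval (1 - 2 * y)) / bB d) _
    _ ≤ ε := by linarith

theorem jacobiP_one {α β : ℝ} (n : ℕ) (h1 : -1 < α) (h2 : 0 < α + β + 1 + n) (h3 : -1 < β) :
    0 < jacobiP α β n 1 ∧ jacobiP α β n 1 ^ 2 = ((2 * (n : ℝ) + α + β + 1) / 2 ^ (α + β + 1) *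
      (Real.Gamma ((n : ℝ) + α + β + 1) * (n.factorial : ℝ) /
        (Real.Gamma ((n : ℝ) + α + 1) * Real.Gamma ((n : ℝ) + β + 1)))) *
        (Real.Gamma (n + α + 1) / (n.factorial * Real.Gamma (α + 1))) ^ 2 ∧
    ∀ y, jacobiP α β n (1 - 2 * y) = jacobiP α β n 1 * (jF n α β).eval y := by
  have hn : (0:ℝ) ≤ n := by positivity
  have key : ∀ y, jacobiP α β n (1 - 2 * y) = Real.sqrt ((2 * (n : ℝ) + α + β + 1) / 2 ^ (α + β + 1) *
      (Real.Gamma ((n : ℝ) + α + β + 1) * (n.factorial : ℝ) /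
        (Real.Gamma ((n : ℝ) + α + 1) * Real.Gamma ((n : ℝ) + β + 1)))) *
        (Real.Gamma (n + α + 1) / (n.factorial * Real.Gamma (α + 1))) * (jF n α β).eval y := by
    intro y
    unfold jacobiP
    have p1 : 0 < Real.Gamma (α + β + n + 1) := Real.Gamma_pos_of_pos (by linarith)
    have p2 : 0 < Real.Gamma (α + 1) := Real.Gamma_pos_of_pos (by linarith)
    have e1 : ∑ m ∈ Finset.range (n + 1),
      (n.choose m : ℝ) * (Real.Gamma (α + β + n + m + 1) / Real.Gamma (α + m + 1)) *
        ((1 - 2 * y - 1) / 2) ^ m = Real.Gamma (α + β + n + 1) / Real.Gamma (α + 1) * (jF n α β).eval y := by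
      rw [jF_eval, Finset.mul_sum]
      refine Finset.sum_congr rfl fun m _ => ?_
      rw [show α + β + n + m + 1 = (n + α + β + 1) + m by ring, show α + m + 1 = (α + 1) + m by ring,
        rf_Gamma (by linarith), rf_Gamma (by linarith), show (1 - 2 * y - 1)/2 = (-1) * y by ring, mul_pow,
        show α + β + n + 1 = n + α + β + 1 by ring]
      have := rf_pos (show 0 < α + 1 by linarith) m
      field_simp
    rw [e1, show α + n + 1 = n + α + 1 by ring]
    field_simp
  have k0 := key 0
  rw [mul_zero, sub_zero, jF_zero, mul_one] at k0
  have q1 : 0 < Real.Gamma (n + α + β + 1) := Real.Gamma_pos_of_pos (by linarith)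
  have q2 : 0 < Real.Gamma (n + α + 1) := Real.Gamma_pos_of_pos (by linarith)
  have q3 : 0 < Real.Gamma (n + β + 1) := Real.Gamma_pos_of_pos (by linarith)
  have q4 : 0 < Real.Gamma (α + 1) := Real.Gamma_pos_of_pos (by linarith)
  have q5 : 0 < 2 * (n : ℝ) + α + β + 1 := by linarith
  have q6 : (0:ℝ) < n.factorial := by positivity
  refine ⟨?_, ?_, ?_⟩
  · rw [k0]; positivity
  · rw [k0, mul_pow, Real.sq_sqrt (by positivity)]
  · intro y; rw [key, k0]

/-- `dim` of spherical harmonics. -/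
def hB (d l : ℕ) : ℝ := (2 * l + d - 1) * Real.Gamma (l + d - 1) / (l.factorial * Real.Gamma d)

theorem omega_ratio (d : ℕ) (hd : 1 ≤ d) : omegaS d / omegaS (d - 1) =
    √π * Real.Gamma ((d:ℝ)/2) / Real.Gamma ((d:ℝ)/2 + 1/2) := by
  unfold omegaS
  have hd' : (0:ℝ) < d := by exact_mod_cast hd
  rw [Nat.cast_sub hd, Nat.cast_one, sub_add_cancel, show ((d:ℝ)+1)/2 = d/2+1/2 by ring, rpow_add pi_pos, ← sqrt_eq_rpow]
  have p1 := Real.Gamma_pos_of_pos (half_pos hd')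
  have p2 : 0 < Real.Gamma ((d:ℝ)/2 + 1/2) := Real.Gamma_pos_of_pos (by positivity)
  have p3 : (0:ℝ) < π ^ ((d:ℝ)/2) := by positivity
  field_simp

theorem hB_eq (d l : ℕ) (hd : 2 ≤ d) : (omegaS d / omegaS (d - 1)) * jacobiP ((d : ℝ) / 2 - 1) ((d : ℝ) / 2 - 1) l 1 ^ 2 = hB d l := by
  have hd' : (2:ℝ) ≤ d := by exact_mod_cast hd
  have hl : (0:ℝ) ≤ l := by positivity
  rw [(jacobiP_one l (by linarith) (by linarith) (by linarith)).2.1, omega_ratio d (by omega)]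
  have h := Real.Gamma_mul_Gamma_add_half_of_pos (s := (d:ℝ)/2) (by positivity)
  rw [show 2 * ((d:ℝ)/2) = d by ring] at h
  rw [show (d:ℝ)/2-1+(d/2-1)+1 = d-1 by ring, show (l:ℝ)+(d/2-1)+1 = l+d/2 by ring,
    show (l:ℝ) + (d/2-1)+(d/2-1)+1 = l+d-1 by ring, show (d:ℝ)/2-1+1 = d/2 by ring,
    show 2 * (l:ℝ) + (d/2-1)+(d/2-1)+1 = 2*l+d-1 by ring]
  rw [show (1 - (d:ℝ)) = -(d - 1) by ring, rpow_neg (by norm_num)] at h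
  have p1 : 0 < Real.Gamma ((d:ℝ)/2) := Real.Gamma_pos_of_pos (by positivity)
  have p2 : 0 < Real.Gamma ((d:ℝ)/2 + 1/2) := Real.Gamma_pos_of_pos (by positivity)
  have p3 : 0 < Real.Gamma (l + (d:ℝ)/2) := Real.Gamma_pos_of_pos (by positivity)
  have p4 : 0 < Real.Gamma (d:ℝ) := Real.Gamma_pos_of_pos (by positivity)
  have p5 : (0:ℝ) < 2 ^ ((d:ℝ)-1) := by positivity
  have p6 : (0:ℝ) < l.factorial := by positivity
  unfold hB
  have h' : √π = Real.Gamma ((d:ℝ)/2) * Real.Gamma ((d:ℝ)/2+1/2) * 2 ^ ((d:ℝ)-1) / Real.Gamma d := by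
    rw [h]; field_simp
  rw [h']
  field_simp

theorem sphK_sum (d N : ℕ) (hd : 2 ≤ d) (y : ℝ) : sphK d N (1 - 2 * y) =
    ∑ l ∈ Finset.range N, hB d l * (jF l ((d:ℝ)/2-1) ((d:ℝ)/2-1)).eval y := by
  have hd' : (2:ℝ) ≤ d := by exact_mod_cast hd
  unfold sphK jacobiK
  rw [Finset.mul_sum]
  refine Finset.sum_congr rfl fun l _ => ?_
  have hl : (0:ℝ) ≤ l := by positivity
  rw [← hB_eq d l hd, (jacobiP_one l (by linarith) (by linarith) (by linarith)).2.2]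
  ring

theorem sum_hB (d N : ℕ) (hd : 2 ≤ d) : ∑ l ∈ Finset.range (N+1), Polynomial.C (hB d l) * jF l ((d:ℝ)/2-1) ((d:ℝ)/2-1) =
    Polynomial.C (dimPi d (N+1)) * jF N ((d:ℝ)/2) ((d:ℝ)/2-1) := by
  have hd' : (2:ℝ) ≤ d := by exact_mod_cast hd
  have p4 : 0 < Real.Gamma (d:ℝ) := Real.Gamma_pos_of_pos (by positivity)
  have hG1 : Real.Gamma ((d:ℝ)+1) = d * Real.Gamma d := Real.Gamma_add_one (by positivity)
  induction N with
  | zero =>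
    simp only [zero_add, Finset.range_one, Finset.sum_singleton]
    have e1 : hB d 0 = 1 := by
      unfold hB
      have : Real.Gamma (d:ℝ) = (d-1) * Real.Gamma (d-1) := by
        conv_lhs => rw [show (d:ℝ) = (d-1) + 1 by ring]
        exact Real.Gamma_add_one (by linarith)
      have p5 : 0 < Real.Gamma ((d:ℝ)-1) := Real.Gamma_pos_of_pos (by linarith)
      rw [this]; simp
      have : (d:ℝ) - 1 ≠ 0 := by linarith
      exact ⟨this, p5.ne'⟩
    have e2 : dimPi d 1 = 1 := by
      unfold dimPi
      rw [hG1]; simp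
      exact ⟨by omega, p4.ne'⟩
    rw [e1, e2]
    congr 1
  | succ K ih =>
    rw [Finset.sum_range_succ, ih]
    ext m
    rw [Polynomial.coeff_add, Polynomial.coeff_C_mul, Polynomial.coeff_C_mul, Polynomial.coeff_C_mul,
      jF_coeff, jF_coeff, jF_coeff]
    rcases lt_or_ge (K+1) m with hm | hm
    · rw [Nat.choose_eq_zero_of_lt hm, Nat.choose_eq_zero_of_lt (show K < m by omega)]; simp
    have hK : (0:ℝ) ≤ K := by positivity
    have hm' : (0:ℝ) ≤ m := by positivity
    set s : ℝ := K + d with hs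
    have hsp : 0 < s := by rw [hs]; linarith
    rw [show ((K:ℝ) + d/2 + (d/2-1) + 1) = s by rw [hs]; ring,
      show (((K+1:ℕ):ℝ) + (d/2-1) + (d/2-1) + 1) = s by rw [hs]; push_cast; ring,
      show (((K+1:ℕ):ℝ) + d/2 + (d/2-1) + 1) = s+1 by rw [hs]; push_cast; ring,
      show ((d:ℝ)/2-1+1) = d/2 by ring]
    have r1 : rf (s+1) m = rf s m * (s+m)/s := by
      rw [eq_div_iff hsp.ne', mul_comm, ← rf_succ_left, rf_succ]
    have r2 : rf ((d:ℝ)/2+1) m = rf ((d:ℝ)/2) m * (d/2+m)/(d/2) := by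
      rw [eq_div_iff (by positivity), mul_comm, ← rf_succ_left, rf_succ]
    have r3 : (K.choose m : ℝ) = ((K+1).choose m : ℝ) * ((K+1 - m)/(K+1)) := by
      have := Nat.choose_mul_succ_eq K m
      have h2 : (K.choose m : ℝ) * (K + 1) = ((K+1).choose m : ℝ) * ((K+1) - m) := by
        rw [← Nat.cast_add_one, ← Nat.cast_sub hm]; exact_mod_cast this
      have : (K:ℝ) + 1 ≠ 0 := by positivity
      field_simp
      linarith
    rw [r1, r2, r3]
    have hA1 : dimPi d (K+1+1) = (2*K+2+d) * (s * Real.Gamma s) / ((K+1) * Real.Gamma (K+1) * (d * Real.Gamma d)) := by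
      unfold dimPi
      rw [hG1]
      push_cast
      rw [Real.Gamma_add_one (by positivity : (K:ℝ)+1 ≠ 0), show (K:ℝ)+1+1+d-1 = s+1 by rw [hs]; ring, Real.Gamma_add_one hsp.ne']
      ring
    have hA0 : dimPi d (K+1) = (2*K+d) * (Real.Gamma s) / (Real.Gamma (K+1) * (d * Real.Gamma d)) := by
      unfold dimPi
      rw [hG1]
      push_cast
      rw [show (K:ℝ)+1+d-1 = s by rw [hs]; ring]
      ring
    have hB0 : hB d (K+1) = (2*K+1+d) * Real.Gamma s / ((K+1) * Real.Gamma (K+1) * Real.Gamma d) := by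
      unfold hB
      rw [← Real.Gamma_nat_eq_factorial]
      push_cast
      rw [show (K:ℝ)+1+d-1 = s by rw [hs]; ring, Real.Gamma_add_one (by positivity : (K:ℝ)+1 ≠ 0)]
      ring
    rw [hA1, hA0, hB0]
    have p5 : 0 < Real.Gamma s := Real.Gamma_pos_of_pos hsp
    have p6 : 0 < Real.Gamma ((K:ℝ)+1) := Real.Gamma_pos_of_pos (by positivity)
    have p7 := rf_pos (show (0:ℝ) < d/2 by positivity) m
    have p8 : (0:ℝ) < d/2+m := by positivity
    have p9 : (0:ℝ) < d := by positivity
    have p10 : (0:ℝ) < d + 2 * m := by positivity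
    have p11 : (0:ℝ) < d + m * 2 := by positivity
    field_simp
    rw [hs]
    ring

theorem sphK_eq (d N : ℕ) (hd : 2 ≤ d) (hN : 1 ≤ N) (y : ℝ) : sphK d N (1 - 2 * y) =
    dimPi d N * (jF (N-1) ((d:ℝ)/2) ((d:ℝ)/2-1)).eval y := by
  obtain ⟨K, rfl⟩ : ∃ K, N = K + 1 := ⟨N-1, by omega⟩
  rw [sphK_sum d _ hd]
  have := congrArg (Polynomial.eval y) (sum_hB d K hd)
  simpa [Polynomial.eval_finsetSum] using this

theorem dimPi_pos (d N : ℕ) (hd : 2 ≤ d) (hN : 1 ≤ N) : 0 < dimPi d N := by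
  have hd' : (2:ℝ) ≤ d := by exact_mod_cast hd
  have hN' : (1:ℝ) ≤ N := by exact_mod_cast hN
  unfold dimPi
  have := Real.Gamma_pos_of_pos (show (0:ℝ) < N by linarith)
  have := Real.Gamma_pos_of_pos (show (0:ℝ) < d+1 by linarith)
  have := Real.Gamma_pos_of_pos (show (0:ℝ) < N+d-1 by linarith)
  have : (0:ℝ) < 2 * N + d - 2 := by linarith
  positivity

/-- the normalised Jacobi factor -/
def pT (d n : ℕ) (r : ℝ) : Polynomial ℝ := jF (d * n) ((d:ℝ)/2 + r) ((d:ℝ)/2-2)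
/-- the normalised Christoffel kernel -/
def kN (d n : ℕ) : Polynomial ℝ := jF ((d+2)*n-1) ((d:ℝ)/2) ((d:ℝ)/2-1)
/-- the kernel in the variable `y` -/
def phiY (d n : ℕ) (r : ℝ) : Polynomial ℝ :=
  Polynomial.C (dimPi d ((d+2)*n)) * kN d n * pT d n r * (1 - Polynomial.X) ^ n

theorem Phi_eq (d n : ℕ) (r : ℝ) (hd : 3 ≤ d) (hn : 1 ≤ n) (hr : 0 < r) (t : ℝ) :
    Phi d n r t = (phiY d n r).eval ((1 - t)/2) := by
  have hd' : (3:ℝ) ≤ d := by exact_mod_cast hd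
  unfold Phi PhiTilde phiY
  have hm : (0:ℝ) ≤ (d*n:ℕ) := by positivity
  obtain ⟨h1, -, h2⟩ := jacobiP_one (α := (d:ℝ)/2+r) (β := (d:ℝ)/2-2) (d*n) (by linarith) (by linarith) (by linarith)
  have e : t = 1 - 2 * ((1-t)/2) := by ring
  have h2' := h2 ((1-t)/2)
  have h3 := sphK_eq d ((d+2)*n) (by omega) (Nat.mul_pos (by omega) hn) ((1-t)/2)
  rw [← e] at h2' h3
  rw [h2', h3, mul_div_cancel_left₀ _ h1.ne']
  simp only [Polynomial.eval_mul, Polynomial.eval_C, Polynomial.eval_pow, Polynomial.eval_sub, Polynomial.eval_one, Polynomial.eval_X]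
  rw [show 1 - (1-t)/2 = (1+t)/2 by ring]
  rfl

theorem kN_repr (d N : ℕ) (hd : 3 ≤ d) (Q : Polynomial ℝ) (hQ : Q.natDegree ≤ N) :
    Lw ((d:ℝ)/2-1) ((d:ℝ)/2-1) (fun y => dimPi d (N+1) * (jF N ((d:ℝ)/2) ((d:ℝ)/2-1)).eval y * Q.eval y) = bB d * Q.eval 0 := by
  have hd' : (3:ℝ) ≤ d := by exact_mod_cast hd
  have ha : -1 < (d:ℝ)/2-1 := by linarith
  set k := jF N ((d:ℝ)/2) ((d:ℝ)/2-1) with hk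
  have h1 : Lw ((d:ℝ)/2-1) ((d:ℝ)/2-1) (fun y => dimPi d (N+1) * k.eval y) = bB d := by
    have e : (fun y => dimPi d (N+1) * k.eval y) = fun y => ∑ l ∈ Finset.range (N+1), hB d l * (jF l ((d:ℝ)/2-1) ((d:ℝ)/2-1)).eval y := by
      ext y
      have := congrArg (Polynomial.eval y) (sum_hB d N (by omega))
      simpa [Polynomial.eval_finsetSum] using this.symm
    rw [e, Lw_sum ha ha _ _ (fun i => by fun_prop), Finset.sum_eq_single 0]
    · have h0 : hB d 0 = 1 := by
        have := congrArg (Polynomial.eval 0) (sum_hB d 0 (by omega))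
        have hA : dimPi d 1 = 1 := by
          unfold dimPi
          rw [Real.Gamma_add_one (by positivity : (d:ℝ) ≠ 0)]
          have : 0 < Real.Gamma (d:ℝ) := Real.Gamma_pos_of_pos (by positivity)
          simp
          exact ⟨by omega, this.ne'⟩
        simpa [Polynomial.eval_finsetSum, jF_zero, hA] using this
      rw [h0, ← Lw_one d (by omega)]
      congr 1; ext y
      rw [jF_eval]; simp [rf_zero]
    · intro l _ hl
      rw [Lw_const_mul]
      have := jF_orth l ha ha 1 (by simp; omega)
      simp only [Polynomial.eval_one, mul_one] at this
      rw [this, mul_zero]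
    · intro h; simp at h
  have hQe : ∀ y, Q.eval y = Q.divX.eval y * y + Q.eval 0 := by
    intro y
    conv_lhs => rw [← Polynomial.divX_mul_X_add Q]
    rw [← Polynomial.coeff_zero_eq_eval_zero]
    simp
  have h2 : Lw ((d:ℝ)/2-1) ((d:ℝ)/2-1) (fun y => k.eval y * (Q.divX.eval y * y)) = 0 := by
    by_cases hN : N = 0
    · have : Q.divX = 0 := by
        rw [Polynomial.divX_eq_zero_iff]
        have : Q.natDegree = 0 := by omega
        rw [Polynomial.natDegree_eq_zero] at this
        obtain ⟨c, rfl⟩ := this; simp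
      simp [this, Lw]
    have := jF_orth N (α := (d:ℝ)/2) (β := (d:ℝ)/2-1) (by linarith) ha Q.divX (by
      rw [Polynomial.natDegree_divX_eq_natDegree_tsub_one]; omega)
    rw [← this]
    refine Lw_congr fun y hy => ?_
    unfold jw
    have : y ^ ((d:ℝ)/2) = y ^ ((d:ℝ)/2-1) * y := by
      conv_lhs => rw [show (d:ℝ)/2 = (d/2-1)+1 by ring]
      rw [rpow_add_one hy.1.ne']
    rw [this]; ring
  have e3 : (fun y => dimPi d (N+1) * k.eval y * Q.eval y) = fun y => dimPi d (N+1) * (k.eval y * (Q.divX.eval y * y)) + Q.eval 0 * (dimPi d (N+1) * k.eval y) := by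
    ext y; rw [hQe y]; ring
  rw [e3, Lw_add ha ha (by fun_prop) (by fun_prop), Lw_const_mul, Lw_const_mul, h1, h2]
  ring

theorem pT_deg (d n : ℕ) (r : ℝ) : (pT d n r).natDegree ≤ d * n := jF_natDegree _ _ _

theorem NN_eq (d n : ℕ) (hn : 1 ≤ n) : (d+2)*n-1+1 = (d+2)*n := by
  have : 1 ≤ (d+2)*n := Nat.mul_pos (by omega) hn
  omega

theorem sph_red' (d : ℕ) (hd : 0 < d) (x : Sph d) (p : MvPolynomial (Fin (d + 1)) ℝ) : ∃ P : Polynomial ℝ,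
    P.natDegree ≤ p.totalDegree ∧ P.eval 1 = MvPolynomial.eval (fun i => (x : Eu d) i) p ∧
    ∀ g : Polynomial ℝ,
      ∫ y : Sph d, MvPolynomial.eval (fun i => (y : Eu d) i) p * g.eval (ip x y) ∂sphMeasure d =
      ∫ y : Sph d, P.eval (ip x y) * g.eval (ip x y) ∂sphMeasure d := by
  obtain ⟨e, rfl⟩ : ∃ e, d = e + 1 := ⟨d - 1, by omega⟩
  exact sph_red e x p

theorem phi_repro (d n : ℕ) (r : ℝ) (hd : 3 ≤ d) (hn : 1 ≤ n) (x : Sph d) (p : MvPolynomial (Fin (d+1)) ℝ)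
    (hp : p.totalDegree < n) :
    ∫ y : Sph d, MvPolynomial.eval (fun i => (y : Eu d) i) p * (phiY d n r).eval ((1 - ip x y)/2) ∂sphMeasure d =
      MvPolynomial.eval (fun i => (x : Eu d) i) p := by
  obtain ⟨P, h1, h2, h3⟩ := sph_red' d (by omega) x p
  set L : Polynomial ℝ := Polynomial.C (1/2) - Polynomial.C (1/2) * Polynomial.X with hL
  have hLe : ∀ t, L.eval t = (1 - t)/2 := by intro t; simp [hL]; ring
  have h4 := h3 ((phiY d n r).comp L)
  simp only [Polynomial.eval_comp, hLe] at h4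
  rw [h4, ← h2]
  set M : Polynomial ℝ := 1 - Polynomial.C 2 * Polynomial.X with hM
  have hMe : ∀ t, M.eval t = 1 - 2 * t := by intro t; simp [hM]
  have h5 := sph_zonal d (by omega) x (fun y => P.eval (1 - 2 * y) * (phiY d n r).eval y) (by fun_prop)
  simp only [show ∀ t : ℝ, 1 - 2 * ((1 - t)/2) = t by intro t; ring] at h5
  rw [h5]
  have hdeg : (P.comp M * pT d n r * (1 - Polynomial.X)^n).natDegree ≤ (d+2)*n-1 := by
    refine (Polynomial.natDegree_mul_le).trans ?_
    have a1 : ((1 - Polynomial.X : Polynomial ℝ)^n).natDegree ≤ n := by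
      refine (Polynomial.natDegree_pow_le).trans ?_
      have : (1 - Polynomial.X : Polynomial ℝ).natDegree ≤ 1 := by
        refine (Polynomial.natDegree_sub_le _ _).trans ?_
        simp
      nlinarith
    have a2 : (P.comp M * pT d n r).natDegree ≤ (n-1) + d * n := by
      refine (Polynomial.natDegree_mul_le).trans ?_
      refine add_le_add ?_ (pT_deg d n r)
      refine (Polynomial.natDegree_comp_le).trans ?_
      have : M.natDegree ≤ 1 := by
        refine (Polynomial.natDegree_sub_le _ _).trans ?_
        simp only [Polynomial.natDegree_one, zero_le, sup_of_le_right]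
        exact (Polynomial.natDegree_C_mul_le _ _).trans Polynomial.natDegree_X_le
      calc P.natDegree * M.natDegree ≤ P.natDegree * 1 := Nat.mul_le_mul_left _ this
        _ ≤ n - 1 := by omega
    have : (d+2)*n = d * n + 2 * n := by ring
    omega
  have h6 := kN_repr d ((d+2)*n-1) hd _ hdeg
  rw [NN_eq d n hn] at h6
  have e1 : (fun y => P.eval (1 - 2 * y) * (phiY d n r).eval y) = fun y => dimPi d ((d+2)*n) * (jF ((d+2)*n-1) ((d:ℝ)/2) ((d:ℝ)/2-1)).eval y * (P.comp M * pT d n r * (1 - Polynomial.X)^n).eval y := by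
    ext y
    unfold phiY kN
    simp only [Polynomial.eval_mul, Polynomial.eval_C, Polynomial.eval_comp, hMe]
    ring
  rw [e1, h6]
  simp only [Polynomial.eval_mul, Polynomial.eval_comp, hMe, pT, jF_zero]
  rw [mul_div_cancel_left₀ _ (bB_pos d (by omega)).ne']
  simp

theorem k_sq_int (d n : ℕ) (hd : 3 ≤ d) (hn : 1 ≤ n) :
    Lw ((d:ℝ)/2-1) ((d:ℝ)/2-1) (fun y => (kN d n).eval y ^ 2) = bB d / dimPi d ((d+2)*n) := by
  have h6 := kN_repr d ((d+2)*n-1) hd (kN d n) (jF_natDegree _ _ _)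
  rw [NN_eq d n hn] at h6
  have e : (fun y => (kN d n).eval y ^ 2) = fun y => (dimPi d ((d+2)*n))⁻¹ * (dimPi d ((d+2)*n) * (jF ((d+2)*n-1) ((d:ℝ)/2) ((d:ℝ)/2-1)).eval y * (kN d n).eval y) := by
    ext y
    have := dimPi_pos d ((d+2)*n) (by omega) (Nat.mul_pos (by omega) hn)
    unfold kN
    field_simp
  rw [e, Lw_const_mul, h6, kN, jF_zero]
  field_simp

theorem kN_le (d n : ℕ) (hd : 3 ≤ d) {y : ℝ} (hy : y ∈ Icc (0:ℝ) 1) : |(kN d n).eval y| ≤ 1 := by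
  have hd' : (3:ℝ) ≤ d := by exact_mod_cast hd
  exact jF_le_one _ (by linarith) (by linarith) hy

theorem pT_le (d n : ℕ) {r : ℝ} (hr : 0 < r) (hd : 3 ≤ d) {y : ℝ} (hy : y ∈ Icc (0:ℝ) 1) : |(pT d n r).eval y| ≤ 1 := by
  have hd' : (3:ℝ) ≤ d := by exact_mod_cast hd
  exact jF_le_one _ (by linarith) (by linarith) hy

theorem pT_int (d n : ℕ) {r : ℝ} (hr : 0 < r) (hd : 3 ≤ d) :
    Lw ((d:ℝ)/2-1) ((d:ℝ)/2-1) (fun y => y ^ r * (pT d n r).eval y ^ 2) =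
     (2 * (d*n:ℕ) + ((d:ℝ)/2-2) + 1) / (d/2+r) * jh (d*n) (d/2+r) (d/2-2) := by
  have hd' : (3:ℝ) ≤ d := by exact_mod_cast hd
  rw [← jF_norm _ (by linarith) (by linarith) (by linarith), ← jF_shift _ (by linarith) (by linarith)]
  refine Lw_congr fun y hy => ?_
  unfold jw
  rw [show (d:ℝ)/2+r-1 = (d/2-1)+r by ring, rpow_add hy.1, show (d:ℝ)/2-2+1 = d/2-1 by ring]
  unfold pT
  ring

theorem gam_lower {x s : ℝ} (hx : 1 < x) (hs : 0 ≤ s) : Real.Gamma x * (x - 1) ^ s ≤ Real.Gamma (x + s) := by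
  rcases hs.eq_or_lt with h | h
  · rw [← h]; simp
  have hc := Real.convexOn_log_Gamma.slope_mono_adjacent (x := x - 1) (y := x) (z := x + s)
    (by simp; linarith) (by simp; linarith) (by linarith) (by linarith)
  simp only [Function.comp] at hc
  have p1 : 0 < Real.Gamma (x-1) := Real.Gamma_pos_of_pos (by linarith)
  have p2 : 0 < Real.Gamma x := Real.Gamma_pos_of_pos (by linarith)
  have p3 : 0 < Real.Gamma (x+s) := Real.Gamma_pos_of_pos (by linarith)
  have e1 : Real.Gamma x = (x-1) * Real.Gamma (x-1) := by
    conv_lhs => rw [show x = (x-1)+1 by ring]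
    exact Real.Gamma_add_one (by linarith)
  have e2 : Real.log (Real.Gamma x) - Real.log (Real.Gamma (x-1)) = Real.log (x-1) := by
    rw [e1, Real.log_mul (by linarith) p1.ne']; ring
  rw [e2, show x - (x-1) = 1 by ring, div_one, show x + s - x = s by ring, le_div_iff₀ h] at hc
  rw [← Real.log_le_log_iff (by have : 0 < x-1 := by linarith
                                positivity) p3, Real.log_mul p2.ne' (by have : 0 < x-1 := by linarith
                                                                        positivity), Real.log_rpow (by linarith)]
  linarith

theorem gam_upper {x s : ℝ} (hx : 0 < x) (hs : 0 ≤ s) : Real.Gamma (x + s) ≤ Real.Gamma x * (x + s) ^ s := by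
  rcases hs.eq_or_lt with h | h
  · rw [← h]; simp
  have hc := Real.convexOn_log_Gamma.slope_mono_adjacent (x := x) (y := x+s) (z := x + s+1)
    (by simp; linarith) (by simp; linarith) (by linarith) (by linarith)
  simp only [Function.comp] at hc
  have p2 : 0 < Real.Gamma x := Real.Gamma_pos_of_pos (by linarith)
  have p3 : 0 < Real.Gamma (x+s) := Real.Gamma_pos_of_pos (by linarith)
  have e2 : Real.log (Real.Gamma (x+s+1)) - Real.log (Real.Gamma (x+s)) = Real.log (x+s) := by
    rw [Real.Gamma_add_one (by linarith), Real.log_mul (by linarith) p3.ne']; ring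
  rw [e2, show x+s+1 - (x+s) = 1 by ring, div_one, show x + s - x = s by ring, div_le_iff₀ h] at hc
  rw [← Real.log_le_log_iff p3 (by positivity), Real.log_mul p2.ne' (by positivity), Real.log_rpow (by linarith)]
  linarith

theorem rf_le_pow {a : ℝ} (ha : 0 < a) (m : ℕ) : rf a m ≤ (a + m) ^ m := by
  induction m with
  | zero => simp [rf_zero]
  | succ k ih =>
    rw [rf_succ, pow_succ]
    have : (a + k)^k ≤ (a + (k+1:ℕ))^k := by gcongr; simp
    have h2 : rf a k ≤ (a + (k+1:ℕ))^k := ih.trans this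
    have := rf_pos ha k
    push_cast at *
    gcongr
    simp

theorem rf_ge_pow {a : ℝ} (ha : 0 < a) (m : ℕ) : a ^ m ≤ rf a m := by
  induction m with
  | zero => simp [rf_zero]
  | succ k ih =>
    rw [rf_succ, pow_succ]
    have := rf_pos ha k
    gcongr
    simp

theorem dimPi_rf (d N : ℕ) (hd : 1 ≤ d) (hN : 1 ≤ N) :
    dimPi d N = (2 * N + d - 2) * rf N (d-1) / (d * Real.Gamma d) := by
  have hN' : (0:ℝ) < N := by exact_mod_cast hN
  have hd' : (0:ℝ) < d := by exact_mod_cast hd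
  unfold dimPi
  rw [Real.Gamma_add_one hd'.ne', show (N:ℝ)+d-1 = N + (d-1:ℕ) by push_cast [Nat.cast_sub hd]; ring, rf_Gamma hN']
  have := Real.Gamma_pos_of_pos hN'
  field_simp

theorem dimPi_le (d N : ℕ) (hd : 1 ≤ d) (hN : 1 ≤ N) : dimPi d N ≤ 2 * ((N:ℝ)+d)^d / (d * Real.Gamma d) := by
  have hN' : (1:ℝ) ≤ N := by exact_mod_cast hN
  have hd' : (1:ℝ) ≤ d := by exact_mod_cast hd
  rw [dimPi_rf d N hd hN]
  have := Real.Gamma_pos_of_pos (show (0:ℝ) < d by linarith)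
  refine div_le_div_of_nonneg_right ?_ (by positivity)
  have h1 := rf_le_pow (show (0:ℝ) < N by linarith) (d-1)
  have h2 : ((N:ℝ) + (d-1:ℕ))^(d-1) ≤ ((N:ℝ)+d)^(d-1) := by gcongr; omega
  have h3 := rf_pos (show (0:ℝ) < N by linarith) (d-1)
  calc (2 * (N:ℝ) + d - 2) * rf N (d-1) ≤ (2 * (N + d)) * ((N:ℝ)+d)^(d-1) := by
        apply mul_le_mul _ (h1.trans h2) h3.le (by positivity)
        linarith
    _ = 2 * (((N:ℝ)+d)^(d-1) * (N+d)) := by ring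
    _ = _ := by rw [← pow_succ, Nat.sub_add_cancel hd]

theorem dimPi_ge (d N : ℕ) (hd : 2 ≤ d) (hN : 1 ≤ N) : 2 * (N:ℝ)^d / (d * Real.Gamma d) ≤ dimPi d N := by
  have hN' : (1:ℝ) ≤ N := by exact_mod_cast hN
  have hd' : (2:ℝ) ≤ d := by exact_mod_cast hd
  rw [dimPi_rf d N (by omega) hN]
  have := Real.Gamma_pos_of_pos (show (0:ℝ) < d by linarith)
  refine div_le_div_of_nonneg_right ?_ (by positivity)
  have h1 := rf_ge_pow (show (0:ℝ) < N by linarith) (d-1)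
  have h3 := rf_pos (show (0:ℝ) < N by linarith) (d-1)
  calc 2 * (N:ℝ)^d = (2 * N) * ((N:ℝ))^(d-1) := by
        rw [mul_assoc, ← pow_succ', Nat.sub_add_cancel (by omega : 1 ≤ d)]
    _ ≤ (2 * (N:ℝ) + d - 2) * rf N (d-1) := by
        apply mul_le_mul _ h1 (by positivity) (by linarith)
        linarith

theorem add_pow_exp {a b : ℝ} (ha : 0 < a) (hb : 0 ≤ b) (d : ℕ) : (a + b)^d ≤ a^d * Real.exp (d * b / a) := by
  have h : a + b = a * (b/a + 1) := by field_simp; ring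
  rw [h, mul_pow]
  have h2 : (b/a+1)^d ≤ Real.exp (b/a) ^ d := by
    gcongr; exact Real.add_one_le_exp _
  rw [← Real.exp_nat_mul] at h2
  rw [mul_div_assoc]
  gcongr

theorem K1_le (d n : ℕ) (hd : 3 ≤ d) (hn : 2*(d+1) ≤ n) :
    dimPi d ((d+2)*n) ≤ 2 * Real.exp 3 * ((d:ℝ)*n)^d / (d * Real.Gamma d) := by
  have hd' : (3:ℝ) ≤ d := by exact_mod_cast hd
  have hn' : 2*((d:ℝ)+1) ≤ n := by exact_mod_cast hn
  have hG := Real.Gamma_pos_of_pos (show (0:ℝ) < d by linarith)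
  refine (dimPi_le d _ (by omega) (Nat.mul_pos (by omega) (by omega))).trans ?_
  have h1 : (((d+2)*n:ℕ):ℝ) + d ≤ d * n + 3 * n := by push_cast; nlinarith
  have h2 := add_pow_exp (show (0:ℝ) < d * n by nlinarith) (show (0:ℝ) ≤ 3 * n by linarith) d
  rw [show (d:ℝ) * (3 * n)/(d*n) = 3 by
    have : (0:ℝ) < n := by linarith
    field_simp] at h2
  have h3 : ((((d+2)*n:ℕ):ℝ) + d)^d ≤ (d * n + 3 * n)^d := by gcongr
  rw [show 2 * Real.exp 3 * ((d:ℝ)*n)^d = 2 * (((d:ℝ)*n)^d * Real.exp 3) by ring]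
  gcongr
  exact h3.trans h2

theorem K1_le_Dn (d n : ℕ) (hd : 3 ≤ d) (hn : 2*(d+1) ≤ n) :
    dimPi d ((d+2)*n) ≤ Real.exp 1 * (2:ℝ)^(-(d:ℝ)) * dimPi d (2*(d+2)*n) := by
  have hd' : (3:ℝ) ≤ d := by exact_mod_cast hd
  have hn' : 2*((d:ℝ)+1) ≤ n := by exact_mod_cast hn
  have hG := Real.Gamma_pos_of_pos (show (0:ℝ) < d by linarith)
  refine (dimPi_le d _ (by omega) (Nat.mul_pos (by omega) (by omega))).trans ?_
  have h1 := dimPi_ge d (2*(d+2)*n) (by omega) (Nat.mul_pos (by omega) (by omega))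
  set N : ℝ := (((d+2)*n:ℕ):ℝ) with hN
  have hN2 : N = (d+2)*n := by rw [hN]; push_cast; ring
  have e : ((2*(d+2)*n:ℕ):ℝ) = 2 * N := by rw [hN2]; push_cast; ring
  rw [e] at h1
  have hNp : 0 < N := by rw [hN2]; nlinarith
  have h2 := add_pow_exp hNp (show (0:ℝ) ≤ d by linarith) d
  have h3 : (d:ℝ) * d / N ≤ 1 := by
    rw [div_le_one hNp, hN2]; nlinarith
  have h4 : (N + d)^d ≤ N^d * Real.exp 1 := h2.trans (by gcongr)
  calc 2 * (N+d)^d / (d * Real.Gamma d) ≤ 2 * (N^d * Real.exp 1) / (d * Real.Gamma d) := by gcongr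
    _ = Real.exp 1 * (2:ℝ)^(-(d:ℝ)) * (2 * (2 * N)^d / (d * Real.Gamma d)) := by
        rw [rpow_neg (by norm_num), rpow_natCast, mul_pow]
        field_simp
    _ ≤ _ := by gcongr

theorem Gam_nat_le (d : ℕ) (hd : 1 ≤ d) : (d:ℝ) * Real.Gamma d ≤ (d:ℝ)^d := by
  have hd' : (0:ℝ) < d := by exact_mod_cast hd
  rw [← Real.Gamma_add_one hd'.ne', Real.Gamma_nat_eq_factorial]
  exact_mod_cast Nat.factorial_le_pow d

theorem Gam_ge_exp {x : ℝ} (hx : 0 < x) : (x / Real.exp 1) ^ x ≤ Real.Gamma (x + 1) := by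
  -- integrate over [x, ∞)
  have h := Real.Gamma_eq_integral (show 0 < x + 1 by linarith)
  have hint : IntegrableOn (fun t => Real.exp (-t) * t ^ (x + 1 - 1)) (Ioi 0) := Real.GammaIntegral_convergent (by linarith)
  have h1 : ∫ t in Ioi x, Real.exp (-t) * x ^ x ≤ Real.Gamma (x + 1) := by
    rw [h]
    refine le_trans ?_ (setIntegral_mono_set hint ?_ (LE.le.eventuallyLE (Ioi_subset_Ioi hx.le)))
    · refine setIntegral_mono_on ?_ (hint.mono_set (Ioi_subset_Ioi hx.le)) measurableSet_Ioi ?_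
      · exact (integrableOn_exp_neg_Ioi x).mul_const _
      · intro t ht
        rw [add_sub_cancel_right]
        have : x < t := ht
        gcongr
    · refine (ae_restrict_iff' measurableSet_Ioi).2 (Filter.Eventually.of_forall fun t ht => ?_)
      have : 0 < t := ht
      simp; positivity
  rw [integral_mul_const, integral_exp_neg_Ioi] at h1
  refine le_trans (le_of_eq ?_) h1
  rw [div_rpow hx.le (Real.exp_pos 1).le, ← Real.exp_mul, one_mul, Real.exp_neg]
  field_simp

theorem Dn_ge (d n : ℕ) (hd : 3 ≤ d) (hn : 2*(d+1) ≤ n) : (2*(n:ℝ))^d ≤ dimPi d (2*(d+2)*n) := by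
  have hd' : (3:ℝ) ≤ d := by exact_mod_cast hd
  have hn' : 2*((d:ℝ)+1) ≤ n := by exact_mod_cast hn
  have hG := Real.Gamma_pos_of_pos (show (0:ℝ) < d by linarith)
  refine le_trans ?_ (dimPi_ge d (2*(d+2)*n) (by omega) (Nat.mul_pos (by omega) (by omega)))
  rw [le_div_iff₀ (by positivity)]
  have h := Gam_nat_le d (by omega)
  calc (2*(n:ℝ))^d * (d * Real.Gamma d) ≤ (2*(n:ℝ))^d * (d:ℝ)^d := by gcongr
    _ = (2 * d * n)^d := by rw [← mul_pow]; ring_nf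
    _ ≤ (((2*(d+2)*n:ℕ):ℝ))^d := by
        push_cast
        gcongr; linarith
    _ ≤ _ := by
      have : (0:ℝ) ≤ (((2*(d+2)*n:ℕ):ℝ))^d := by positivity
      linarith

theorem Dn_le (d n : ℕ) (hd : 3 ≤ d) (hn : 2*(d+1) ≤ n) : dimPi d (2*(d+2)*n) ≤ (4 * Real.exp 4 * n)^d := by
  have hd' : (3:ℝ) ≤ d := by exact_mod_cast hd
  have hn' : 2*((d:ℝ)+1) ≤ n := by exact_mod_cast hn
  have hG := Real.Gamma_pos_of_pos (show (0:ℝ) < d by linarith)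
  refine (dimPi_le d _ (by omega) (Nat.mul_pos (by omega) (by omega))).trans ?_
  have h0 := Gam_ge_exp (show (0:ℝ) < d by linarith)
  rw [Real.Gamma_add_one (by linarith), rpow_natCast] at h0
  rw [div_le_iff₀ (by positivity)]
  have h1 : (((2*(d+2)*n:ℕ):ℝ) + d) ≤ 2 * Real.exp 3 * d * n := by
    have he : 4 ≤ Real.exp 3 := by have := Real.add_one_le_exp (3:ℝ); linarith
    push_cast
    have : 2 * 4 * (d:ℝ) * n ≤ 2 * Real.exp 3 * d * n := by gcongr
    nlinarith
  calc 2 * (((2*(d+2)*n:ℕ):ℝ) + d)^d ≤ 2^d * (2 * Real.exp 3 * d * n)^d := by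
        have h2 : (2:ℝ) ≤ 2^d := by
          calc (2:ℝ) = 2^1 := by norm_num
            _ ≤ 2^d := pow_le_pow_right₀ (by norm_num) (by omega)
        gcongr
    _ = (4 * Real.exp 4 * n)^d * (d / Real.exp 1)^d := by
        rw [← mul_pow, ← mul_pow, show (4:ℝ) = 3 + 1 by norm_num, Real.exp_add]
        congr 1
        field_simp
        norm_num
        ring
    _ ≤ _ := by gcongr

/-- constant in the weighted estimate -/
def Cg (r : ℝ) : ℝ := 4 * Real.exp 3 * 2 ^ (r+2) * (r+2) ^ (2*(r+1))

theorem Cg_pos {r : ℝ} (hr : 0 < r) : 0 < Cg r := by unfold Cg; positivity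

theorem G_bound (d n : ℕ) {r : ℝ} (hr : 0 < r) (hd : 3 ≤ d) (hn : 2*(d+1) ≤ n) :
    dimPi d ((d+2)*n) * (Lw ((d:ℝ)/2-1) ((d:ℝ)/2-1) (fun y => y ^ r * (pT d n r).eval y ^ 2) / bB d) ≤ Cg r * (n:ℝ) ^ (-(2*r)) := by
  have hd' : (3:ℝ) ≤ d := by exact_mod_cast hd
  have hn' : 2*((d:ℝ)+1) ≤ n := by exact_mod_cast hn
  have hdp : (0:ℝ) < d := by linarith
  have hnp : (0:ℝ) < n := by linarith
  have hG := Real.Gamma_pos_of_pos (show (0:ℝ) < d by linarith)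
  have hG2 := Real.Gamma_pos_of_pos (show (0:ℝ) < (d:ℝ)/2 by linarith)
  set K := dimPi d ((d+2)*n) with hK
  have hKp : 0 < K := dimPi_pos _ _ (by omega) (Nat.mul_pos (by omega) (by omega))
  have hKle : K ≤ 2 * Real.exp 3 * ((d:ℝ)*n)^d / (d * Real.Gamma d) := K1_le d n hd hn
  rw [pT_int d n hr hd]
  have hm : ((d*n:ℕ):ℝ) = d * n := by push_cast; ring
  unfold jh
  rw [← Real.Gamma_nat_eq_factorial, hm]
  set m : ℝ := (d:ℝ) * n with hmd
  have hm1 : 24 ≤ m := by rw [hmd]; nlinarith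
  have hmp : 0 < m := by linarith
  set α : ℝ := (d:ℝ)/2 + r with hα
  set β : ℝ := (d:ℝ)/2 - 2 with hβ
  have A1 : Real.Gamma (m+1) * m ^ ((d:ℝ)+r-2) ≤ Real.Gamma (m+α+β+1) := by
    have := gam_lower (x := m+1) (s := (d:ℝ)+r-2) (by linarith) (by linarith)
    rw [show m+α+β+1 = m+1+((d:ℝ)+r-2) by rw [hα, hβ]; ring]
    simpa using this
  have A2 : Real.Gamma (m+β+1) * (m/2) ^ (r+2) ≤ Real.Gamma (m+α+1) := by
    have := gam_lower (x := m+β+1) (s := r+2) (by rw [hβ]; linarith) (by linarith)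
    rw [show m+α+1 = m+β+1+(r+2) by rw [hα, hβ]; ring]
    refine le_trans ?_ this
    have : 0 < Real.Gamma (m+β+1) := Real.Gamma_pos_of_pos (by rw [hβ]; linarith)
    have h2 : m/2 ≤ m+β+1-1 := by rw [hβ]; linarith
    gcongr
  have A3 : Real.Gamma (α+1) ≤ Real.Gamma ((d:ℝ)/2) * ((r+2)*d)^(r+1) := by
    have := gam_upper (x := (d:ℝ)/2) (s := r+1) (by linarith) (by linarith)
    rw [show α+1 = (d:ℝ)/2+(r+1) by rw [hα]; ring]
    refine this.trans ?_
    have h2 : (d:ℝ)/2+(r+1) ≤ (r+2)*d := by nlinarith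
    gcongr
  have pa : 0 < Real.Gamma (m+1) := Real.Gamma_pos_of_pos (by linarith)
  have pb : 0 < Real.Gamma (m+β+1) := Real.Gamma_pos_of_pos (by rw [hβ]; linarith)
  have pc : 0 < Real.Gamma (α+1) := Real.Gamma_pos_of_pos (by rw [hα]; linarith)
  have pd : 0 < Real.Gamma (m+α+β+1) := lt_of_lt_of_le (by positivity) A1
  have pe : 0 < Real.Gamma (m+α+1) := lt_of_lt_of_le (by positivity) A2
  have hαp : (d:ℝ)/2 ≤ α := by rw [hα]; linarith
  have hαp' : 0 < α := by linarith
  have q1 : 0 < 2*m+β+1 := by rw [hβ]; linarith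
  have q2 : 0 < 2*m+α+β+1 := by linarith
  -- bound the jh factor
  have B1 : (2*m+β+1)/α * (Real.Gamma (m+1) * Real.Gamma (α+1)^2 * Real.Gamma (m+β+1) /
      ((2*m+α+β+1) * Real.Gamma (m+α+β+1) * Real.Gamma (m+α+1))) ≤
      (2/d) * (Real.Gamma ((d:ℝ)/2) * ((r+2)*d)^(r+1))^2 / (m ^ ((d:ℝ)+r-2) * (m/2)^(r+2)) := by
    have e1 : (2*m+β+1)/α * (Real.Gamma (m+1) * Real.Gamma (α+1)^2 * Real.Gamma (m+β+1) /
      ((2*m+α+β+1) * Real.Gamma (m+α+β+1) * Real.Gamma (m+α+1))) =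
      ((2*m+β+1)/(2*m+α+β+1)) * (1/α) * Real.Gamma (α+1)^2 * (Real.Gamma (m+1)/Real.Gamma (m+α+β+1)) * (Real.Gamma (m+β+1)/Real.Gamma (m+α+1)) := by
      field_simp
    have c1 : (2*m+β+1)/(2*m+α+β+1) ≤ 1 := by rw [div_le_one q2]; linarith
    have c2 : 1/α ≤ 2/d := by rw [div_le_div_iff₀ hαp' hdp]; linarith
    have c3 : Real.Gamma (m+1)/Real.Gamma (m+α+β+1) ≤ 1/(m ^ ((d:ℝ)+r-2)) := by
      rw [div_le_div_iff₀ pd (by positivity)]; linarith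
    have c4 : Real.Gamma (m+β+1)/Real.Gamma (m+α+1) ≤ 1/((m/2)^(r+2)) := by
      rw [div_le_div_iff₀ pe (by positivity)]; linarith
    rw [e1]
    calc _ ≤ 1 * (2/d) * (Real.Gamma ((d:ℝ)/2) * ((r+2)*d)^(r+1))^2 * (1/(m ^ ((d:ℝ)+r-2))) * (1/((m/2)^(r+2))) := by
          gcongr
      _ = _ := by field_simp
  have hB := bB_pos d (by omega)
  calc K * (_ / bB d) ≤ (2 * Real.exp 3 * m^d / (d * Real.Gamma d)) * (((2/d) * (Real.Gamma ((d:ℝ)/2) * ((r+2)*d)^(r+1))^2 / (m ^ ((d:ℝ)+r-2) * (m/2)^(r+2))) / bB d) := by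
        gcongr
    _ = Cg r * (n:ℝ) ^ (-(2*r)) := by
        unfold bB Cg
        have e1 : m ^ ((d:ℝ)+r-2) * (m/2)^(r+2) = m^d * (m^(2*r)) / 2^(r+2) := by
          rw [div_rpow hmp.le (by norm_num), show (d:ℝ)+r-2 = d + (r-2) by ring, rpow_add hmp, rpow_natCast, ← mul_div_assoc, mul_assoc, ← rpow_add hmp]
          ring_nf
        have e2 : (((r+2)*d)^(r+1))^2 = (r+2)^(2*(r+1)) * ((d:ℝ)^(2*r) * d^2) := by
          rw [← rpow_natCast (((r+2)*d)^(r+1)), ← rpow_mul (by positivity), mul_rpow (by linarith) hdp.le,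
            show (r+1)*((2:ℕ):ℝ) = 2*r+((2:ℕ):ℝ) by push_cast; ring, rpow_add hdp, rpow_natCast]
          push_cast; ring_nf
        have e3 : m^(2*r) = (d:ℝ)^(2*r) * n^(2*r) := by rw [hmd, mul_rpow hdp.le hnp.le]
        rw [mul_pow (Real.Gamma ((d:ℝ)/2)), e1, e2, e3, rpow_neg hnp.le]
        have : (0:ℝ) < (d:ℝ)^(2*r) := by positivity
        have : (0:ℝ) < (n:ℝ)^(2*r) := by positivity
        have : (0:ℝ) < (2:ℝ)^(r+2) := by positivity
        have : (0:ℝ) < m^d := by positivity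
        field_simp
        ring


theorem cap_bound (d n : ℕ) (hd : 3 ≤ d) (hn : 2*(d+1) ≤ n) :
    dimPi d ((d+2)*n) * (Lw ((d:ℝ)/2-1) ((d:ℝ)/2-1) (fun y => Real.exp d * (1-y)^(512*d*n^2)) / bB d) ≤
      Real.exp 3 * Real.exp (-d) := by
  have hd' : (3:ℝ) ≤ d := by exact_mod_cast hd
  have hn' : 2*((d:ℝ)+1) ≤ n := by exact_mod_cast hn
  have hdp : (0:ℝ) < d := by linarith
  have hnp : (0:ℝ) < n := by linarith
  have hG := Real.Gamma_pos_of_pos (show (0:ℝ) < d by linarith)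
  have hG2 := Real.Gamma_pos_of_pos (show (0:ℝ) < (d:ℝ)/2 by linarith)
  set K := dimPi d ((d+2)*n) with hK
  have hKp : 0 < K := dimPi_pos _ _ (by omega) (Nat.mul_pos (by omega) (by omega))
  have hKle : K ≤ 2 * Real.exp 3 * ((d:ℝ)*n)^d / (d * Real.Gamma d) := K1_le d n hd hn
  rw [Lw_const_mul]
  have h1 := Lw_mono_pow (a := (d:ℝ)/2-1) (b := (d:ℝ)/2-1) (by linarith) (by linarith) 0 (512*d*n^2)
  simp only [pow_zero, one_mul, Nat.cast_zero, add_zero] at h1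
  rw [h1]
  set j : ℝ := ((512*d*n^2:ℕ):ℝ) with hj
  have hj' : j = 512*d*n^2 := by rw [hj]; push_cast; ring
  have hjp : 0 < j := by rw [hj']; positivity
  rw [show (d:ℝ)/2-1+1 = d/2 by ring, show (d:ℝ)/2-1+j+1 = d/2+j by ring,
    show (d:ℝ)/2-1+(d/2-1)+j+2 = d/2+j+d/2 by ring]
  have h2 := gam_lower (x := (d:ℝ)/2+j) (s := (d:ℝ)/2) (by linarith [show 1 ≤ j by rw [hj']; nlinarith [mul_pos hdp (sq_pos_of_pos hnp), mul_self_nonneg ((n:ℝ)-1)]]) (by linarith)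
  have hGj := Real.Gamma_pos_of_pos (show (0:ℝ) < (d:ℝ)/2+j by linarith)
  have h3 : Real.Gamma (d/2+j) * j^((d:ℝ)/2) ≤ Real.Gamma (d/2+j+d/2) := by
    refine le_trans ?_ h2
    gcongr; linarith
  have hGt : 0 < Real.Gamma (d/2+j+d/2) := lt_of_lt_of_le (by positivity) h3
  have h4 : Real.Gamma (d/2+j) / Real.Gamma (d/2+j+d/2) ≤ 1 / j^((d:ℝ)/2) := by
    rw [div_le_div_iff₀ hGt (by positivity)]; linarith
  have h5 := Gam_ge_exp (show (0:ℝ) < (d:ℝ)/2 by linarith)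
  rw [Real.Gamma_add_one (by linarith)] at h5
  have h6 : 1 / Real.Gamma ((d:ℝ)/2) ≤ (d/2) / ((d:ℝ)/2/Real.exp 1)^((d:ℝ)/2) := by
    rw [div_le_div_iff₀ hG2 (by positivity)]; linarith
  have hB := bB_pos d (by omega)
  have e0 : ((d:ℝ)*n)^d = (((d:ℝ)*n)^2)^((d:ℝ)/2) := by
    rw [← rpow_natCast _ 2, ← rpow_mul (by positivity), ← rpow_natCast]
    congr 1; push_cast; ring
  calc K * (Real.exp d * (Real.Gamma (d/2) * Real.Gamma (d/2+j) / Real.Gamma (d/2+j+d/2)) / bB d)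
      = K * Real.exp d * Real.Gamma d * (1 / Real.Gamma ((d:ℝ)/2)) * (Real.Gamma (d/2+j) / Real.Gamma (d/2+j+d/2)) := by
        unfold bB; field_simp
    _ ≤ (2 * Real.exp 3 * ((d:ℝ)*n)^d / (d * Real.Gamma d)) * Real.exp d * Real.Gamma d * ((d/2) / ((d:ℝ)/2/Real.exp 1)^((d:ℝ)/2)) * (1 / j^((d:ℝ)/2)) := by
        gcongr
    _ = Real.exp 3 * (Real.exp d * ((((d:ℝ)*n)^2)^((d:ℝ)/2) / (((d:ℝ)/2/Real.exp 1)^((d:ℝ)/2) * j^((d:ℝ)/2)))) := by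
        rw [e0]; field_simp
    _ = Real.exp 3 * (Real.exp 3 / 256)^((d:ℝ)/2) := by
        rw [← mul_rpow (by positivity) hjp.le, ← div_rpow (by positivity) (by positivity)]
        rw [show Real.exp (d:ℝ) = Real.exp 2 ^ ((d:ℝ)/2) by rw [← Real.exp_mul]; congr 1; ring]
        rw [← mul_rpow (by positivity) (by positivity), hj']
        congr 2
        rw [show (3:ℝ) = 2 + 1 by norm_num, Real.exp_add]
        field_simp
        norm_num
    _ ≤ Real.exp 3 * (Real.exp (-2))^((d:ℝ)/2) := by
        gcongr
        rw [div_le_iff₀ (by norm_num), show (3:ℝ) = 5 + (-2) by norm_num, Real.exp_add]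
        have : Real.exp 5 ≤ 256 := by
          have h := Real.exp_one_lt_d9.le
          calc Real.exp 5 = Real.exp 1 ^ 5 := by rw [← Real.exp_nat_mul]; norm_num
            _ ≤ 2.7182818286 ^ 5 := by gcongr
            _ ≤ 256 := by norm_num
        have := Real.exp_pos (-2)
        nlinarith
    _ = _ := by
        rw [← Real.exp_mul]; congr 2; ring

/-- variance constant -/
def Cv (r : ℝ) : ℝ := Real.exp 3 + 3 * 1024 ^ r * Cg r + 1

theorem k_decay (d n : ℕ) (hd : 3 ≤ d) (hn : 2*(d+1) ≤ n) {y : ℝ} (hy : y ∈ Icc (1/(1024*(n:ℝ)^2)) (1/2)) :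
    (kN d n).eval y ^ 2 ≤ 3 * Real.exp (-((d:ℝ)/512)) := by
  have hd' : (3:ℝ) ≤ d := by exact_mod_cast hd
  have hn' : 2*((d:ℝ)+1) ≤ n := by exact_mod_cast hn
  have hnp : (0:ℝ) < n := by linarith
  have hn8 : (8:ℝ) ≤ n := by linarith
  have hN : (((d+2)*n-1:ℕ):ℝ) = (d+2)*n - 1 := by
    rw [Nat.cast_sub (Nat.mul_pos (by omega) (by omega))]; push_cast; ring
  have hNN : (d:ℝ) + 2 ≤ (d+2)*n := by nlinarith
  have hmu : (((d+2)*n-1:ℕ):ℝ) * ((((d+2)*n-1:ℕ):ℝ) + d/2 + (d/2-1) + 1) ≤ 2 * (((d:ℝ)+2)*n)^2 := by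
    rw [hN]
    calc _ ≤ (((d:ℝ)+2)*n) * (2*(((d:ℝ)+2)*n)) := by
          apply mul_le_mul <;> linarith
      _ = _ := by ring
  have hmu2 : (((d:ℝ)+2)*n)^2 ≤ (((d+2)*n-1:ℕ):ℝ) * ((((d+2)*n-1:ℕ):ℝ) + d/2 + (d/2-1) + 1) := by
    rw [hN]; set N := ((d:ℝ)+2)*n; nlinarith
  have hy1s : 1/(1024*(n:ℝ)^2) ≤ 1/16 := by
    rw [div_le_div_iff₀ (by positivity) (by norm_num)]; nlinarith
  have hdec := jF_decay ((d+2)*n-1) (α := (d:ℝ)/2) (β := (d:ℝ)/2-1) (y1 := 1/(1024*(n:ℝ)^2)) (by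
      have : 1 * 2 ≤ (d+2)*n := Nat.mul_le_mul (by omega) (by omega)
      omega) (by linarith) (by linarith) (by positivity) hy1s (by
      rw [mul_one_div, div_le_iff₀ (by positivity)]
      have h4 : (0:ℝ) ≤ ((d+2) * n)^2 := by positivity
      calc _ ≤ 8 * (2 * (((d:ℝ)+2)*n)^2) := by linarith
        _ ≤ 256 * (((d:ℝ)+2)*n)^2 := by linarith
        _ = _ := by ring) (y := y) hy
  refine hdec.trans ?_
  refine mul_le_mul_of_nonneg_left ?_ (by norm_num)
  rw [Real.exp_le_exp, neg_le_neg_iff, mul_one_div, div_div, le_div_iff₀ (by positivity)]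
  refine le_trans ?_ hmu2
  have : (d:ℝ)/512*(((d:ℝ)/2+1)*(1024*(n:ℝ)^2)) = (d*(d+2))*n^2 := by ring
  rw [this, mul_pow]
  gcongr
  nlinarith

theorem V_point (d n : ℕ) {r : ℝ} (hr : 0 < r) (hd : 3 ≤ d) (hn : 2*(d+1) ≤ n) {K y1 : ℝ} (hK : K = dimPi d ((d+2)*n))
    (hKp : 0 < K) (hy1 : y1 = 1/(1024*(n:ℝ)^2)) (hn8 : (8:ℝ) ≤ n) (hy1p : 0 < y1) (hy1s : y1 ≤ 1/16) :
    ∀ y ∈ Icc (0:ℝ) 1, (phiY d n r).eval y ^ 2 ≤ K^2 * (Real.exp d * (1-y)^(512*d*n^2)) +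
      (K^2 * (3 * Real.exp (-((d:ℝ)/512)) * (1/y1)^r) * (y^r * (pT d n r).eval y ^ 2) + K^2 * (1/4)^n * (kN d n).eval y ^ 2) := by
    intro y hy
    have hk := kN_le d n hd hy
    have hp := pT_le d n hr hd hy
    have hk' : (kN d n).eval y ^ 2 ≤ 1 := (sq_le_one_iff_abs_le_one _).2 hk
    have hp' : (pT d n r).eval y ^ 2 ≤ 1 := (sq_le_one_iff_abs_le_one _).2 hp
    have h1y : 0 ≤ 1 - y := by linarith [hy.2]
    have h1y' : 1 - y ≤ 1 := by linarith [hy.1]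
    have hyn := hy.1
    have hnp : (0:ℝ) < n := by linarith
    have e : (phiY d n r).eval y ^ 2 = K^2 * ((kN d n).eval y ^ 2 * (pT d n r).eval y ^ 2 * ((1-y)^n)^2) := by
      unfold phiY
      rw [← hK]
      simp only [Polynomial.eval_mul, Polynomial.eval_C, Polynomial.eval_pow, Polynomial.eval_sub, Polynomial.eval_one, Polynomial.eval_X]
      ring
    have q0 : 0 ≤ (kN d n).eval y ^ 2 := sq_nonneg _
    have q1 : 0 ≤ (pT d n r).eval y ^ 2 := sq_nonneg _
    have q2 : ((1-y)^n)^2 ≤ 1 := by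
      have := pow_le_one₀ h1y h1y' (n := n)
      have h0 : 0 ≤ (1-y)^n := by positivity
      nlinarith
    have q2' : 0 ≤ ((1-y)^n)^2 := sq_nonneg _
    have t1 : 0 ≤ K^2 * (Real.exp d * (1-y)^(512*d*n^2)) := by positivity
    have t2 : 0 ≤ K^2 * (3 * Real.exp (-((d:ℝ)/512)) * (1/y1)^r) * (y^r * (pT d n r).eval y ^ 2) := by positivity
    have t3 : 0 ≤ K^2 * (1/4)^n * (kN d n).eval y ^ 2 := by positivity
    rw [e]
    have kp1 : (kN d n).eval y ^ 2 * (pT d n r).eval y ^ 2 ≤ 1 := mul_le_one₀ hk' q1 hp'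
    rcases le_total y y1 with h | h
    · have : 1 ≤ Real.exp d * (1-y)^(512*d*n^2) := by
        have hb : Real.exp (-(2*y1)) ≤ 1 - y := by
          have h1 : 1 - y1 ≤ 1 - y := by linarith
          refine le_trans ?_ h1
          have h2 := Real.add_one_le_exp (2*y1)
          rw [Real.exp_neg, inv_le_comm₀ (Real.exp_pos _) (by linarith)]
          refine le_trans ?_ h2
          rw [inv_le_iff_one_le_mul₀ (by linarith)]
          nlinarith
        have h3 : Real.exp (-(2*y1)) ^ (512*d*n^2) ≤ (1-y)^(512*d*n^2) := by gcongr
        rw [← Real.exp_nat_mul] at h3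
        have h4 : ((512*d*n^2:ℕ):ℝ) * (-(2*y1)) = -d := by
          rw [hy1]; push_cast; field_simp; norm_num
        rw [h4] at h3
        calc (1:ℝ) = Real.exp d * Real.exp (-d) := by rw [← Real.exp_add]; simp
          _ ≤ _ := by gcongr
      have : K^2 * ((kN d n).eval y ^ 2 * (pT d n r).eval y ^ 2 * ((1-y)^n)^2) ≤ K^2 * (Real.exp d * (1-y)^(512*d*n^2)) := by
        exact mul_le_mul_of_nonneg_left ((mul_le_one₀ kp1 q2' q2).trans this) (by positivity)
      linarith
    rcases le_total y (1/2) with h' | h'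
    · have hk3 := k_decay d n hd hn (y := y) ⟨hy1 ▸ h, h'⟩
      have hyr : 1 ≤ (1/y1)^r * y^r := by
        rw [← mul_rpow (by positivity) hyn]
        refine one_le_rpow ?_ hr.le
        rw [one_div, ← div_eq_inv_mul, one_le_div hy1p]; exact h
      have : K^2 * ((kN d n).eval y ^ 2 * (pT d n r).eval y ^ 2 * ((1-y)^n)^2) ≤ K^2 * (3 * Real.exp (-((d:ℝ)/512)) * (1/y1)^r) * (y^r * (pT d n r).eval y ^ 2) := by
        calc _ ≤ K^2 * ((3 * Real.exp (-((d:ℝ)/512))) * (pT d n r).eval y ^ 2 * 1) := by gcongr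
          _ = K^2 * (3 * Real.exp (-((d:ℝ)/512))) * (pT d n r).eval y ^ 2 * 1 := by ring
          _ ≤ K^2 * (3 * Real.exp (-((d:ℝ)/512))) * (pT d n r).eval y ^ 2 * ((1/y1)^r * y^r) := by gcongr
          _ = _ := by ring
      linarith
    · have : ((1-y)^n)^2 ≤ (1/4)^n := by
        rw [← pow_mul, mul_comm, pow_mul]
        gcongr
        nlinarith
      have : K^2 * ((kN d n).eval y ^ 2 * (pT d n r).eval y ^ 2 * ((1-y)^n)^2) ≤ K^2 * (1/4)^n * (kN d n).eval y ^ 2 := by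
        calc _ ≤ K^2 * ((kN d n).eval y ^ 2 * 1 * (1/4)^n) := by gcongr
          _ = _ := by ring
      linarith

theorem V_bound (d n : ℕ) {r : ℝ} (hr : 0 < r) (hd : 3 ≤ d) (hn : 2*(d+1) ≤ n) :
    Lw ((d:ℝ)/2-1) ((d:ℝ)/2-1) (fun y => (phiY d n r).eval y ^ 2) / bB d ≤
      Cv r * dimPi d ((d+2)*n) * Real.exp (-((d:ℝ)/512)) := by
  have hd' : (3:ℝ) ≤ d := by exact_mod_cast hd
  have hn' : 2*((d:ℝ)+1) ≤ n := by exact_mod_cast hn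
  have hdp : (0:ℝ) < d := by linarith
  have hnp : (0:ℝ) < n := by linarith
  have ha : -1 < (d:ℝ)/2-1 := by linarith
  have hcap := cap_bound d n hd hn
  have hGb := G_bound d n hr hd hn
  have hk2 := k_sq_int d n hd (by omega)
  set K := dimPi d ((d+2)*n) with hK
  have hKp : 0 < K := dimPi_pos _ _ (by omega) (Nat.mul_pos (by omega) (by omega))
  set y1 : ℝ := 1/(1024*(n:ℝ)^2) with hy1
  have hn8 : (8:ℝ) ≤ n := by linarith
  have hy1p : 0 < y1 := by positivity
  have hy1s : y1 ≤ 1/16 := by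
    rw [hy1, div_le_div_iff₀ (by positivity) (by norm_num)]; nlinarith
  have point := V_point d n hr hd hn hK hKp hy1 hn8 hy1p hy1s
  have hcr : Continuous (fun y : ℝ => y ^ r) := Real.continuous_rpow_const hr.le
  have hL := Lw_mono (a := (d:ℝ)/2-1) (b := (d:ℝ)/2-1) ha ha (by fun_prop) (by fun_prop) point
  rw [Lw_add ha ha (by fun_prop) (by fun_prop), Lw_add ha ha (by fun_prop) (by fun_prop), Lw_const_mul, Lw_const_mul, Lw_const_mul, Lw_const_mul, hk2] at hL
  rw [Lw_const_mul] at hcap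
  have hB := bB_pos d (by omega)
  rw [div_le_iff₀ hB]
  refine hL.trans ?_
  set L1 := Real.exp d * Lw ((d:ℝ)/2-1) ((d:ℝ)/2-1) (fun y => (1-y)^(512*d*n^2))
  set L2 := Lw ((d:ℝ)/2-1) ((d:ℝ)/2-1) (fun y => y ^ r * (pT d n r).eval y ^ 2)
  have hE : Real.exp (-d) ≤ Real.exp (-((d:ℝ)/512)) := by rw [Real.exp_le_exp]; linarith
  have h1 : K * (L1 / bB d) ≤ Real.exp 3 * Real.exp (-((d:ℝ)/512)) := hcap.trans (by gcongr)
  have h1' : K^2 * L1 ≤ K * bB d * (Real.exp 3 * Real.exp (-((d:ℝ)/512))) := by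
    have : K^2 * L1 = K * bB d * (K * (L1 / bB d)) := by field_simp
    rw [this]; gcongr
  have hy1r : (1/y1)^r * (n:ℝ)^(-(2*r)) = 1024^r := by
    have : 1/y1 = 1024 * (n:ℝ)^2 := by rw [hy1]; field_simp
    rw [this, mul_rpow (by norm_num) (by positivity), ← rpow_natCast, ← rpow_mul hnp.le, mul_assoc, ← rpow_add hnp]
    push_cast; simp
  have h2' : K^2 * (3 * Real.exp (-((d:ℝ)/512)) * (1/y1)^r) * L2 ≤ K * bB d * (3 * 1024^r * Cg r * Real.exp (-((d:ℝ)/512))) := by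
    have : K^2 * (3 * Real.exp (-((d:ℝ)/512)) * (1/y1)^r) * L2 = K * bB d * ((3 * Real.exp (-((d:ℝ)/512)) * (1/y1)^r) * (K * (L2 / bB d))) := by field_simp
    rw [this]
    calc _ ≤ K * bB d * ((3 * Real.exp (-((d:ℝ)/512)) * (1/y1)^r) * (Cg r * (n:ℝ)^(-(2*r)))) := by gcongr
      _ = K * bB d * (3 * ((1/y1)^r * (n:ℝ)^(-(2*r))) * Cg r * Real.exp (-((d:ℝ)/512))) := by ring
      _ = _ := by rw [hy1r]
  have h3' : K^2 * (1/4)^n * (bB d / K) ≤ K * bB d * Real.exp (-((d:ℝ)/512)) := by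
    have : K^2 * (1/4)^n * (bB d / K) = K * bB d * (1/4)^n := by field_simp
    rw [this]
    gcongr
    have h4 : (1/4:ℝ) ≤ Real.exp (-1) := by
      rw [Real.exp_neg, ← one_div]
      have := Real.exp_one_lt_d9
      exact one_div_le_one_div_of_le (Real.exp_pos 1) (by linarith)
    calc (1/4:ℝ)^n ≤ Real.exp (-1)^n := by gcongr
      _ = Real.exp (n * (-1)) := by rw [← Real.exp_nat_mul]
      _ ≤ _ := by rw [Real.exp_le_exp]; linarith
  unfold Cv
  linarith

theorem lagr_growth (m : ℕ) (Q : Polynomial ℝ) (hQ : Q.natDegree ≤ m) {s0 B : ℝ} (h0 : 0 < s0) (h1 : s0 ≤ 1)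
    (hB : ∀ s ∈ Icc (0:ℝ) s0, |Q.eval s| ≤ B) :
    |Q.eval 1| ≤ (m+1) * ((m:ℝ)/s0)^m * B := by
  have hB0 : 0 ≤ B := (abs_nonneg _).trans (hB 0 ⟨le_rfl, h0.le⟩)
  set v : ℕ → ℝ := fun i => i * s0 / m with hv
  have hsep : ∀ i ∈ Finset.range (m+1), ∀ j ∈ Finset.range (m+1), i ≠ j → s0 / m ≤ |v i - v j| ∧ 0 < s0 / m := by
    intro i hi j hj hij
    have hm : 0 < m := by
      simp only [Finset.mem_range] at hi hj; omega
    have hm' : (0:ℝ) < m := by exact_mod_cast hm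
    refine ⟨?_, by positivity⟩
    have : v i - v j = ((i:ℤ) - j : ℤ) * (s0/m) := by simp only [hv]; push_cast; ring
    rw [this, abs_mul, abs_of_pos (show 0 < s0/m by positivity)]
    have h2 : (1:ℝ) ≤ |(((i:ℤ) - j : ℤ):ℝ)| := by
      rw [← Int.cast_abs]
      have : 1 ≤ |(i:ℤ) - j| := Int.one_le_abs (by omega)
      exact_mod_cast this
    have : 0 < s0 / m := by positivity
    nlinarith
  have hinj : Set.InjOn v (Finset.range (m+1)) := by
    intro i hi j hj hij
    by_contra hne
    obtain ⟨h2, h3⟩ := hsep i hi j hj hne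
    rw [hij, sub_self, abs_zero] at h2; linarith
  have hint := Lagrange.eq_interpolate (s := Finset.range (m+1)) (v := v) (f := Q) hinj (by
    rw [Finset.card_range]
    exact lt_of_le_of_lt Polynomial.degree_le_natDegree (by exact_mod_cast Nat.lt_succ_of_le hQ))
  have hvm : ∀ i ∈ Finset.range (m+1), v i ∈ Icc 0 s0 := by
    intro i hi
    simp only [Finset.mem_range] at hi
    rcases Nat.eq_zero_or_pos m with h | h
    · simp only [hv, h]; simp [h0.le]
    have hm' : (0:ℝ) < m := by exact_mod_cast h
    have hi' : (i:ℝ) ≤ m := by exact_mod_cast Nat.lt_succ_iff.1 hi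
    refine ⟨by simp only [hv]; positivity, ?_⟩
    simp only [hv]; rw [div_le_iff₀ hm', mul_comm]; gcongr
  rw [hint, Lagrange.interpolate_apply, Polynomial.eval_finsetSum]
  have hterm : ∀ i ∈ Finset.range (m+1), |(Polynomial.C (Q.eval (v i)) * Lagrange.basis (Finset.range (m+1)) v i).eval 1| ≤ ((m:ℝ)/s0)^m * B := by
    intro i hi
    rw [Polynomial.eval_mul, Polynomial.eval_C, abs_mul, mul_comm]
    have hb : |(Lagrange.basis (Finset.range (m+1)) v i).eval 1| ≤ ((m:ℝ)/s0)^m := by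
      unfold Lagrange.basis
      rw [Polynomial.eval_prod, Finset.abs_prod]
      calc _ ≤ ∏ j ∈ (Finset.range (m+1)).erase i, ((m:ℝ)/s0) := by
            refine Finset.prod_le_prod (fun _ _ => abs_nonneg _) ?_
            intro j hj
            have hj1 := Finset.mem_of_mem_erase hj
            have hj2 := Finset.ne_of_mem_erase hj
            obtain ⟨h2, h3⟩ := hsep i hi j hj1 (Ne.symm hj2)
            unfold Lagrange.basisDivisor
            rw [Polynomial.eval_mul, Polynomial.eval_C, Polynomial.eval_sub, Polynomial.eval_X, Polynomial.eval_C, abs_mul, abs_inv]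
            have h4 := hvm j hj1
            have h5 : |1 - v j| ≤ 1 := by rw [abs_le]; constructor <;> linarith [h4.1, h4.2]
            have h6 : |v i - v j|⁻¹ ≤ (s0/m)⁻¹ := inv_anti₀ h3 h2
            rw [inv_div] at h6
            calc _ ≤ ((m:ℝ)/s0) * 1 := mul_le_mul h6 h5 (abs_nonneg _) (by positivity)
              _ = _ := mul_one _
        _ = _ := by rw [Finset.prod_const, Finset.card_erase_of_mem hi, Finset.card_range, Nat.add_sub_cancel]
    exact mul_le_mul hb (hB _ (hvm i hi)) (abs_nonneg _) (by positivity)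
  calc _ ≤ ∑ i ∈ Finset.range (m+1), |(Polynomial.C (Q.eval (v i)) * Lagrange.basis (Finset.range (m+1)) v i).eval 1| := Finset.abs_sum_le_sum_abs _ _
    _ ≤ ∑ i ∈ Finset.range (m+1), ((m:ℝ)/s0)^m * B := Finset.sum_le_sum hterm
    _ = _ := by rw [Finset.sum_const, Finset.card_range, nsmul_eq_mul]; push_cast; ring

/-- homogenised substitution -/
theorem exists_subst {ι : Type*} [Fintype ι] (p : MvPolynomial ι ℝ) (k : ℕ) (hk : p.totalDegree ≤ k)
    (N : ι → Polynomial ℝ) (hN : ∀ i, (N i).natDegree ≤ 2) (W : Polynomial ℝ) (hW : W.natDegree ≤ 2) :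
    ∃ Q : Polynomial ℝ, Q.natDegree ≤ 2*k ∧ ∀ s, W.eval s ≠ 0 →
      Q.eval s = (W.eval s)^k * MvPolynomial.eval (fun i => (N i).eval s / W.eval s) p := by
  classical
  refine ⟨∑ m ∈ p.support, Polynomial.C (p.coeff m) * (∏ i, N i ^ m i) * W ^ (k - ∑ i, m i), ?_, ?_⟩
  · refine Polynomial.natDegree_sum_le_of_forall_le _ _ ?_
    intro m hm
    have hmk : ∑ i, m i ≤ k := by
      refine le_trans ?_ hk
      have := MvPolynomial.le_totalDegree hm
      rwa [Finsupp.sum_fintype _ _ (fun _ => rfl)] at this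
    refine (Polynomial.natDegree_mul_le).trans ?_
    have h1 : (Polynomial.C (p.coeff m) * (∏ i, N i ^ m i)).natDegree ≤ 2 * ∑ i, m i := by
      refine (Polynomial.natDegree_C_mul_le _ _).trans ?_
      refine (Polynomial.natDegree_prod_le _ _).trans ?_
      rw [Finset.mul_sum]
      refine Finset.sum_le_sum fun i _ => ?_
      refine Polynomial.natDegree_pow_le.trans ?_
      rw [mul_comm]; exact Nat.mul_le_mul_right _ (hN i)
    have h2 : (W ^ (k - ∑ i, m i)).natDegree ≤ (k - ∑ i, m i) * 2 := Polynomial.natDegree_pow_le.trans (Nat.mul_le_mul_left _ hW)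
    omega
  · intro s hs
    rw [Polynomial.eval_finsetSum, MvPolynomial.eval_eq', Finset.mul_sum]
    refine Finset.sum_congr rfl fun m hm => ?_
    have hmk : ∑ i, m i ≤ k := by
      refine le_trans ?_ hk
      have := MvPolynomial.le_totalDegree hm
      rwa [Finsupp.sum_fintype _ _ (fun _ => rfl)] at this
    simp only [Polynomial.eval_mul, Polynomial.eval_C, Polynomial.eval_pow, Polynomial.eval_prod, div_pow]
    rw [Finset.prod_div_distrib, Finset.prod_pow_eq_pow_sum]
    rw [pow_sub₀ _ hs hmk]
    field_simp

theorem dist_sq_ip {d : ℕ} (x y : Sph d) : dist x y ^ 2 = 4 * ((1 - ip x y)/2) := by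
  have hx : ‖(x : Eu d)‖ = 1 := by simp
  have hy : ‖(y : Eu d)‖ = 1 := by simp
  rw [Subtype.dist_eq, dist_eq_norm, norm_sub_sq_real, hx, hy]
  unfold ip; ring

theorem poly_growth {d : ℕ} (p : MvPolynomial (Fin (d+1)) ℝ) (k : ℕ) (hk : p.totalDegree ≤ k) (x y : Sph d)
    {ρ B : ℝ} (hρ : 0 < ρ) (hρ2 : ρ < dist x y) (hy : -1 < ip x y)
    (hB : ∀ z : Sph d, dist x z ≤ ρ → |MvPolynomial.eval (fun i => (z : Eu d) i) p| ≤ B) :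
    |MvPolynomial.eval (fun i => (y : Eu d) i) p| ≤ (2*k+1) * (2*k:ℝ)^(2*k) * 2^k * (4/ρ^2)^k * B := by
  have hB0 : 0 ≤ B := (abs_nonneg _).trans (hB x (by simp [hρ.le]))
  set t := ip x y with ht
  have hxx : ⟪(x : Eu d), (x : Eu d)⟫ = 1 := ip_self x
  have hyy : ⟪(y : Eu d), (y : Eu d)⟫ = 1 := ip_self y
  have hxy : ⟪(x : Eu d), (y : Eu d)⟫ = t := rfl
  have hyx : ⟪(y : Eu d), (x : Eu d)⟫ = t := by rw [real_inner_comm]; exact hxy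
  have ht1 : t ≤ 1 := (ip_mem x y).2
  have hd2 := dist_sq_ip x y
  rw [← ht] at hd2
  have h1t : 0 < 1 + t := by linarith
  set a := (1-t)/(1+t) with ha
  have ha0 : 0 ≤ a := div_nonneg (by linarith) h1t.le
  have hta : t * (1+a) = 1 - a := by rw [ha]; field_simp; ring
  have haq : a / (1+a) = (1-t)/2 := by rw [ha]; field_simp; ring
  have hρa : ρ^2/4 < a/(1+a) := by
    rw [haq]
    have : ρ^2 < dist x y ^ 2 := by gcongr
    linarith
  have hρa' : ρ^2/4 < a := hρa.trans_le (div_le_self ha0 (by linarith))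
  have ha1 : 0 < a := lt_of_le_of_lt (by positivity) hρa'
  have hρ4 : ρ^2/4 < 1 := hρa.trans (by rw [div_lt_one (by linarith)]; linarith)
  set N : Fin (d+1) → Polynomial ℝ := fun i =>
    Polynomial.C ((x : Eu d) i) * (1 - Polynomial.C a * Polynomial.X^2) + Polynomial.C ((1+a)*(y : Eu d) i - (1-a) * (x : Eu d) i) * Polynomial.X with hN
  set W : Polynomial ℝ := 1 + Polynomial.C a * Polynomial.X^2 with hW
  obtain ⟨Q, hQ1, hQ2⟩ := exists_subst p k hk N (fun i => by simp only [hN]; compute_degree) W (by simp only [hW]; compute_degree)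
  have hWe : ∀ s, W.eval s = 1 + a*s^2 := fun s => by simp [hW]
  have hWp : ∀ s, 0 < W.eval s := fun s => by rw [hWe]; positivity
  have hNe : ∀ s i, (N i).eval s = (x : Eu d) i * (1 - a*s^2) + ((1+a)*(y : Eu d) i - (1-a) * (x : Eu d) i) * s := fun s i => by simp [hN]
  -- the curve
  have hz : ∀ s, ∃ z : Sph d, (∀ i, (z : Eu d) i = (N i).eval s / W.eval s) ∧ dist x z ^ 2 = 4 * (a*s^2/(1+a*s^2)) := by
    intro s
    set w : ℝ := 1 + a*s^2 with hw
    have hwp : 0 < w := by positivity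
    set z : Eu d := (w⁻¹) • ((1-a*s^2) • (x : Eu d) + s • ((1+a) • (y : Eu d) - (1-a) • (x : Eu d))) with hzd
    have hin : ⟪(x : Eu d), z⟫ = (1-a*s^2)/w := by
      rw [hzd]
      simp only [inner_smul_right, inner_add_right, inner_sub_right, hxx, hxy]
      have : (1+a)*t - (1-a)*1 = 0 := by linarith
      rw [this]; field_simp; ring
    have hzz : ⟪z, z⟫ = 1 := by
      rw [hzd]
      simp only [inner_smul_right, inner_add_right, inner_sub_right, inner_smul_left, inner_add_left, inner_sub_left, hxx, hxy, hyx, hyy, conj_trivial]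
      have h1 : (1+a)*t = (1-a) := by linarith
      have h2 : w⁻¹ * w = 1 := inv_mul_cancel₀ hwp.ne'
      have h3 : ((1 - a * s ^ 2) * ((1 - a * s ^ 2) * 1 + s * ((1 + a) * t - (1 - a) * 1)) + s * ((1 + a) * ((1 - a * s ^ 2) * t + s * ((1 + a) * 1 - (1 - a) * t)) - (1 - a) * ((1 - a * s ^ 2) * 1 + s * ((1 + a) * t - (1 - a) * 1)))) = w^2 := by
        rw [hw]
        linear_combination (2*s*(1-a*s^2) -2*s^2*(1-a)) * h1
      rw [← mul_assoc]
      first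
        | (calc _ = w⁻¹ * w⁻¹ * w^2 := by rw [← h3]; ring
            _ = (w⁻¹ * w)^2 := by ring
            _ = 1 := by rw [h2]; norm_num)
    have hzn : ‖z‖ = 1 := by
      rw [real_inner_self_eq_norm_sq] at hzz
      have := norm_nonneg z
      nlinarith
    refine ⟨⟨z, by simpa using hzn⟩, ?_, ?_⟩
    · intro i
      rw [hNe, hWe]
      change z i = _
      rw [hzd]
      simp only [PiLp.smul_apply, PiLp.add_apply, PiLp.sub_apply, smul_eq_mul]
      rw [← hw]; field_simp
    · rw [dist_sq_ip]
      have : ip x ⟨z, by simpa using hzn⟩ = (1-a*s^2)/w := hin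
      rw [this]; field_simp; rw [hw]; ring
  set s0 := ρ/(2*Real.sqrt a) with hs0
  have hsa : 0 < Real.sqrt a := Real.sqrt_pos.2 ha1
  have hs0p : 0 < s0 := by positivity
  have hs02 : a * s0^2 = ρ^2/4 := by
    rw [hs0, div_pow, mul_pow, Real.sq_sqrt ha0]; field_simp; norm_num
  have hs01 : s0 ≤ 1 := by
    by_contra h
    push Not at h
    have : 1 < s0^2 := by nlinarith
    nlinarith
  have hQb : ∀ s ∈ Icc (0:ℝ) s0, |Q.eval s| ≤ 2^k * B := by
    intro s hs
    obtain ⟨z, hz1, hz2⟩ := hz s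
    rw [hQ2 s (hWp s).ne', abs_mul]
    have hss : s^2 ≤ s0^2 := by have := hs.1; have := hs.2; gcongr
    have has : a*s^2 ≤ ρ^2/4 := by rw [← hs02]; gcongr
    have h1 : dist x z ≤ ρ := by
      refine abs_le_of_sq_le_sq' ?_ hρ.le |>.2
      rw [hz2]
      have : a*s^2/(1+a*s^2) ≤ a*s^2 := div_le_self (by positivity) (by nlinarith [sq_nonneg s])
      linarith
    have h2 := hB z h1
    simp only [hz1] at h2
    have h3 : |W.eval s ^ k| ≤ 2^k := by
      rw [abs_pow, abs_of_pos (hWp s), hWe]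
      gcongr
      linarith
    exact mul_le_mul h3 h2 (abs_nonneg _) (by positivity)
  have hg := lagr_growth (2*k) Q hQ1 hs0p hs01 hQb
  have hy1 : ∀ i, (y : Eu d) i = (N i).eval 1 / W.eval 1 := by
    intro i
    rw [hNe, hWe]
    have : (1 + a * 1^2 : ℝ) ≠ 0 := by positivity
    rw [eq_div_iff this]; ring
  simp only [hy1]
  rw [hQ2 1 (hWp 1).ne', abs_mul] at hg
  set E := |MvPolynomial.eval (fun i => (N i).eval 1 / W.eval 1) p|
  have hE : 0 ≤ E := abs_nonneg _
  have hW1 : |W.eval 1 ^ k| = (1+a)^k := by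
    rw [abs_of_pos (pow_pos (hWp 1) k), hWe]; norm_num
  rw [hW1] at hg
  have hak : 0 < a^k := by positivity
  have h5 : (((2*k:ℕ):ℝ)/s0)^(2*k) = (2*k:ℝ)^(2*k) * ((4/ρ^2)^k * a^k) := by
    rw [div_eq_mul_inv, mul_pow, pow_mul (s0⁻¹), ← mul_pow]
    push_cast
    congr 2
    have : s0^2 = ρ^2/4/a := by rw [← hs02]; field_simp
    rw [inv_pow, this]; field_simp
  rw [h5] at hg
  have h6 : a^k * E ≤ (1+a)^k * E := by gcongr; linarith
  have h7 := h6.trans hg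
  have h8 : a^k * E ≤ a^k * ((2*k+1) * (2*k:ℝ)^(2*k) * 2^k * (4/ρ^2)^k * B) := by
    refine h7.trans (le_of_eq ?_); push_cast; ring
  exact le_of_mul_le_mul_left h8 hak

/-- growth constant -/
def Gr (r : ℝ) : ℝ := (2*(⌈r⌉₊:ℝ)+1) * (2*(⌈r⌉₊:ℝ))^(2*⌈r⌉₊) * 2^⌈r⌉₊ * (1+1/(4*r))^⌈r⌉₊ * 2^r

/-- constant for local approximation -/
def Ca (r : ℝ) : ℝ := 1 + (1 + Gr r) * (16*r)^(-(r/2))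

theorem Gr_nonneg {r : ℝ} (hr : 0 < r) : 0 ≤ Gr r := by unfold Gr; positivity

theorem Ca_pos {r : ℝ} (hr : 0 < r) : 0 < Ca r := by
  have := Gr_nonneg hr
  unfold Ca; positivity

theorem Gr_le {r : ℝ} (hr : 0 < r) {k : ℕ} (hk : (k:ℝ) < r) :
    (2*k+1) * (2*k:ℝ)^(2*k) * 2^k * (1+1/(4*r))^k * 2^r ≤ Gr r := by
  have hkq : k ≤ ⌈r⌉₊ := by
    have := Nat.le_ceil r
    exact_mod_cast hk.le.trans this
  have hq : 1 ≤ ⌈r⌉₊ := Nat.one_le_iff_ne_zero.2 (by rw [Ne, Nat.ceil_eq_zero]; linarith)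
  have hkq' : (k:ℝ) ≤ ⌈r⌉₊ := by exact_mod_cast hkq
  have hq' : (1:ℝ) ≤ ⌈r⌉₊ := by exact_mod_cast hq
  have h0 : 0 ≤ 1/(4*r) := by positivity
  unfold Gr
  have h1 : (2*k:ℝ)^(2*k) ≤ (2*(⌈r⌉₊:ℝ))^(2*⌈r⌉₊) :=
    calc (2*k:ℝ)^(2*k) ≤ (2*(⌈r⌉₊:ℝ))^(2*k) := by gcongr
      _ ≤ _ := pow_le_pow_right₀ (by linarith) (by omega)
  have h2 : (2:ℝ)^k ≤ 2^⌈r⌉₊ := pow_le_pow_right₀ (by norm_num) hkq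
  have h3 : (1+1/(4*r))^k ≤ (1+1/(4*r))^⌈r⌉₊ := pow_le_pow_right₀ (by linarith) hkq
  refine mul_le_mul_of_nonneg_right ?_ (by positivity)
  refine mul_le_mul ?_ h3 (by positivity) (by positivity)
  refine mul_le_mul ?_ h2 (by positivity) (by positivity)
  refine mul_le_mul (by linarith) h1 (by positivity) (by positivity)

theorem far_bound {d n : ℕ} {r : ℝ} (hr : 0 < r) (hn : 8 ≤ n) {x y : Sph d} {S L : ℝ} (hL : 0 ≤ L)
    (F : Sph d → ℝ) (hS : ∀ y, |F y| ≤ S) (p : MvPolynomial (Fin (d+1)) ℝ) (hp : (p.totalDegree : ℝ) < r)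
    (hy : √(16*r*Real.log n/n) < dist x y)
    (hloc : ∀ y : Sph d, dist x y ≤ √(16*r*Real.log n/n) → |F y - MvPolynomial.eval (fun i => (y : Eu d) i) p| ≤ L * dist x y ^ r) :
    |F y - MvPolynomial.eval (fun i => (y : Eu d) i) p| * (1 - (1 - ip x y)/2)^n ≤ (1 + Gr r) * (16*r)^(-(r/2)) * (S + L) * dist x y ^ r := by
  have hn' : (8:ℝ) ≤ n := by exact_mod_cast hn
  have hnp : (0:ℝ) < n := by linarith
  have hS0 : 0 ≤ S := (abs_nonneg _).trans (hS x)
  have hlog : 1 ≤ Real.log n := by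
    rw [Real.le_log_iff_exp_le hnp]
    have := Real.exp_one_lt_d9
    linarith
  have hG := Gr_nonneg hr
  set ρ0 := √(16*r*Real.log n/n) with hρ0
  have hρpos : 0 < ρ0 := Real.sqrt_pos.2 (by positivity)
  have hρsq : ρ0^2 = 16*r*Real.log n/n := Real.sq_sqrt (by positivity)
  have hm := ip_mem x y
  have hd2 := dist_sq_ip x y
  rcases eq_or_lt_of_le hm.1 with hm1 | hm1
  · rw [← hm1]
    have : (1 - (1 - -1)/2 : ℝ)^n = 0 := by
      rw [show (1 - (1 - -1)/2 : ℝ) = 0 by norm_num]; exact zero_pow (by omega)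
    rw [this, mul_zero]; positivity
  set η := (1 - ip x y)/2 with hη
  have hη1 : η ≤ 1 := by rw [hη]; linarith
  have hdle : dist x y ≤ 2 := by
    refine (abs_le_of_sq_le_sq' ?_ (by norm_num)).2
    rw [hd2]; linarith
  have hB : ∀ z : Sph d, dist x z ≤ ρ0 → |MvPolynomial.eval (fun i => (z : Eu d) i) p| ≤ 2^r * (S + L) := by
    intro z hz
    have h1 := hloc z hz
    have h2 := hS z
    have h3 : dist x z ^ r ≤ 2^r := Real.rpow_le_rpow dist_nonneg (by linarith) hr.le
    have h4 : L * dist x z ^ r ≤ L * 2^r := by gcongr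
    have h5 : (1:ℝ) ≤ 2^r := Real.one_le_rpow (by norm_num) hr.le
    have h6 : S * 1 ≤ S * 2^r := by gcongr
    have h7 : |MvPolynomial.eval (fun i => (z : Eu d) i) p| ≤ |F z| + |F z - MvPolynomial.eval (fun i => (z : Eu d) i) p| := by
      have := abs_sub (F z) (F z - MvPolynomial.eval (fun i => (z : Eu d) i) p)
      rwa [sub_sub_cancel] at this
    linarith
  have hg := poly_growth p p.totalDegree le_rfl x y hρpos hy hm1 hB
  set k := p.totalDegree with hk
  have hGk := Gr_le hr hp
  have hr4 : (4/ρ0^2)^k ≤ (1+1/(4*r))^k * (n:ℝ)^r := by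
    have h1 : 4/ρ0^2 ≤ (1+1/(4*r)) * n := by
      rw [hρsq]
      calc 4/(16*r*Real.log n/n) = (1/(4*r)) * n * (1/Real.log n) := by field_simp; norm_num
        _ ≤ (1/(4*r)) * n * 1 := by
            gcongr
            rw [div_le_one (by linarith)]; exact hlog
        _ ≤ _ := by nlinarith
    calc (4/ρ0^2)^k ≤ ((1+1/(4*r)) * n)^k := by gcongr
      _ = (1+1/(4*r))^k * (n:ℝ)^k := mul_pow _ _ _
      _ ≤ _ := by
        gcongr
        rw [← Real.rpow_natCast]
        exact Real.rpow_le_rpow_of_exponent_le (by linarith) hp.le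
  have hnr : 1 ≤ (n:ℝ)^r := Real.one_le_rpow (by linarith) hr.le
  have hPy : |MvPolynomial.eval (fun i => (y : Eu d) i) p| ≤ Gr r * (n:ℝ)^r * (S+L) := by
    refine hg.trans ?_
    calc _ ≤ (2*k+1) * (2*k:ℝ)^(2*k) * 2^k * ((1+1/(4*r))^k * (n:ℝ)^r) * (2^r*(S+L)) := by gcongr
      _ = ((2*k+1) * (2*k:ℝ)^(2*k) * 2^k * (1+1/(4*r))^k * 2^r) * (n:ℝ)^r * (S+L) := by ring
      _ ≤ _ := by gcongr
  have hF : |F y - MvPolynomial.eval (fun i => (y : Eu d) i) p| ≤ (1 + Gr r) * (n:ℝ)^r * (S+L) := by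
    have h1 := abs_sub (F y) (MvPolynomial.eval (fun i => (y : Eu d) i) p)
    have h2 := hS y
    have h3 : S + L ≤ (n:ℝ)^r * (S+L) := by nlinarith
    nlinarith
  have hfac : (1-η)^n ≤ (n:ℝ)^(-(4*r)) := by
    have h1 : 1 - η ≤ Real.exp (-η) := by have := Real.add_one_le_exp (-η); linarith
    have h2 : 4*r*Real.log n ≤ n*η := by
      have : ρ0^2 < dist x y ^2 := by gcongr
      rw [hρsq, hd2, div_lt_iff₀ hnp] at this
      linarith
    calc (1-η)^n ≤ (Real.exp (-η))^n := pow_le_pow_left₀ (by linarith) h1 n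
      _ = Real.exp (n * (-η)) := by rw [Real.exp_nat_mul]
      _ ≤ Real.exp (Real.log n * (-(4*r))) := by rw [Real.exp_le_exp]; linarith
      _ = _ := by rw [Real.rpow_def_of_pos hnp]
  have hdr : (16*r)^(r/2) * (n:ℝ)^(-(r/2)) ≤ dist x y ^ r := by
    have h1 : (16*r/n)^(r/2) ≤ (dist x y ^ 2)^(r/2) := by
      refine Real.rpow_le_rpow (by positivity) ?_ (by positivity)
      have : ρ0^2 < dist x y ^2 := by gcongr
      refine le_trans ?_ this.le
      rw [hρsq]
      refine div_le_div_of_nonneg_right ?_ hnp.le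
      exact le_mul_of_one_le_right (by positivity) hlog
    have h2 : (dist x y ^ 2)^(r/2) = dist x y ^ r := by
      rw [← Real.rpow_natCast, ← Real.rpow_mul dist_nonneg]; congr 1; push_cast; ring
    rw [h2, Real.div_rpow (by positivity) hnp.le] at h1
    rwa [Real.rpow_neg hnp.le, ← div_eq_mul_inv]
  have hne : (n:ℝ)^r * (n:ℝ)^(-(4*r)) ≤ (n:ℝ)^(-(r/2)) := by
    rw [← Real.rpow_add hnp]
    exact Real.rpow_le_rpow_of_exponent_le (by linarith) (by linarith)
  have hinv : (n:ℝ)^(-(r/2)) ≤ (16*r)^(-(r/2)) * dist x y ^ r := by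
    calc (n:ℝ)^(-(r/2)) = (16*r)^(-(r/2)) * ((16*r)^(r/2) * (n:ℝ)^(-(r/2))) := by
          rw [← mul_assoc, ← Real.rpow_add (by positivity)]; simp
      _ ≤ _ := by gcongr
  calc _ ≤ ((1 + Gr r) * (n:ℝ)^r * (S+L)) * (n:ℝ)^(-(4*r)) := by
        refine mul_le_mul hF hfac (pow_nonneg (by linarith) _) (by positivity)
    _ = (1 + Gr r) * (S+L) * ((n:ℝ)^r * (n:ℝ)^(-(4*r))) := by ring
    _ ≤ (1 + Gr r) * (S+L) * ((16*r)^(-(r/2)) * dist x y ^ r) := by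
        exact mul_le_mul_of_nonneg_left (hne.trans hinv) (by positivity)
    _ = _ := by ring

theorem loc_bound {d n : ℕ} {r δ : ℝ} (hr : 0 < r) (hn : 8 ≤ n) (hrn : r ≤ n) (x : Sph d) {S L : ℝ} (hL : 0 ≤ L)
    (F : Sph d → ℝ) (hS : ∀ y, |F y| ≤ S) (hδ0 : 0 < δ) (hδ : √(16*r*Real.log n/n) ≤ δ)
    (hP : ∃ P, IsSphPoly d r P ∧ ∀ y ∈ Metric.closedBall x δ, |F y - P y| ≤ L * dist x y ^ r) :
    ∃ p : MvPolynomial (Fin (d+1)) ℝ, p.totalDegree < n ∧ MvPolynomial.eval (fun i => (x : Eu d) i) p = F x ∧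
      ∀ y : Sph d, |F y - MvPolynomial.eval (fun i => (y : Eu d) i) p| * (1 - (1 - ip x y)/2)^n ≤ Ca r * (S + L) * dist x y ^ r := by
  obtain ⟨P, ⟨p, hp1, hp2⟩, hP⟩ := hP
  have hG := Gr_nonneg hr
  have hS0 : 0 ≤ S := (abs_nonneg _).trans (hS x)
  simp only [hp2] at hP
  refine ⟨p, by exact_mod_cast hp1.trans_le hrn, ?_, ?_⟩
  · have := hP x (by simp [hδ0.le])
    rw [dist_self, Real.zero_rpow hr.ne', mul_zero] at this
    have := abs_nonpos_iff.1 this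
    linarith
  intro y
  have hloc : ∀ y : Sph d, dist x y ≤ √(16*r*Real.log n/n) → |F y - MvPolynomial.eval (fun i => (y : Eu d) i) p| ≤ L * dist x y ^ r := by
    intro y hy
    refine hP y ?_
    rw [Metric.mem_closedBall, dist_comm]; exact hy.trans hδ
  have hdr : 0 ≤ dist x y ^ r := Real.rpow_nonneg dist_nonneg _
  have hq : 0 ≤ (1 + Gr r) * (16*r)^(-(r/2)) := by positivity
  rcases le_or_gt (dist x y) (√(16*r*Real.log n/n)) with h | h
  · have h1 := hloc y h
    have hm := ip_mem x y
    have h2 : (1 - (1 - ip x y)/2)^n ≤ 1 := pow_le_one₀ (by linarith [hm.1]) (by linarith [hm.2])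
    calc _ ≤ (L * dist x y ^ r) * 1 := mul_le_mul h1 h2 (pow_nonneg (by linarith [hm.1]) _) (by positivity)
      _ = L * dist x y ^ r := mul_one _
      _ ≤ (S + L) * dist x y ^ r := by gcongr; linarith
      _ ≤ Ca r * (S + L) * dist x y ^ r := by
        gcongr
        unfold Ca
        have : 0 ≤ (1 + Gr r) * (16*r)^(-(r/2)) * (S+L) := by positivity
        linarith
  · refine (far_bound hr hn hL F hS p hp1 h hloc).trans ?_
    gcongr
    unfold Ca; linarith

theorem approx_bound {d n : ℕ} {r δ : ℝ} (hr : 0 < r) (hd : 3 ≤ d) (hn : 2*(d+1) ≤ n) (hrn : r ≤ n) (x : Sph d) {S L : ℝ} (hL : 0 ≤ L)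
    (F : Sph d → ℝ) (hFc : Continuous F) (hS : ∀ y, |F y| ≤ S) (hδ0 : 0 < δ) (hδ : √(16*r*Real.log n/n) ≤ δ)
    (hP : ∃ P, IsSphPoly d r P ∧ ∀ y ∈ Metric.closedBall x δ, |F y - P y| ≤ L * dist x y ^ r) :
    |F x - ∫ y : Sph d, F y * (phiY d n r).eval ((1 - ip x y)/2) ∂sphMeasure d| ≤ Ca r * 2^r * (Cg r + 1) * (S + L) * (n:ℝ)^(-r) := by
  obtain ⟨p, hp1, hp2, hp3⟩ := loc_bound hr (by omega) hrn x hL F hS hδ0 hδ hP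
  have hn' : 2*((d:ℝ)+1) ≤ n := by exact_mod_cast hn
  have hnp : (0:ℝ) < n := by linarith
  have hS0 : 0 ≤ S := (abs_nonneg _).trans (hS x)
  have hrep := phi_repro d n r hd (by omega) x p hp1
  have hipc := ip_cont x
  have hpc : Continuous (fun y : Sph d => MvPolynomial.eval (fun i => (y : Eu d) i) p) := by
    have := MvPolynomial.continuous_eval p
    exact this.comp (by fun_prop)
  have hphc : Continuous (fun y : Sph d => (phiY d n r).eval ((1 - ip x y)/2)) := by fun_prop
  have hi1 : Integrable (fun y : Sph d => F y * (phiY d n r).eval ((1 - ip x y)/2)) (sphMeasure d) := sph_integrable (hFc.mul hphc)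
  have hi2 : Integrable (fun y : Sph d => MvPolynomial.eval (fun i => (y : Eu d) i) p * (phiY d n r).eval ((1 - ip x y)/2)) (sphMeasure d) := sph_integrable (hpc.mul hphc)
  rw [← hp2, ← hrep, abs_sub_comm, ← integral_sub hi1 hi2]
  set K := dimPi d ((d+2)*n) with hK
  have hKp : 0 < K := dimPi_pos _ _ (by omega) (Nat.mul_pos (by omega) (by omega))
  have hCa := Ca_pos hr
  set c0 := Ca r * 2^r * (S + L) with hc0
  have hc0p : 0 ≤ c0 := by positivity
  set g : ℝ → ℝ := fun η => c0 * (K * ((n:ℝ)^r * (η^r * (pT d n r).eval η ^2) + (n:ℝ)^(-r) * (kN d n).eval η ^ 2)) with hg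
  have hcr : Continuous (fun y : ℝ => y ^ r) := Real.continuous_rpow_const hr.le
  have hgc : Continuous g := by simp only [hg]; fun_prop
  have hpt : ∀ y : Sph d, ‖F y * (phiY d n r).eval ((1 - ip x y)/2) - MvPolynomial.eval (fun i => (y : Eu d) i) p * (phiY d n r).eval ((1 - ip x y)/2)‖ ≤ g ((1 - ip x y)/2) := by
    intro y
    have h3 := hp3 y
    have hm := ip_mem x y
    have hd2 := dist_sq_ip x y
    set η := (1 - ip x y)/2 with hη
    have hη0 : 0 ≤ η := by rw [hη]; linarith [hm.2]
    have hη1 : 0 ≤ 1 - η := by rw [hη]; linarith [hm.1]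
    have hdr : dist x y ^ r = 2^r * η^(r/2) := by
      have h2 : (dist x y ^ 2)^(r/2) = dist x y ^ r := by
        rw [← Real.rpow_natCast, ← Real.rpow_mul dist_nonneg]; congr 1; push_cast; ring
      rw [← h2, hd2, Real.mul_rpow (by norm_num) hη0, show (4:ℝ) = 2^(2:ℝ) by norm_num, ← Real.rpow_mul (by norm_num)]
      congr 2; ring
    rw [← sub_mul, Real.norm_eq_abs, abs_mul]
    have e : |(phiY d n r).eval η| = K * (|(kN d n).eval η| * |(pT d n r).eval η|) * (1-η)^n := by
      unfold phiY
      rw [← hK]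
      simp only [Polynomial.eval_mul, Polynomial.eval_C, Polynomial.eval_pow, Polynomial.eval_sub, Polynomial.eval_one, Polynomial.eval_X]
      rw [abs_mul, abs_mul, abs_mul, abs_of_pos hKp, abs_of_nonneg (pow_nonneg hη1 n)]
      ring
    rw [e]
    have amgm : η^(r/2) * (|(kN d n).eval η| * |(pT d n r).eval η|) ≤ (n:ℝ)^r * (η^r * (pT d n r).eval η ^2) + (n:ℝ)^(-r) * (kN d n).eval η ^ 2 := by
      set u := (n:ℝ)^(r/2) * (η^(r/2) * |(pT d n r).eval η|) with hu
      set v := (n:ℝ)^(-(r/2)) * |(kN d n).eval η| with hv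
      have h1 : u * v = η^(r/2) * (|(kN d n).eval η| * |(pT d n r).eval η|) := by
        have : (n:ℝ)^(r/2) * (n:ℝ)^(-(r/2)) = 1 := by rw [← Real.rpow_add hnp]; simp
        calc u * v = ((n:ℝ)^(r/2) * (n:ℝ)^(-(r/2))) * (η^(r/2) * (|(kN d n).eval η| * |(pT d n r).eval η|)) := by rw [hu, hv]; ring
          _ = _ := by rw [this, one_mul]
      have h2 : u^2 = (n:ℝ)^r * (η^r * (pT d n r).eval η ^2) := by
        rw [hu, mul_pow, mul_pow, sq_abs, ← Real.rpow_natCast, ← Real.rpow_natCast, ← Real.rpow_mul hnp.le, ← Real.rpow_mul hη0]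
        congr 2
        · push_cast; ring
        · congr 1; push_cast; ring
      have h3 : v^2 = (n:ℝ)^(-r) * (kN d n).eval η ^2 := by
        rw [hv, mul_pow, sq_abs, ← Real.rpow_natCast, ← Real.rpow_mul hnp.le]
        congr 2
        push_cast; ring
      rw [← h1, ← h2, ← h3]
      nlinarith [sq_nonneg (u-v), sq_nonneg u, sq_nonneg v]
    calc _ = (|F y - MvPolynomial.eval (fun i => (y : Eu d) i) p| * (1-η)^n) * (K * (|(kN d n).eval η| * |(pT d n r).eval η|)) := by ring
      _ ≤ (Ca r * (S + L) * (2^r * η^(r/2))) * (K * (|(kN d n).eval η| * |(pT d n r).eval η|)) := by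
          rw [← hdr]
          exact mul_le_mul_of_nonneg_right h3 (by positivity)
      _ = c0 * (K * (η^(r/2) * (|(kN d n).eval η| * |(pT d n r).eval η|))) := by rw [hc0]; ring
      _ ≤ _ := by
          simp only [hg]
          exact mul_le_mul_of_nonneg_left (mul_le_mul_of_nonneg_left amgm hKp.le) hc0p
  have hI := norm_integral_le_of_norm_le (μ := sphMeasure d) (sph_integrable (F := fun y => g ((1 - ip x y)/2)) (by fun_prop)) (Filter.Eventually.of_forall hpt)
  rw [Real.norm_eq_abs] at hI
  refine hI.trans ?_
  rw [sph_zonal d (by omega) x g hgc]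
  have ha : -1 < (d:ℝ)/2-1 := by
    have : (3:ℝ) ≤ d := by exact_mod_cast hd
    linarith
  simp only [hg]
  rw [Lw_const_mul, Lw_const_mul, Lw_add ha ha (by fun_prop) (by fun_prop), Lw_const_mul, Lw_const_mul, k_sq_int d n hd (by omega)]
  have hGb := G_bound d n hr hd hn
  rw [← hK] at hGb ⊢
  set L2 := Lw ((d:ℝ)/2-1) ((d:ℝ)/2-1) (fun y => y ^ r * (pT d n r).eval y ^ 2)
  have hB := bB_pos d (by omega)
  calc c0 * (K * ((n:ℝ)^r * L2 + (n:ℝ)^(-r) * (bB d / K))) / bB d = c0 * ((n:ℝ)^r * (K * (L2 / bB d)) + (n:ℝ)^(-r)) := by field_simp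
    _ ≤ c0 * ((n:ℝ)^r * (Cg r * (n:ℝ)^(-(2*r))) + (n:ℝ)^(-r)) := by gcongr
    _ = c0 * (Cg r * ((n:ℝ)^r * (n:ℝ)^(-(2*r))) + (n:ℝ)^(-r)) := by ring
    _ = _ := by
      rw [← Real.rpow_add hnp, show r + -(2*r) = -r by ring, hc0]; ring

theorem exp_quad (u : ℝ) : Real.exp u ≤ 1 + u + u^2 * Real.exp |u| := by
  rcases le_or_gt |u| 1 with h | h
  · have h1 := (abs_le.1 (Real.abs_exp_sub_one_sub_id_le h)).2
    have h2 : 1 ≤ Real.exp |u| := Real.one_le_exp (abs_nonneg _)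
    nlinarith [sq_nonneg u]
  · have h2 := Real.add_one_le_exp |u|
    have h3 : 1 ≤ u^2 := by rw [← sq_abs]; nlinarith
    rcases le_or_gt 0 u with h0 | h0
    · rw [abs_of_nonneg h0] at *
      have := Real.exp_pos u
      nlinarith
    · have h4 : Real.exp u ≤ 1 := Real.exp_le_one_iff.2 h0.le
      rw [abs_of_neg h0] at *
      nlinarith

theorem mgf_bound {Ω : Type*} [MeasurableSpace Ω] (τ : Measure Ω) [IsProbabilityMeasure τ] (g : Ω → ℝ) (hg : Measurable g)
    {R V s : ℝ} (hR : ∀ ω, |g ω| ≤ R) (hV : ∫ ω, g ω ^ 2 ∂τ ≤ V) (hs : 0 ≤ s) :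
    ∫ ω, Real.exp (s * g ω) ∂τ ≤ Real.exp (s * (∫ ω, g ω ∂τ) + s^2 * V * Real.exp (s*R)) := by
  have hi : Integrable g τ := Integrable.of_bound hg.aestronglyMeasurable R (Filter.Eventually.of_forall hR)
  have hi2 : Integrable (fun ω => g ω ^ 2) τ := by
    refine Integrable.of_bound (hg.pow_const 2).aestronglyMeasurable (R^2) (Filter.Eventually.of_forall fun ω => ?_)
    rw [Real.norm_eq_abs, abs_pow]
    have := hR ω
    gcongr
  have hie : Integrable (fun ω => Real.exp (s * g ω)) τ := by
    refine Integrable.of_bound ((hg.const_mul s).exp).aestronglyMeasurable (Real.exp (s*R)) (Filter.Eventually.of_forall fun ω => ?_)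
    rw [Real.norm_eq_abs, Real.abs_exp, Real.exp_le_exp]
    exact mul_le_mul_of_nonneg_left ((le_abs_self _).trans (hR ω)) hs
  have h1 : ∫ ω, Real.exp (s * g ω) ∂τ ≤ ∫ ω, ((1 + s * g ω) + (s^2 * Real.exp (s*R)) * g ω ^ 2) ∂τ := by
    refine integral_mono hie ((((integrable_const 1).add (hi.const_mul s))).add (hi2.const_mul _)) ?_
    intro ω
    refine (exp_quad _).trans ?_
    have h2 : |s * g ω| ≤ s * R := by
      rw [abs_mul, abs_of_nonneg hs]; exact mul_le_mul_of_nonneg_left (hR ω) hs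
    have h3 : Real.exp |s * g ω| ≤ Real.exp (s*R) := Real.exp_le_exp.2 h2
    have h4 : (s * g ω)^2 * Real.exp |s * g ω| ≤ (s * g ω)^2 * Real.exp (s*R) := by gcongr
    have h5 : (s * g ω)^2 * Real.exp (s*R) = (s^2 * Real.exp (s*R)) * g ω ^ 2 := by ring
    change _ ≤ 1 + s * g ω + (s^2 * Real.exp (s*R)) * g ω ^ 2
    linarith
  have h6 : ∫ ω, ((1 + s * g ω) + (s^2 * Real.exp (s*R)) * g ω ^ 2) ∂τ = 1 + s * (∫ ω, g ω ∂τ) + (s^2 * Real.exp (s*R)) * ∫ ω, g ω ^ 2 ∂τ := by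
    have hi3 : Integrable (fun ω => 1 + s * g ω) τ := (integrable_const 1).add (hi.const_mul s)
    rw [integral_add hi3 (hi2.const_mul _), integral_add (integrable_const 1) (hi.const_mul s), integral_const_mul, integral_const_mul]
    simp
  rw [h6] at h1
  refine h1.trans ?_
  have h7 : (s^2 * Real.exp (s*R)) * ∫ ω, g ω ^ 2 ∂τ ≤ (s^2 * Real.exp (s*R)) * V := by gcongr
  have h8 := Real.add_one_le_exp (s * (∫ ω, g ω ∂τ) + s^2 * V * Real.exp (s*R))
  linarith

theorem conc_one {Ω : Type*} [MeasurableSpace Ω] (τ : Measure Ω) [IsProbabilityMeasure τ] (M : ℕ) (g : Ω → ℝ) (hg : Measurable g)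
    {R V s : ℝ} (hR : ∀ ω, |g ω| ≤ R) (hV : ∫ ω, g ω ^ 2 ∂τ ≤ V) (hs : 0 ≤ s) (t : ℝ) :
    (Measure.pi (fun _ : Fin M => τ)).real {ys | t ≤ ∑ j, g (ys j) - M * ∫ ω, g ω ∂τ} ≤
      Real.exp (-s * t + M * (s^2 * V * Real.exp (s*R))) := by
  set E := ∫ ω, g ω ∂τ with hE
  have hset : {ys : Fin M → Ω | t ≤ ∑ j, g (ys j) - M * E} = {ys | t + M * E ≤ (fun ys : Fin M → Ω => ∑ j, g (ys j)) ys} := by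
    ext ys; simp only [mem_ofPred_eq]; constructor <;> intro h <;> linarith
  rw [hset]
  have hmeas : Measurable (fun ys : Fin M → Ω => ∑ j, g (ys j)) :=
    Finset.measurable_sum _ fun j _ => hg.comp (measurable_pi_apply j)
  have hb : ∀ ys : Fin M → Ω, ∑ j, g (ys j) ≤ M * R := by
    intro ys
    calc ∑ j, g (ys j) ≤ ∑ j : Fin M, R := Finset.sum_le_sum fun j _ => (le_abs_self _).trans (hR _)
      _ = _ := by simp
  have hint : Integrable (fun ys : Fin M → Ω => Real.exp (s * ∑ j, g (ys j))) (Measure.pi (fun _ : Fin M => τ)) := by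
    refine Integrable.of_bound ((hmeas.const_mul s).exp).aestronglyMeasurable (Real.exp (s*(M*R))) (Filter.Eventually.of_forall fun ys => ?_)
    rw [Real.norm_eq_abs, Real.abs_exp, Real.exp_le_exp]
    exact mul_le_mul_of_nonneg_left (hb ys) hs
  have h1 := ProbabilityTheory.measure_ge_le_exp_mul_mgf (μ := Measure.pi (fun _ : Fin M => τ)) (X := fun ys : Fin M → Ω => ∑ j, g (ys j)) (t + M * E) hs hint
  refine h1.trans ?_
  have h2 : ProbabilityTheory.mgf (fun ys : Fin M → Ω => ∑ j, g (ys j)) (Measure.pi (fun _ : Fin M => τ)) s = (∫ ω, Real.exp (s * g ω) ∂τ)^M := by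
    unfold ProbabilityTheory.mgf
    have := integral_fintype_prod_eq_prod (ι := Fin M) (μ := fun _ => τ) (fun (_ : Fin M) ω => Real.exp (s * g ω))
    rw [Finset.prod_const, Finset.card_univ, Fintype.card_fin] at this
    rw [← this]
    congr 1; ext ys
    beta_reduce
    rw [Finset.mul_sum, Real.exp_sum]
  rw [h2]
  have h3 := mgf_bound τ g hg hR hV hs
  have h4 : 0 ≤ ∫ ω, Real.exp (s * g ω) ∂τ := integral_nonneg fun ω => (Real.exp_pos _).le
  calc _ ≤ Real.exp (-s * (t + M*E)) * (Real.exp (s * E + s^2 * V * Real.exp (s*R)))^M := by gcongr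
    _ = _ := by
      rw [← Real.exp_nat_mul, ← Real.exp_add]; congr 1; ring

theorem conc_two {Ω : Type*} [MeasurableSpace Ω] (τ : Measure Ω) [IsProbabilityMeasure τ] (M : ℕ) (g : Ω → ℝ) (hg : Measurable g)
    {R V s : ℝ} (hR : ∀ ω, |g ω| ≤ R) (hV : ∫ ω, g ω ^ 2 ∂τ ≤ V) (hs : 0 ≤ s) (t : ℝ) :
    (Measure.pi (fun _ : Fin M => τ)).real {ys | t ≤ |∑ j, g (ys j) - M * ∫ ω, g ω ∂τ|} ≤
      2 * Real.exp (-s * t + M * (s^2 * V * Real.exp (s*R))) := by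
  have h1 := conc_one τ M g hg hR hV hs t
  have h2 := conc_one τ M (fun ω => - g ω) hg.neg (R := R) (V := V) (s := s) (fun ω => by rw [abs_neg]; exact hR ω) (by simpa using hV) hs t
  have h3 : {ys : Fin M → Ω | t ≤ |∑ j, g (ys j) - M * ∫ ω, g ω ∂τ|} ⊆ {ys | t ≤ ∑ j, g (ys j) - M * ∫ ω, g ω ∂τ} ∪ {ys | t ≤ ∑ j, - g (ys j) - M * ∫ ω, - g ω ∂τ} := by
    intro ys hys
    simp only [mem_ofPred_eq, mem_union] at *
    rcases le_abs.1 hys with h | h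
    · left; exact h
    · right
      rw [Finset.sum_neg_distrib, integral_neg]; linarith
  have h4 := measureReal_mono (μ := Measure.pi (fun _ : Fin M => τ)) h3
  have h5 := measureReal_union_le (μ := Measure.pi (fun _ : Fin M => τ)) {ys | t ≤ ∑ j, g (ys j) - M * ∫ ω, g ω ∂τ} {ys | t ≤ ∑ j, - g (ys j) - M * ∫ ω, - g ω ∂τ}
  linarith

theorem trig_poly (D : ℕ) (P : Polynomial ℝ) (hP : P.natDegree ≤ D) (a b : ℝ) :
    ∃ Q : Polynomial ℂ, Q.natDegree < 2*D+1 ∧ ∀ θ : ℝ,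
      Q.eval (Complex.exp (θ * Complex.I)) = Complex.exp (θ * Complex.I) ^ D * ((P.eval (a * Real.cos θ + b * Real.sin θ) : ℝ) : ℂ) := by
  set α : ℂ := (a - b * Complex.I)/2 with hα
  set β : ℂ := (a + b * Complex.I)/2 with hβ
  refine ⟨∑ m ∈ Finset.range (D+1), Polynomial.C ((P.coeff m : ℝ) : ℂ) * (Polynomial.C α * Polynomial.X^2 + Polynomial.C β)^m * Polynomial.X^(D-m), ?_, ?_⟩
  · refine Nat.lt_succ_of_le (Polynomial.natDegree_sum_le_of_forall_le _ _ ?_)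
    intro m hm
    have hm' := Nat.lt_succ_iff.1 (Finset.mem_range.1 hm)
    refine Polynomial.natDegree_mul_le.trans ?_
    have h1 : (Polynomial.C ((P.coeff m : ℝ) : ℂ) * (Polynomial.C α * Polynomial.X^2 + Polynomial.C β)^m).natDegree ≤ m * 2 := by
      refine (Polynomial.natDegree_C_mul_le _ _).trans (Polynomial.natDegree_pow_le.trans (Nat.mul_le_mul_left _ ?_))
      compute_degree
    have h2 : ((Polynomial.X : Polynomial ℂ)^(D-m)).natDegree ≤ D - m := by simp
    omega
  · intro θ
    set u := Complex.exp (θ * Complex.I) with hu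
    have hu0 : u ≠ 0 := Complex.exp_ne_zero _
    have huc : u = Complex.cos θ + Complex.sin θ * Complex.I := Complex.exp_mul_I _
    have hcs : Complex.cos θ ^ 2 + Complex.sin θ ^ 2 = 1 := by rw [add_comm]; exact Complex.sin_sq_add_cos_sq _
    have hkey : α * u^2 + β = u * ((a * Real.cos θ + b * Real.sin θ : ℝ) : ℂ) := by
      push_cast
      rw [huc, hα, hβ]
      have hI := Complex.I_sq
      linear_combination (-(a + b*Complex.I)/2) * hcs + ((a*Complex.sin θ^2)/2 - b*Complex.sin θ * Complex.cos θ - b * Complex.sin θ^2 * Complex.I/2) * hI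
    have hPe : ((P.eval (a * Real.cos θ + b * Real.sin θ) : ℝ) : ℂ) = ∑ m ∈ Finset.range (D+1), ((P.coeff m : ℝ) : ℂ) * ((a * Real.cos θ + b * Real.sin θ : ℝ) : ℂ)^m := by
      rw [Polynomial.eval_eq_sum_range' (Nat.lt_succ_of_le hP)]
      push_cast; rfl
    rw [hPe, Polynomial.eval_finsetSum, Finset.mul_sum]
    refine Finset.sum_congr rfl fun m hm => ?_
    have hm' := Nat.lt_succ_iff.1 (Finset.mem_range.1 hm)
    simp only [Polynomial.eval_mul, Polynomial.eval_C, Polynomial.eval_pow, Polynomial.eval_add, Polynomial.eval_X]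
    rw [hkey, mul_pow]
    have : u^D = u^m * u^(D-m) := by rw [← pow_add]; congr 1; omega
    rw [this]; ring

theorem root_orth (q : ℕ) (ζ : ℂ) (hζ : IsPrimitiveRoot ζ q) {k l : ℕ} (hk : k < q) (hl : l < q) :
    ∑ j ∈ Finset.range q, (ζ^j)⁻¹^k * (ζ^j)^l = if k = l then (q:ℂ) else 0 := by
  have h0 : ζ ≠ 0 := hζ.ne_zero (by omega)
  have e : ∀ j, (ζ^j)⁻¹^k * (ζ^j)^l = ((ζ^k)⁻¹ * ζ^l)^j := by
    intro j
    rw [mul_pow, inv_pow, inv_pow, ← pow_mul, ← pow_mul, ← pow_mul, ← pow_mul, mul_comm j k, mul_comm j l]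
  simp only [e]
  split_ifs with h
  · subst h
    rw [inv_mul_cancel₀ (pow_ne_zero _ h0)]; simp
  · set z := (ζ^k)⁻¹ * ζ^l with hz
    have hz1 : z ≠ 1 := by
      intro h1
      rw [hz, inv_mul_eq_one₀ (pow_ne_zero _ h0)] at h1
      exact h (hζ.pow_inj hk hl h1)
    have hzq : z^q = 1 := by
      rw [hz, mul_pow, inv_pow, ← pow_mul, ← pow_mul, mul_comm k, mul_comm l, pow_mul, pow_mul, hζ.pow_eq_one]; simp
    have h2 := geom_sum_mul z q
    rw [hzq, sub_self] at h2
    exact (mul_eq_zero.1 h2).resolve_right (sub_ne_zero.2 hz1)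

/-- The discrete representation of increments of trigonometric polynomials. -/
theorem trig_incr (D : ℕ) (θ : ℝ) : ∃ w φ : ℕ → ℝ, (∀ j, |w j| ≤ D * |θ|) ∧
    ∀ (P : Polynomial ℝ), P.natDegree ≤ D → ∀ a b : ℝ,
      P.eval (a * Real.cos θ + b * Real.sin θ) - P.eval a =
        ∑ j ∈ Finset.range (2*D+1), w j * P.eval (a * Real.cos (φ j) + b * Real.sin (φ j)) := by
  set q := 2*D+1 with hq
  have hq0 : q ≠ 0 := by omega
  have hqc : (q:ℂ) ≠ 0 := by exact_mod_cast hq0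
  set ζ : ℂ := Complex.exp (2 * Real.pi * Complex.I / q) with hζ
  have hprim : IsPrimitiveRoot ζ q := Complex.isPrimitiveRoot_exp q hq0
  set φ : ℕ → ℝ := fun j => 2 * Real.pi * j / q with hφ
  have hφe : ∀ j, Complex.exp (φ j * Complex.I) = ζ^j := by
    intro j
    rw [hζ, ← Complex.exp_nat_mul]
    congr 1
    simp only [hφ]; push_cast; ring
  set u := Complex.exp (θ * Complex.I) with hu
  have hu0 : u ≠ 0 := Complex.exp_ne_zero _
  set V : ℕ → ℂ := fun j => (1/(q:ℂ)) * ∑ k ∈ Finset.range q, (u⁻¹^D * u^k - 1) * (ζ^j)⁻¹^k with hV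
  set W : ℕ → ℂ := fun j => V j * (ζ^j)^D with hW
  have hz1 : ‖ζ‖ = 1 := hprim.norm'_eq_one hq0
  have hterm : ∀ k ∈ Finset.range q, ‖u⁻¹^D * u^k - 1‖ ≤ D * |θ| := by
    intro k hk
    have hk' := Finset.mem_range.1 hk
    have e1 : u⁻¹^D * u^k = Complex.exp (Complex.I * (((k:ℝ) - D) * θ : ℝ)) := by
      rw [hu, ← Complex.exp_neg, ← Complex.exp_nat_mul, ← Complex.exp_nat_mul, ← Complex.exp_add]
      congr 1; push_cast; ring
    rw [e1]
    refine (Real.norm_exp_I_mul_ofReal_sub_one_le).trans ?_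
    rw [Real.norm_eq_abs, abs_mul]
    gcongr
    have : (k:ℝ) ≤ 2*D := by exact_mod_cast (by omega : k ≤ 2*D)
    rw [abs_le]; constructor <;> linarith [Nat.cast_nonneg (α := ℝ) k]
  have hWn : ∀ j, ‖W j‖ ≤ D * |θ| := by
    intro j
    simp only [hW, hV]
    rw [norm_mul, norm_pow, norm_pow, hz1, one_pow, one_pow, mul_one, norm_mul, norm_div, norm_one, Complex.norm_natCast]
    have h1 : ‖∑ k ∈ Finset.range q, (u⁻¹^D * u^k - 1) * (ζ^j)⁻¹^k‖ ≤ ∑ k ∈ Finset.range q, D * |θ| := by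
      refine norm_sum_le_of_le _ fun k hk => ?_
      rw [norm_mul, norm_pow, norm_inv, norm_pow, hz1, one_pow, inv_one, one_pow, mul_one]
      exact hterm k hk
    rw [Finset.sum_const, Finset.card_range, nsmul_eq_mul] at h1
    have hqp : (0:ℝ) < q := by exact_mod_cast Nat.pos_of_ne_zero hq0
    calc _ ≤ 1/(q:ℝ) * (q * (D*|θ|)) := by gcongr
      _ = _ := by field_simp
  refine ⟨fun j => (W j).re, φ, fun j => (Complex.abs_re_le_norm _).trans (hWn j), ?_⟩
  intro P hP a b
  obtain ⟨Q, hQ1, hQ2⟩ := trig_poly D P hP a b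
  -- complex identity
  have hid : u⁻¹^D * Q.eval u - Q.eval 1 = ∑ j ∈ Finset.range q, V j * Q.eval (ζ^j) := by
    have hev : ∀ z, Q.eval z = ∑ l ∈ Finset.range q, Q.coeff l * z^l := fun z => Polynomial.eval_eq_sum_range' hQ1 z
    have h1 : ∀ l ∈ Finset.range q, ∑ j ∈ Finset.range q, V j * (ζ^j)^l = u⁻¹^D * u^l - 1 := by
      intro l hl
      have hl' := Finset.mem_range.1 hl
      calc ∑ j ∈ Finset.range q, V j * (ζ^j)^l = (1/(q:ℂ)) * ∑ j ∈ Finset.range q, ∑ k ∈ Finset.range q, (u⁻¹^D * u^k - 1) * ((ζ^j)⁻¹^k * (ζ^j)^l) := by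
            rw [Finset.mul_sum]
            refine Finset.sum_congr rfl fun j _ => ?_
            simp only [hV]
            rw [mul_assoc, Finset.sum_mul]
            congr 1
            refine Finset.sum_congr rfl fun k _ => ?_
            ring
        _ = (1/(q:ℂ)) * ∑ k ∈ Finset.range q, (u⁻¹^D * u^k - 1) * (if k = l then (q:ℂ) else 0) := by
            rw [Finset.sum_comm]
            congr 1
            refine Finset.sum_congr rfl fun k hk => ?_
            rw [← Finset.mul_sum, root_orth q ζ hprim (Finset.mem_range.1 hk) hl']
        _ = _ := by
            simp only [mul_ite, mul_zero]
            rw [Finset.sum_ite_eq' , if_pos hl]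
            field_simp
    calc _ = ∑ l ∈ Finset.range q, Q.coeff l * (u⁻¹^D * u^l - 1) := by
          rw [hev u, hev 1, Finset.mul_sum, ← Finset.sum_sub_distrib]
          refine Finset.sum_congr rfl fun l _ => ?_
          rw [one_pow]; ring
      _ = ∑ l ∈ Finset.range q, Q.coeff l * ∑ j ∈ Finset.range q, V j * (ζ^j)^l := by
          refine Finset.sum_congr rfl fun l hl => ?_
          rw [h1 l hl]
      _ = ∑ j ∈ Finset.range q, ∑ l ∈ Finset.range q, Q.coeff l * (V j * (ζ^j)^l) := by
          rw [Finset.sum_comm]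
          refine Finset.sum_congr rfl fun l _ => ?_
          rw [Finset.mul_sum]
      _ = _ := by
          refine Finset.sum_congr rfl fun j _ => ?_
          rw [hev, Finset.mul_sum]
          refine Finset.sum_congr rfl fun l _ => ?_
          ring
  have hQu := hQ2 θ
  rw [← hu] at hQu
  have hQ0 := hQ2 0
  simp only [Complex.ofReal_zero, zero_mul, Complex.exp_zero, one_pow, one_mul, Real.cos_zero, Real.sin_zero, mul_one, mul_zero, add_zero] at hQ0
  have hQj : ∀ j, Q.eval (ζ^j) = (ζ^j)^D * ((P.eval (a * Real.cos (φ j) + b * Real.sin (φ j)) : ℝ) : ℂ) := by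
    intro j
    have := hQ2 (φ j)
    rwa [hφe] at this
  rw [hQu, hQ0] at hid
  have h3 : u⁻¹^D * (u^D * ((P.eval (a * Real.cos θ + b * Real.sin θ) : ℝ) : ℂ)) = ((P.eval (a * Real.cos θ + b * Real.sin θ) : ℝ) : ℂ) := by
    rw [← mul_assoc, ← mul_pow, inv_mul_cancel₀ hu0, one_pow, one_mul]
  rw [h3] at hid
  have h4 := congrArg Complex.re hid
  rw [← Complex.ofReal_sub, Complex.ofReal_re, Complex.re_sum] at h4
  rw [h4]
  refine Finset.sum_congr rfl fun j _ => ?_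
  rw [hQj, ← mul_assoc, Complex.re_mul_ofReal]

theorem great_circle {d : ℕ} (x x' : Sph d) (hne : x ≠ x') (h : dist x x' < 2) : ∃ (θ : ℝ) (z : ℝ → Sph d) (b : Sph d → ℝ),
    |θ| ≤ 2 * dist x x' ∧ (z θ = x') ∧ ∀ φ y, ip (z φ) y = ip x y * Real.cos φ + b y * Real.sin φ := by
  have hm := ip_mem x x'
  have hd2 := dist_sq_ip x x'
  have hdp : 0 < dist x x' := dist_pos.2 hne
  set t := ip x x' with ht
  have hxx : ⟪(x : Eu d), (x : Eu d)⟫ = 1 := ip_self x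
  have hyy : ⟪(x' : Eu d), (x' : Eu d)⟫ = 1 := ip_self x'
  have hxy : ⟪(x : Eu d), (x' : Eu d)⟫ = t := rfl
  have hyx : ⟪(x' : Eu d), (x : Eu d)⟫ = t := by rw [real_inner_comm]; exact hxy
  have ht1 : t < 1 := by nlinarith
  have ht2 : -1 < t := by nlinarith
  set θ := Real.arccos t with hθ
  have hcos : Real.cos θ = t := Real.cos_arccos hm.1 hm.2
  have hs2 : Real.sin θ ^ 2 = 1 - t^2 := by have := Real.sin_sq_add_cos_sq θ; rw [hcos] at this; linarith
  have hsp : Real.sin θ ≠ 0 := by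
    intro h0
    rw [h0] at hs2
    nlinarith
  set v : Eu d := (Real.sin θ)⁻¹ • ((x' : Eu d) - t • (x : Eu d)) with hv
  have hxv : ⟪(x : Eu d), v⟫ = 0 := by
    rw [hv, inner_smul_right, inner_sub_right, inner_smul_right, hxx, hxy]; ring
  have hvx : ⟪v, (x : Eu d)⟫ = 0 := by rw [real_inner_comm]; exact hxv
  have hvv : ⟪v, v⟫ = 1 := by
    rw [hv]
    simp only [inner_smul_right, inner_smul_left, inner_sub_right, inner_sub_left, hxx, hxy, hyx, hyy, conj_trivial]
    have : (Real.sin θ)⁻¹ * ((Real.sin θ)⁻¹ * (1 - t * t) - t * ((Real.sin θ)⁻¹ * (t - t * 1))) = (Real.sin θ ^2)⁻¹ * (1 - t^2) := by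
      rw [← inv_pow]; ring
    rw [hs2] at this
    rw [this]
    exact inv_mul_cancel₀ (by nlinarith)
  have hzn : ∀ φ : ℝ, ‖Real.cos φ • (x : Eu d) + Real.sin φ • v‖ = 1 := by
    intro φ
    have h1 : ⟪Real.cos φ • (x : Eu d) + Real.sin φ • v, Real.cos φ • (x : Eu d) + Real.sin φ • v⟫ = 1 := by
      simp only [inner_smul_right, inner_smul_left, inner_add_right, inner_add_left, hxx, hxv, hvx, hvv, conj_trivial]
      have := Real.sin_sq_add_cos_sq φ
      nlinarith
    rw [real_inner_self_eq_norm_sq] at h1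
    have := norm_nonneg (Real.cos φ • (x : Eu d) + Real.sin φ • v)
    nlinarith
  refine ⟨θ, fun φ => ⟨Real.cos φ • (x : Eu d) + Real.sin φ • v, by simpa using hzn φ⟩, fun y => ⟪v, (y : Eu d)⟫, ?_, ?_, ?_⟩
  · have h0 : 0 ≤ θ := Real.arccos_nonneg _
    have hpi : θ ≤ Real.pi := Real.arccos_le_pi _
    rw [abs_of_nonneg h0]
    have h1 := Real.mul_le_sin (x := θ/2) (by linarith) (by linarith)
    have hsn : 0 ≤ Real.sin (θ/2) := Real.sin_nonneg_of_nonneg_of_le_pi (by linarith) (by linarith)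
    have h2 : Real.sin (θ/2) ^ 2 = (1 - t)/2 := by
      have := Real.cos_sq' (θ/2)
      have h3 := Real.cos_two_mul (θ/2)
      rw [show 2*(θ/2) = θ by ring, hcos] at h3
      linarith
    have h3 : dist x x' = 2 * Real.sin (θ/2) := by
      have : dist x x' ^2 = (2 * Real.sin (θ/2))^2 := by rw [hd2, mul_pow, h2]; ring
      exact (pow_left_inj₀ hdp.le (by linarith) (by norm_num)).1 this
    have h4 : θ / 4 ≤ 2/Real.pi * (θ/2) := by
      have hpp := Real.pi_pos
      have := Real.pi_le_four
      rw [show 2/Real.pi * (θ/2) = θ / Real.pi by ring]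
      gcongr
    linarith
  · apply Subtype.ext
    change Real.cos θ • (x : Eu d) + Real.sin θ • v = x'
    rw [hv, smul_smul, mul_inv_cancel₀ hsp, hcos, one_smul]; abel
  · intro φ y
    change ⟪Real.cos φ • (x : Eu d) + Real.sin φ • v, (y : Eu d)⟫ = _
    rw [inner_add_left, inner_smul_left, inner_smul_left]
    simp only [conj_trivial]
    unfold ip
    ring

theorem zonal_lip {d : ℕ} (D : ℕ) (P : Polynomial ℝ) (hP : P.natDegree ≤ D) {M : ℕ} (c : Fin M → ℝ) (ys : Fin M → Sph d)
    (G : Sph d → ℝ) (hG : Continuous G) (H : Sph d → ℝ)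
    (hH : ∀ x, H x = ∑ j, c j * P.eval (ip x (ys j)) - ∫ y : Sph d, G y * P.eval (ip x y) ∂sphMeasure d)
    {B : ℝ} (hB : ∀ x, |H x| ≤ B) (x x' : Sph d) (h : dist x x' < 2) :
    |H x' - H x| ≤ (2*D+1) * (D * (2 * dist x x')) * B := by
  by_cases hne : x = x'
  · subst hne; simp
  obtain ⟨θ, z, b, hθ, hz, hip⟩ := great_circle x x' hne h
  obtain ⟨w, φ, hw, hT⟩ := trig_incr D θ
  have hi : ∀ x : Sph d, Integrable (fun y => G y * P.eval (ip x y)) (sphMeasure d) := by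
    intro x
    have := ip_cont x
    exact sph_integrable (by fun_prop)
  have key : ∀ y : Sph d, P.eval (ip x' y) - P.eval (ip x y) = ∑ j ∈ Finset.range (2*D+1), w j * P.eval (ip (z (φ j)) y) := by
    intro y
    have := hT P hP (ip x y) (b y)
    rw [← hip, hz] at this
    simp only [hip]; exact this
  have hsum : H x' - H x = ∑ j ∈ Finset.range (2*D+1), w j * H (z (φ j)) := by
    have h1 : ∑ j, c j * P.eval (ip x' (ys j)) - ∑ j, c j * P.eval (ip x (ys j)) = ∑ i ∈ Finset.range (2*D+1), w i * ∑ j, c j * P.eval (ip (z (φ i)) (ys j)) := by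
      rw [← Finset.sum_sub_distrib]
      simp only [← mul_sub, key, Finset.mul_sum]
      rw [Finset.sum_comm]
      refine Finset.sum_congr rfl fun i _ => Finset.sum_congr rfl fun j _ => by ring
    have h2 : (∫ y : Sph d, G y * P.eval (ip x' y) ∂sphMeasure d) - ∫ y : Sph d, G y * P.eval (ip x y) ∂sphMeasure d = ∑ i ∈ Finset.range (2*D+1), w i * ∫ y : Sph d, G y * P.eval (ip (z (φ i)) y) ∂sphMeasure d := by
      rw [← integral_sub (hi x') (hi x)]
      simp only [← integral_const_mul]
      rw [← integral_finsetSum _ (fun i _ => (hi (z (φ i))).const_mul (w i))]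
      congr 1; ext y
      rw [← mul_sub, key, Finset.mul_sum]
      refine Finset.sum_congr rfl fun i _ => by ring
    rw [hH x', hH x]
    simp only [hH, mul_sub, Finset.sum_sub_distrib]
    rw [← h1, ← h2]; ring
  rw [hsum]
  have hB0 : 0 ≤ B := (abs_nonneg _).trans (hB x)
  calc _ ≤ ∑ j ∈ Finset.range (2*D+1), |w j * H (z (φ j))| := Finset.abs_sum_le_sum_abs _ _
    _ ≤ ∑ j ∈ Finset.range (2*D+1), (D * (2 * dist x x')) * B := by
        refine Finset.sum_le_sum fun j _ => ?_
        rw [abs_mul]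
        refine mul_le_mul ((hw j).trans ?_) (hB _) (abs_nonneg _) (by positivity)
        gcongr
    _ = _ := by rw [Finset.sum_const, Finset.card_range, nsmul_eq_mul]; push_cast; ring

theorem exists_net (d m : ℕ) (hm : 0 < m) : ∃ N : Finset (Sph d), N.card ≤ (2*m+1)^(d+1) ∧
    ∀ x : Sph d, ∃ y ∈ N, dist x y ≤ ((d:ℝ)+1)/m := by
  classical
  have hmp : (0:ℝ) < m := by exact_mod_cast hm
  set cell : Sph d → (Fin (d+1) → Fin (2*m+1)) := fun x i => Fin.ofNat (2*m+1) (⌊m * ((x : Eu d) i + 1)⌋₊) with hcell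
  have hco : ∀ (x : Sph d) i, -1 ≤ (x : Eu d) i ∧ (x : Eu d) i ≤ 1 := by
    intro x i
    have h1 : ‖(x : Eu d) i‖ ≤ ‖(x : Eu d)‖ := PiLp.norm_apply_le _ i
    have h2 : ‖(x : Eu d)‖ = 1 := by simp
    rw [h2, Real.norm_eq_abs] at h1
    exact abs_le.1 h1
  have hfl : ∀ (x : Sph d) i, ((cell x i : ℕ)) = ⌊m * ((x : Eu d) i + 1)⌋₊ := by
    intro x i
    simp only [hcell, Fin.ofNat]
    refine Nat.mod_eq_of_lt ?_
    rw [Nat.lt_succ_iff]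
    refine Nat.floor_le_of_le ?_
    push_cast
    have := (hco x i).2
    nlinarith
  have hsame : ∀ x y : Sph d, cell x = cell y → dist x y ≤ ((d:ℝ)+1)/m := by
    intro x y hxy
    have hi : ∀ i, |(x : Eu d) i - (y : Eu d) i| ≤ 1/m := by
      intro i
      have h1 := hfl x i
      have h2 := hfl y i
      rw [hxy, h2] at h1
      have hx0 : 0 ≤ m * ((x : Eu d) i + 1) := mul_nonneg hmp.le (by linarith [(hco x i).1])
      have hy0 : 0 ≤ m * ((y : Eu d) i + 1) := mul_nonneg hmp.le (by linarith [(hco y i).1])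
      have a1 := Nat.floor_le hx0
      have a2 := Nat.lt_floor_add_one (m * ((x : Eu d) i + 1))
      have a3 := Nat.floor_le hy0
      have a4 := Nat.lt_floor_add_one (m * ((y : Eu d) i + 1))
      rw [← h1] at a1 a2
      rw [le_div_iff₀ hmp, show |(x : Eu d) i - (y : Eu d) i| * m = |((x : Eu d) i - (y : Eu d) i) * m| by rw [abs_mul, abs_of_pos hmp], abs_le]
      constructor <;> linarith
    rw [Subtype.dist_eq, dist_eq_norm, EuclideanSpace.norm_eq]
    refine Real.sqrt_le_iff.2 ⟨by positivity, ?_⟩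
    calc ∑ i, ‖((x : Eu d) - (y : Eu d)) i‖^2 ≤ ∑ i : Fin (d+1), (1/(m:ℝ))^2 := by
          refine Finset.sum_le_sum fun i _ => ?_
          have := hi i
          rw [Real.norm_eq_abs]
          gcongr
          exact this
      _ = ((d:ℝ)+1) * (1/(m:ℝ))^2 := by simp
      _ ≤ ((d:ℝ)+1)^2 * (1/(m:ℝ))^2 := by gcongr; nlinarith [Nat.cast_nonneg (α := ℝ) d]
      _ = _ := by ring
  rcases isEmpty_or_nonempty (Sph d) with he | hne
  · exact ⟨∅, by simp, fun x => (he.false x).elim⟩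
  set ch : (Fin (d+1) → Fin (2*m+1)) → Sph d := Function.invFun cell with hch
  refine ⟨Finset.univ.image ch, ?_, ?_⟩
  · refine Finset.card_image_le.trans ?_
    simp
  · intro x
    refine ⟨ch (cell x), Finset.mem_image_of_mem _ (Finset.mem_univ _), hsame _ _ ?_⟩
    rw [hch]
    exact (Function.invFun_eq ⟨x, rfl⟩).symm

theorem le_supNorm {d : ℕ} {F : Sph d → ℝ} (hF : Continuous F) (y : Sph d) : |F y| ≤ supNorm F := by
  unfold supNorm
  refine le_csSup ?_ ⟨y, rfl⟩
  exact (isCompact_range hF.abs).bddAbove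

theorem supNorm_le {d : ℕ} {F : Sph d → ℝ} {B : ℝ} (hB : 0 ≤ B) (h : ∀ y, |F y| ≤ B) : supNorm F ≤ B := by
  unfold supNorm
  refine Real.sSup_le ?_ hB
  rintro _ ⟨y, rfl⟩
  exact h y

theorem tau_prob {d : ℕ} (f₀ : Sph d → ℝ) (hc : Continuous f₀) (h0 : ∀ y, 0 ≤ f₀ y) (h1 : ∫ y, f₀ y ∂sphMeasure d = 1) :
    IsProbabilityMeasure ((sphMeasure d).withDensity fun y => ENNReal.ofReal (f₀ y)) := by
  constructor
  rw [withDensity_apply _ MeasurableSet.univ, Measure.restrict_univ]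
  rw [← ofReal_integral_eq_lintegral_ofReal (sph_integrable hc) (Filter.Eventually.of_forall h0), h1]
  simp

theorem tau_int {d : ℕ} (f₀ : Sph d → ℝ) (hc : Continuous f₀) (h0 : ∀ y, 0 ≤ f₀ y) (g : Sph d → ℝ) :
    ∫ y, g y ∂((sphMeasure d).withDensity fun y => ENNReal.ofReal (f₀ y)) = ∫ y, f₀ y * g y ∂sphMeasure d := by
  rw [integral_withDensity_eq_integral_toReal_smul (by fun_prop) (Filter.Eventually.of_forall fun y => ENNReal.ofReal_lt_top)]
  simp only [ENNReal.toReal_ofReal (h0 _), smul_eq_mul]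

theorem phi_abs_le (d n : ℕ) {r : ℝ} (hr : 0 < r) (hd : 3 ≤ d) (hn : 1 ≤ n) {y : ℝ} (hy : y ∈ Icc (0:ℝ) 1) :
    |(phiY d n r).eval y| ≤ dimPi d ((d+2)*n) := by
  have hK := dimPi_pos d ((d+2)*n) (by omega) (Nat.mul_pos (by omega) (by omega))
  have h1 := kN_le d n hd hy
  have h2 := pT_le d n hr hd hy
  have h3 : |(1 - y)^n| ≤ 1 := by
    rw [abs_pow]
    refine pow_le_one₀ (abs_nonneg _) ?_
    rw [abs_le]; constructor <;> linarith [hy.1, hy.2]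
  unfold phiY
  simp only [Polynomial.eval_mul, Polynomial.eval_C, Polynomial.eval_pow, Polynomial.eval_sub, Polynomial.eval_one, Polynomial.eval_X]
  rw [abs_mul, abs_mul, abs_mul, abs_of_pos hK]
  calc dimPi d ((d+2)*n) * |(kN d n).eval y| * |(pT d n r).eval y| * |(1-y)^n| ≤ dimPi d ((d+2)*n) * 1 * 1 * 1 := by gcongr
    _ = _ := by ring

theorem ip_half_mem {d : ℕ} (x y : Sph d) : (1 - ip x y)/2 ∈ Icc (0:ℝ) 1 := by
  have := ip_mem x y
  constructor <;> linarith [this.1, this.2]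

theorem phi_L2 (d n : ℕ) {r : ℝ} (hr : 0 < r) (hd : 3 ≤ d) (hn : 2*(d+1) ≤ n) (x : Sph d) :
    ∫ y : Sph d, (phiY d n r).eval ((1 - ip x y)/2) ^ 2 ∂sphMeasure d ≤ Cv r * dimPi d ((d+2)*n) * Real.exp (-((d:ℝ)/512)) := by
  rw [sph_zonal d (by omega) x (fun y => (phiY d n r).eval y ^ 2) (by fun_prop)]
  exact V_bound d n hr hd hn

theorem var_bound {d n : ℕ} {r : ℝ} (hr : 0 < r) (hd : 3 ≤ d) (hn : 2*(d+1) ≤ n) (x : Sph d) (f₀ f : Sph d → ℝ)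
    (hc : Continuous f₀) (h0 : ∀ y, 0 ≤ f₀ y) (hf : Continuous f) {a b : ℝ} (ha : ∀ y, |f y| ≤ a) (hb : ∀ y, |f₀ y * f y| ≤ b) :
    ∫ y : Sph d, f₀ y * (f y * (phiY d n r).eval ((1 - ip x y)/2))^2 ∂sphMeasure d ≤ a * b * (Cv r * dimPi d ((d+2)*n) * Real.exp (-((d:ℝ)/512))) := by
  have hip := ip_cont x
  have ha0 : 0 ≤ a := (abs_nonneg _).trans (ha x)
  have hb0 : 0 ≤ b := (abs_nonneg _).trans (hb x)
  calc _ ≤ ∫ y : Sph d, a * b * ((phiY d n r).eval ((1 - ip x y)/2))^2 ∂sphMeasure d := by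
        refine integral_mono (sph_integrable (by fun_prop)) (sph_integrable (by fun_prop)) fun y => ?_
        have h1 : f₀ y * f y ^ 2 ≤ a * b := by
          calc f₀ y * f y ^ 2 = (f₀ y * |f y|) * |f y| := by rw [mul_assoc, ← sq, sq_abs]
            _ = |f₀ y * f y| * |f y| := by rw [abs_mul, abs_of_nonneg (h0 y)]
            _ ≤ b * a := mul_le_mul (hb y) (ha y) (abs_nonneg _) hb0
            _ = _ := mul_comm _ _
        calc f₀ y * (f y * (phiY d n r).eval ((1 - ip x y)/2))^2 = (f₀ y * f y ^2) * ((phiY d n r).eval ((1 - ip x y)/2))^2 := by ring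
          _ ≤ _ := mul_le_mul_of_nonneg_right h1 (sq_nonneg _)
    _ = a * b * ∫ y : Sph d, ((phiY d n r).eval ((1 - ip x y)/2))^2 ∂sphMeasure d := integral_const_mul _ _
    _ ≤ _ := mul_le_mul_of_nonneg_left (phi_L2 d n hr hd hn x) (mul_nonneg ha0 hb0)

theorem exp_num {d : ℕ} (hd : 1 ≤ d) {θ : ℝ} (h : θ ≤ (d:ℝ)^((1:ℝ)/6)) : Real.exp (-((d:ℝ)/512)) * Real.exp θ ≤ Real.exp 128 := by
  rw [← Real.exp_add]
  refine Real.exp_le_exp.2 ?_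
  have hd' : (1:ℝ) ≤ d := by exact_mod_cast hd
  have h1 : (d:ℝ)^((1:ℝ)/6) ≤ (d:ℝ)^((1:ℝ)/2) := Real.rpow_le_rpow_of_exponent_le hd' (by norm_num)
  rw [← Real.sqrt_eq_rpow] at h1
  have h2 := Real.sq_sqrt (show (0:ℝ) ≤ d by linarith)
  nlinarith [sq_nonneg (√(d:ℝ) - 256)]

theorem one_point {d n M : ℕ} {r : ℝ} (hr : 0 < r) (hd : 3 ≤ d) (hn : 2*(d+1) ≤ n) (x : Sph d) (f₀ f : Sph d → ℝ)
    (hc : Continuous f₀) (h0 : ∀ y, 0 ≤ f₀ y) (hint : ∫ y, f₀ y ∂sphMeasure d = 1) (hf : Continuous f) {a b θ : ℝ} (hap : 0 < a) (hbp : 0 < b)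
    (ha : ∀ y, |f y| ≤ a) (hb : ∀ y, |f₀ y * f y| ≤ b) (hθ0 : 0 ≤ θ) (hθ : θ ≤ (d:ℝ)^((1:ℝ)/6)) :
    (Measure.pi (fun _ : Fin M => (sphMeasure d).withDensity fun y => ENNReal.ofReal (f₀ y))).real
      {ys | M * ((Cv r * Real.exp 128 + 1) * θ * b) ≤ |∑ j, f (ys j) * (phiY d n r).eval ((1 - ip x (ys j))/2)
        - M * ∫ y : Sph d, f₀ y * f y * (phiY d n r).eval ((1 - ip x y)/2) ∂sphMeasure d|} ≤
      2 * Real.exp (-(M * b / (a * dimPi d ((d+2)*n)) * θ^2)) := by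
  have := tau_prob f₀ hc h0 hint
  have hip := ip_cont x
  have hK := dimPi_pos d ((d+2)*n) (by omega) (Nat.mul_pos (by omega) (by omega))
  set K := dimPi d ((d+2)*n) with hKdef
  have hCv : 0 < Cv r := by
    have := Cg_pos hr
    unfold Cv; positivity
  have h := conc_two ((sphMeasure d).withDensity fun y => ENNReal.ofReal (f₀ y)) M
    (fun y => f y * (phiY d n r).eval ((1 - ip x y)/2)) (by fun_prop) (R := a * K) (V := a * b * (Cv r * K * Real.exp (-((d:ℝ)/512))))
    (s := θ / (a * K)) (fun y => by
      rw [abs_mul]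
      exact mul_le_mul (ha y) (phi_abs_le d n hr hd (by omega) (ip_half_mem x y)) (abs_nonneg _) hap.le)
    (by rw [tau_int f₀ hc h0]; exact var_bound hr hd hn x f₀ f hc h0 hf ha hb) (by positivity) (M * ((Cv r * Real.exp 128 + 1) * θ * b))
  rw [tau_int f₀ hc h0] at h
  simp only [← mul_assoc] at h ⊢
  refine h.trans ?_
  refine mul_le_mul_of_nonneg_left (Real.exp_le_exp.2 ?_) (by norm_num)
  have e1 : θ / (a*K) * (a * K) = θ := by field_simp
  have e1' : θ / (a*K) * a * K = θ := by field_simp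
  simp only [e1']
  have hnum := exp_num (d := d) (by omega) hθ
  set E := Real.exp (-((d:ℝ)/512)) with hE
  have e2 : M * (θ/(a*K))^2 * a * b * Cv r * K * E * Real.exp θ = (M*b/(a*K)*θ^2) * (Cv r * (E * Real.exp θ)) := by
    field_simp
  have e3 : -(θ/(a*K)) * M * (Cv r * Real.exp 128 + 1) * θ * b = -((M*b/(a*K)*θ^2) * (Cv r * Real.exp 128 + 1)) := by
    field_simp
  have e4 : 0 ≤ M*b/(a*K)*θ^2 := by positivity
  have e5 : (M*b/(a*K)*θ^2) * (Cv r * (E * Real.exp θ)) ≤ (M*b/(a*K)*θ^2) * (Cv r * Real.exp 128) :=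
    mul_le_mul_of_nonneg_left (mul_le_mul_of_nonneg_left hnum hCv.le) e4
  rw [e2, e3]
  linarith

def phiX (d n : ℕ) (r : ℝ) : Polynomial ℝ := (phiY d n r).comp (Polynomial.C (1/2) - Polynomial.C (1/2) * Polynomial.X)

theorem phiX_eval (d n : ℕ) (r t : ℝ) : (phiX d n r).eval t = (phiY d n r).eval ((1-t)/2) := by
  unfold phiX
  rw [Polynomial.eval_comp]
  simp only [Polynomial.eval_sub, Polynomial.eval_mul, Polynomial.eval_C, Polynomial.eval_X]
  congr 1; ring

theorem phiX_deg (d n : ℕ) (r : ℝ) (hn : 1 ≤ n) : (phiX d n r).natDegree ≤ 2*(d+2)*n := by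
  have h1 : (phiY d n r).natDegree ≤ 2*(d+2)*n := by
    unfold phiY
    have a1 : (kN d n).natDegree ≤ (d+2)*n - 1 := jF_natDegree _ _ _
    have a2 : (pT d n r).natDegree ≤ d*n := jF_natDegree _ _ _
    have a3 : ((1 - Polynomial.X : Polynomial ℝ)^n).natDegree ≤ n := by
      refine Polynomial.natDegree_pow_le.trans ?_
      have : (1 - Polynomial.X : Polynomial ℝ).natDegree ≤ 1 := by
        refine (Polynomial.natDegree_sub_le _ _).trans ?_
        simp
      nlinarith
    refine Polynomial.natDegree_mul_le.trans ?_
    have b1 := Polynomial.natDegree_mul_le (p := Polynomial.C (dimPi d ((d+2)*n)) * kN d n) (q := pT d n r)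
    have b2 := Polynomial.natDegree_C_mul_le (dimPi d ((d+2)*n)) (kN d n)
    have : (d+2)*n - 1 + d * n + n ≤ 2*(d+2)*n := by
      have : (d+2)*n = d*n+2*n := by ring
      have : 2*(d+2)*n = 2*(d*n)+4*n := by ring
      omega
    omega
  unfold phiX
  refine Polynomial.natDegree_comp_le.trans ?_
  have : (Polynomial.C (1/2) - Polynomial.C (1/2) * Polynomial.X : Polynomial ℝ).natDegree ≤ 1 := by
    refine (Polynomial.natDegree_sub_le _ _).trans ?_
    refine max_le (by simp) ?_
    refine (Polynomial.natDegree_C_mul_le _ _).trans (by simp)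
  nlinarith

theorem net_sup {d n M : ℕ} {r : ℝ} (hr : 0 < r) (hd : 3 ≤ d) (hn : 1 ≤ n) (c : Fin M → ℝ) (ys : Fin M → Sph d)
    (G : Sph d → ℝ) (hG : Continuous G) (H : Sph d → ℝ)
    (hH : ∀ x, H x = ∑ j, c j * (phiY d n r).eval ((1 - ip x (ys j))/2) - ∫ y : Sph d, G y * (phiY d n r).eval ((1 - ip x y)/2) ∂sphMeasure d)
    (N : Finset (Sph d)) (hN : ∀ x : Sph d, ∃ y ∈ N, dist x y ≤ 1 / (16 * ((2*(d+2)*n : ℕ):ℝ)^2)) {T : ℝ} (hT : ∀ x ∈ N, |H x| ≤ T) (x : Sph d) :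
    |H x| ≤ 2 * T := by
  set D : ℕ := 2*(d+2)*n with hD
  have hD1 : (1:ℝ) ≤ D := by
    have : 1 ≤ D := Nat.mul_pos (by omega) (by omega)
    exact_mod_cast this
  have hK := dimPi_pos d ((d+2)*n) (by omega) (Nat.mul_pos (by omega) (by omega))
  have hbd : ∀ x, |H x| ≤ ∑ j, |c j| * dimPi d ((d+2)*n) + supNorm G * dimPi d ((d+2)*n) := by
    intro x
    rw [hH]
    refine (abs_sub _ _).trans (add_le_add ?_ ?_)
    · refine (Finset.abs_sum_le_sum_abs _ _).trans (Finset.sum_le_sum fun j _ => ?_)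
      rw [abs_mul]
      exact mul_le_mul_of_nonneg_left (phi_abs_le d n hr hd hn (ip_half_mem _ _)) (abs_nonneg _)
    · have := norm_integral_le_of_norm_le_const (μ := sphMeasure d) (f := fun y => G y * (phiY d n r).eval ((1 - ip x y)/2)) (C := supNorm G * dimPi d ((d+2)*n)) (Filter.Eventually.of_forall fun y => by
        rw [Real.norm_eq_abs, abs_mul]
        exact mul_le_mul (le_supNorm hG y) (phi_abs_le d n hr hd hn (ip_half_mem _ _)) (abs_nonneg _) ((abs_nonneg _).trans (le_supNorm hG y)))
      simpa using this
  have hba : BddAbove (range fun x => |H x|) := ⟨_, by rintro _ ⟨y, rfl⟩; exact hbd y⟩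
  set B := sSup (range fun x => |H x|) with hBdef
  have hB : ∀ x, |H x| ≤ B := fun x => le_csSup hba ⟨x, rfl⟩
  have hB0 : 0 ≤ B := (abs_nonneg _).trans (hB x)
  have key : ∀ x, |H x| ≤ T + B/2 := by
    intro x
    obtain ⟨y, hy, hxy⟩ := hN x
    have hsm : 1 / (16 * (D:ℝ)^2) ≤ 1/16 := by
      refine one_div_le_one_div_of_le (by norm_num) ?_
      nlinarith
    have hl := zonal_lip D (phiX d n r) (phiX_deg d n r hn) c ys G hG H (by intro x; simp only [phiX_eval]; exact hH x) hB y x (by rw [dist_comm]; linarith)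
    have h1 : (2*(D:ℝ)+1) * (D * (2 * dist y x)) ≤ 1/2 := by
      rw [dist_comm]
      rw [le_div_iff₀ (by positivity)] at hxy
      have := dist_nonneg (x := x) (y := y)
      calc (2*(D:ℝ)+1) * (D * (2 * dist x y)) ≤ (2*(D:ℝ)+2*D) * (D * (2 * dist x y)) := by
            refine mul_le_mul_of_nonneg_right (by linarith) (by positivity)
        _ = (dist x y * (16 * (D:ℝ)^2))/2 := by ring
        _ ≤ 1/2 := by linarith
    have h2 : |H x - H y| ≤ B/2 := by
      refine hl.trans ?_
      nlinarith
    have h3 := abs_sub_abs_le_abs_sub (H x) (H y)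
    linarith [hT y hy]
  have : B ≤ T + B/2 := by
    refine csSup_le ⟨_, ⟨x, rfl⟩⟩ ?_
    rintro _ ⟨y, rfl⟩
    exact key y
  linarith [hB x]

theorem net_exists {d n : ℕ} (hd : 3 ≤ d) (hn : 2*(d+1) ≤ n) : ∃ N : Finset (Sph d), (N.card : ℝ) ≤ dimPi d (2*(d+2)*n) ^ 16 ∧
    ∀ x : Sph d, ∃ y ∈ N, dist x y ≤ 1 / (16 * ((2*(d+2)*n : ℕ):ℝ)^2) := by
  obtain ⟨N, h1, h2⟩ := exists_net d ((d+1) * (16 * (2*(d+2)*n)^2)) (by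
    refine Nat.mul_pos (by omega) (Nat.mul_pos (by norm_num) (pow_pos (Nat.mul_pos (by omega) (by omega)) 2)))
  refine ⟨N, ?_, ?_⟩
  · have hn' : 2*((d:ℝ)+1) ≤ n := by exact_mod_cast hn
    have hd' : (3:ℝ) ≤ d := by exact_mod_cast hd
    have hn8 : (8:ℝ) ≤ n := by linarith
    have a1 : (N.card : ℝ) ≤ (2*(((d:ℝ)+1) * (16 * (2*(d+2)*n)^2)) + 1)^(d+1) := by exact_mod_cast h1
    have a2 : (2*(((d:ℝ)+1) * (16 * (2*(d+2)*n)^2)) + 1) ≤ (n:ℝ)^8 := by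
      have b1 : (n:ℝ)^5 * 8^3 ≤ (n:ℝ)^8 := by
        rw [show (n:ℝ)^8 = n^5 * n^3 by ring]
        gcongr
      have b2 : ((d:ℝ)+1) * (d+2)^2 ≤ n * n^2 := by
        refine mul_le_mul (by linarith) (pow_le_pow_left₀ (by linarith) (by linarith) 2) (by positivity) (by linarith)
      have b3 : ((d:ℝ)+1) * (d+2)^2 * n^2 ≤ n * n^2 * n^2 := mul_le_mul_of_nonneg_right b2 (by positivity)
      have b4 : (1:ℝ) ≤ n^5 := one_le_pow₀ (by linarith)
      nlinarith
    have a3 := Dn_ge d n hd hn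
    calc (N.card : ℝ) ≤ ((n:ℝ)^8)^(d+1) := a1.trans (pow_le_pow_left₀ (by positivity) a2 _)
      _ = (n:ℝ)^(8*(d+1)) := by rw [← pow_mul]
      _ ≤ (n:ℝ)^(d*16) := pow_le_pow_right₀ (by linarith) (by omega)
      _ ≤ (2*(n:ℝ))^(d*16) := pow_le_pow_left₀ (by linarith) (by linarith) _
      _ = ((2*(n:ℝ))^d)^16 := by rw [← pow_mul]
      _ ≤ _ := pow_le_pow_left₀ (by positivity) a3 _
  · intro x
    obtain ⟨y, hy, h⟩ := h2 x
    refine ⟨y, hy, h.trans_eq ?_⟩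
    push_cast
    have : (d:ℝ)+1 ≠ 0 := by positivity
    rw [div_mul_eq_div_div, div_self this]

theorem num_bound {d : ℕ} (hd : 3 ≤ d) {r a b K D Lg M : ℝ} (hap : 0 < a) (hbp : 0 < b) (hK : 0 < K) (hD : 0 < D)
    (hKD : K ≤ Real.exp 1 * 2^(-(d:ℝ)) * D) (hLg : 0 ≤ Lg)
    (hM : (18 * Real.exp 1) * 2 ^ (-(d : ℝ)) * (d : ℝ) ^ (-((1 : ℝ)/3)) * (a / b) * D ^ ((2 * r + d) / (d : ℝ)) * Lg ≤ M) :
    18 * Lg ≤ M * b / (a * K) * ((d:ℝ)^((1:ℝ)/6) * D^(-(r/(d:ℝ))))^2 := by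
  have hdp : (0:ℝ) < d := by
    have : (3:ℝ) ≤ d := by exact_mod_cast hd
    linarith
  have e1 : ((d:ℝ)^((1:ℝ)/6))^2 = (d:ℝ)^((1:ℝ)/3) := by
    rw [← Real.rpow_natCast, ← Real.rpow_mul hdp.le]; norm_num
  have e2 : (D^(-(r/(d:ℝ))))^2 = D^(-(2*r/(d:ℝ))) := by
    rw [← Real.rpow_natCast, ← Real.rpow_mul hD.le]; congr 1; push_cast; ring
  have e3 : D ^ ((2 * r + d) / (d : ℝ)) * D^(-(2*r/(d:ℝ))) = D := by
    rw [← Real.rpow_add hD]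
    have : (2 * r + d) / (d : ℝ) + (-(2*r/(d:ℝ))) = 1 := by field_simp; ring
    rw [this, Real.rpow_one]
  have e4 : (d:ℝ)^(-((1:ℝ)/3)) * (d:ℝ)^((1:ℝ)/3) = 1 := by
    rw [← Real.rpow_add hdp]; simp
  rw [mul_pow, e1, e2]
  set X := D ^ ((2 * r + d) / (d : ℝ))
  set Y := D^(-(2*r/(d:ℝ))) with hY
  have hYp : 0 < Y := Real.rpow_pos_of_pos hD _
  set p := (d:ℝ)^(-((1:ℝ)/3))
  set q := (d:ℝ)^((1:ℝ)/3) with hq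
  have hqp : 0 < q := Real.rpow_pos_of_pos hdp _
  set w := (2:ℝ)^(-(d:ℝ))
  calc 18 * Lg = 18 * Lg * (K / K) := by rw [div_self hK.ne', mul_one]
    _ ≤ 18 * Lg * ((Real.exp 1 * w * D)/K) := by gcongr
    _ = (18 * Real.exp 1 * w * p * (a/b) * X * Lg) * b / (a*K) * (q * Y) := by
        have : (18 * Real.exp 1 * w * p * (a/b) * X * Lg) * b / (a*K) * (q * Y) = 18 * Real.exp 1 * w * (p * q) * (X * Y) * Lg * ((a/b) * b / (a*K)) := by ring
        rw [this, e3, e4]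
        field_simp
    _ ≤ _ := by gcongr

theorem log_pos_const : 0 < Real.log (16 * Real.exp 1 / Real.pi) := by
  refine Real.log_pos ?_
  rw [lt_div_iff₀ Real.pi_pos]
  have := Real.add_one_le_exp 1
  have := Real.pi_le_four
  linarith

theorem union_num {d : ℕ} (hd : 3 ≤ d) {D ε : ℝ} (hD : 1 ≤ D) (hε : 0 < ε) (hε1 : ε < 1) :
    D^16 * (2 * Real.exp (-(18 * (Real.log D + ((d : ℝ) + 1) * Real.log d +
              (d : ℝ) * Real.log (16 * Real.exp 1 / Real.pi) + Real.log (1 / ε))))) < ε := by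
  have hd' : (3:ℝ) ≤ d := by exact_mod_cast hd
  have h1 : 1 < Real.log d := by
    rw [Real.lt_log_iff_exp_lt (by linarith)]
    have := Real.exp_one_lt_d9
    norm_num at this
    linarith
  have h2 := log_pos_const
  have h3 : 0 ≤ Real.log D := Real.log_nonneg hD
  have h4 : Real.log (1/ε) = - Real.log ε := by rw [one_div, Real.log_inv]
  have h5 : Real.log ε < 0 := Real.log_neg hε hε1
  have hl2 : Real.log 2 < 1 := by have := Real.log_two_lt_d9; linarith
  have e1 : D^16 = Real.exp (16 * Real.log D) := by
    rw [mul_comm, Real.exp_mul, Real.exp_log (by linarith)]; norm_cast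
  have e2 : (2:ℝ) = Real.exp (Real.log 2) := (Real.exp_log (by norm_num)).symm
  rw [e1]
  nth_rewrite 1 [e2]
  rw [← Real.exp_add, ← Real.exp_add, ← Real.lt_log_iff_exp_lt hε, h4]
  have h6 : 0 ≤ (d:ℝ) * Real.log (16 * Real.exp 1 / Real.pi) := by positivity
  have h7 : 1 ≤ ((d:ℝ)+1) * Real.log d := by nlinarith
  linarith

theorem Lg_nonneg {d : ℕ} (hd : 3 ≤ d) {D ε : ℝ} (hD : 1 ≤ D) (hε : 0 < ε) (hε1 : ε < 1) :
    0 ≤ Real.log D + ((d : ℝ) + 1) * Real.log d + (d : ℝ) * Real.log (16 * Real.exp 1 / Real.pi) + Real.log (1 / ε) := by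
  have hd' : (3:ℝ) ≤ d := by exact_mod_cast hd
  have h1 : 0 ≤ Real.log d := Real.log_nonneg (by linarith)
  have h2 := log_pos_const
  have h3 : 0 ≤ Real.log D := Real.log_nonneg hD
  have h4 : 0 ≤ Real.log (1/ε) := Real.log_nonneg (by rw [le_div_iff₀ hε]; linarith)
  positivity

theorem rate {d n : ℕ} (hd : 3 ≤ d) (hn : 2*(d+1) ≤ n) {r : ℝ} (hr : 0 < r) :
    (n:ℝ)^(-r) ≤ (4 * Real.exp 4)^r * dimPi d (2*(d+2)*n) ^ (-(r/(d:ℝ))) := by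
  have hd' : (3:ℝ) ≤ d := by exact_mod_cast hd
  have hn' : 2*((d:ℝ)+1) ≤ n := by exact_mod_cast hn
  have hnp : (0:ℝ) < n := by linarith
  have hD := dimPi_pos d (2*(d+2)*n) (by omega) (Nat.mul_pos (by omega) (by omega))
  have h := Dn_le d n hd hn
  set D := dimPi d (2*(d+2)*n)
  have hex := Real.exp_pos 4
  have h1 : D^(r/(d:ℝ)) ≤ (4 * Real.exp 4 * n)^r := by
    calc D^(r/(d:ℝ)) ≤ ((4 * Real.exp 4 * n)^d)^(r/(d:ℝ)) := Real.rpow_le_rpow hD.le h (by positivity)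
      _ = (4 * Real.exp 4 * n)^r := by
        rw [← Real.rpow_natCast, ← Real.rpow_mul (by positivity)]
        congr 1; field_simp
  rw [Real.mul_rpow (by positivity) hnp.le] at h1
  rw [Real.rpow_neg hnp.le, Real.rpow_neg hD.le]
  have hDr : 0 < D^(r/(d:ℝ)) := Real.rpow_pos_of_pos hD _
  have hnr : 0 < (n:ℝ)^r := Real.rpow_pos_of_pos hnp _
  rw [← div_eq_mul_inv, le_div_iff₀ hDr, inv_mul_le_iff₀ hnr]
  linarith

theorem prob_final {Ω : Type*} [MeasurableSpace Ω] (P : Measure Ω) [IsProbabilityMeasure P] {ι : Type*} (N : Finset ι) (Bd : ι → Set Ω)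
    (hm : ∀ i, MeasurableSet (Bd i)) (E : Set Ω) (hE : ∀ ω, (∀ i ∈ N, ω ∉ Bd i) → ω ∈ E) {q c ε : ℝ} (hq : 0 ≤ q) (hc : (N.card : ℝ) ≤ c)
    (hB : ∀ i, P.real (Bd i) ≤ q) (hlt : c * q < ε) (hε1 : ε < 1) : ENNReal.ofReal (1 - ε) < P E := by
  set U := ⋃ i ∈ N, Bd i with hU
  have hUm : MeasurableSet U := Finset.measurableSet_biUnion _ fun i _ => hm i
  have h1 : P.real U < ε := by
    calc P.real U ≤ ∑ i ∈ N, P.real (Bd i) := measureReal_biUnion_finset_le _ _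
      _ ≤ ∑ i ∈ N, q := Finset.sum_le_sum fun i _ => hB i
      _ = N.card * q := by simp
      _ ≤ c * q := mul_le_mul_of_nonneg_right hc hq
      _ < ε := hlt
  have h2 : Uᶜ ⊆ E := by
    intro ω hω
    refine hE ω fun i hi hb => hω ?_
    exact mem_biUnion hi hb
  refine lt_of_lt_of_le ?_ (measure_mono h2)
  have h3 : P.real Uᶜ = 1 - P.real U := probReal_compl_eq_one_sub hUm
  rw [ENNReal.ofReal_lt_iff_lt_toReal (by linarith) (measure_ne_top _ _)]
  change _ < P.real Uᶜ
  linarith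

theorem error_split {d n M : ℕ} {r δ L : ℝ} (hr : 0 < r) (hd : 3 ≤ d) (hn : 2*(d+1) ≤ n) (hrn : r ≤ n) (hM : 0 < M) (f₀ f : Sph d → ℝ)
    (hc : Continuous f₀) (hf : Continuous f) (hδ0 : 0 < δ) (hδ : √(16*r*Real.log n/n) ≤ δ) (hL : 0 ≤ L)
    (hP : ∀ x : Sph d, ∃ P, IsSphPoly d r P ∧ ∀ y ∈ Metric.closedBall x δ, |f₀ y * f y - P y| ≤ L * dist x y ^ r)
    (N : Finset (Sph d)) (hN : ∀ x : Sph d, ∃ y ∈ N, dist x y ≤ 1 / (16 * ((2*(d+2)*n : ℕ):ℝ)^2)) {b T : ℝ} (hb : ∀ y, |f₀ y * f y| ≤ b)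
    (ys : Fin M → Sph d)
    (hT : ∀ x ∈ N, |∑ j, f (ys j) * (phiY d n r).eval ((1 - ip x (ys j))/2)
        - M * ∫ y : Sph d, f₀ y * f y * (phiY d n r).eval ((1 - ip x y)/2) ∂sphMeasure d| ≤ M * T) (x : Sph d) :
    |f₀ x * f x - (1 / (M : ℝ)) * ∑ j : Fin M, f (ys j) * Phi d n r (ip x (ys j))| ≤
      Ca r * 2^r * (Cg r + 1) * (b + L) * (n:ℝ)^(-r) + 2 * T := by
  have hMp : (0:ℝ) < M := by exact_mod_cast hM
  set H : Sph d → ℝ := fun x => ∑ j, (1/(M:ℝ) * f (ys j)) * (phiY d n r).eval ((1 - ip x (ys j))/2)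
     - ∫ y : Sph d, f₀ y * f y * (phiY d n r).eval ((1 - ip x y)/2) ∂sphMeasure d with hH
  have e1 : ∀ x, ∑ j, f (ys j) * (phiY d n r).eval ((1 - ip x (ys j))/2)
        - M * ∫ y : Sph d, f₀ y * f y * (phiY d n r).eval ((1 - ip x y)/2) ∂sphMeasure d = M * H x := by
    intro x
    simp only [hH, mul_sub, mul_assoc, ← Finset.mul_sum]
    field_simp
  have hHT : ∀ x ∈ N, |H x| ≤ T := by
    intro x hx
    have := hT x hx
    rw [e1, abs_mul, abs_of_pos hMp] at this
    exact le_of_mul_le_mul_left this hMp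
  have h1 := net_sup hr hd (by omega) (fun j => 1/(M:ℝ) * f (ys j)) ys (fun y => f₀ y * f y) (hc.mul hf) H (fun x => rfl) N hN hHT x
  have h2 := approx_bound hr hd hn hrn x hL (fun y => f₀ y * f y) (hc.mul hf) hb hδ0 hδ (hP x)
  have e2 : (1 / (M : ℝ)) * ∑ j : Fin M, f (ys j) * Phi d n r (ip x (ys j)) =
      H x + ∫ y : Sph d, f₀ y * f y * (phiY d n r).eval ((1 - ip x y)/2) ∂sphMeasure d := by
    simp only [hH, mul_assoc, ← Finset.mul_sum, Phi_eq d n r hd (show 1 ≤ n by omega) hr]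
    ring
  rw [e2]
  set I := ∫ y : Sph d, f₀ y * f y * (phiY d n r).eval ((1 - ip x y)/2) ∂sphMeasure d
  have := abs_sub (f₀ x * f x - I) (H x)
  rw [show f₀ x * f x - (H x + I) = f₀ x * f x - I - H x by ring]
  linarith

theorem prob_approx :
    ∀ r : ℝ, 0 < r → ∃ c C : ℝ, 0 < c ∧ 0 < C ∧
      ∀ (d : ℕ) (ε : ℝ) (f₀ f : Sph d → ℝ) (δ L : ℝ) (n M : ℕ),
        3 ≤ d → 0 < ε → ε < 1 →
        Continuous f₀ → (∀ y, 0 ≤ f₀ y) → (∫ y, f₀ y ∂sphMeasure d) = 1 →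
        Continuous f → (∃ y, f₀ y * f y ≠ 0) →
        0 < δ → 0 ≤ L →
        (∀ x : Sph d, ∃ P, IsSphPoly d r P ∧
          ∀ y ∈ Metric.closedBall x δ, |f₀ y * f y - P y| ≤ L * dist x y ^ r) →
        2 * (d + 1) ≤ n → ((d : ℝ) + r + 1) ^ 2 ≤ (d : ℝ) * n →
        Real.sqrt (16 * r * Real.log n / n) ≤ δ →
        2 ≤ M →
        c * 2 ^ (-(d : ℝ)) * (d : ℝ) ^ (-((1 : ℝ)/3)) *
            (supNorm f / supNorm (fun y => f₀ y * f y)) *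
            dimPi d (2 * (d + 2) * n) ^ ((2 * r + d) / (d : ℝ)) *
            (Real.log (dimPi d (2 * (d + 2) * n)) + ((d : ℝ) + 1) * Real.log d +
              (d : ℝ) * Real.log (16 * Real.exp 1 / Real.pi) + Real.log (1 / ε)) ≤ (M : ℝ) →
        ENNReal.ofReal (1 - ε) <
          Measure.pi (fun _ : Fin M =>
              (sphMeasure d).withDensity fun y => ENNReal.ofReal (f₀ y))
            {ys | supNorm (fun x : Sph d =>
                f₀ x * f x - (1 / (M : ℝ)) * ∑ j : Fin M, f (ys j) * Phi d n r (ip x (ys j))) ≤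
              C * (d : ℝ) ^ ((1 : ℝ)/6) * dimPi d (2 * (d + 2) * n) ^ (-(r / (d : ℝ))) *
                (supNorm (fun y => f₀ y * f y) + L)} := by
  intro r hr
  have hCa := Ca_pos hr
  have hCg := Cg_pos hr
  have hCv : 0 < Cv r := by unfold Cv; positivity
  refine ⟨18 * Real.exp 1, Ca r * 2^r * (Cg r + 1) * (4 * Real.exp 4)^r + 2 * (Cv r * Real.exp 128 + 1), by positivity, by positivity, ?_⟩
  intro d ε f₀ f δ L n M hd hε hε1 hc h0 hint hf hne hδ0 hL hP hn hdn hδ hM2 hM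
  have hd' : (3:ℝ) ≤ d := by exact_mod_cast hd
  have hdp : (0:ℝ) < d := by linarith
  have hn' : 2*((d:ℝ)+1) ≤ n := by exact_mod_cast hn
  have hrn : r ≤ n := by
    have h1 : (d:ℝ) * r ≤ d * n := by nlinarith
    exact le_of_mul_le_mul_left h1 hdp
  have hFc : Continuous fun y => f₀ y * f y := hc.mul hf
  set b := supNorm (fun y => f₀ y * f y) with hbdef
  set a := supNorm f with hadef
  have ha : ∀ y, |f y| ≤ a := le_supNorm hf
  have hb : ∀ y, |f₀ y * f y| ≤ b := fun y => le_supNorm hFc y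
  obtain ⟨y0, hy0⟩ := hne
  have hap : 0 < a := lt_of_lt_of_le (abs_pos.2 (right_ne_zero_of_mul hy0)) (ha y0)
  have hbp : 0 < b := lt_of_lt_of_le (abs_pos.2 hy0) (hb y0)
  have hK := dimPi_pos d ((d+2)*n) (by omega) (Nat.mul_pos (by omega) (by omega))
  have hKD := K1_le_Dn d n hd hn
  have hD1 : 1 ≤ dimPi d (2*(d+2)*n) := (one_le_pow₀ (by linarith)).trans (Dn_ge d n hd hn)
  have hrate := rate hd hn hr
  obtain ⟨N, hNc, hN⟩ := net_exists hd hn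
  set D := dimPi d (2*(d+2)*n) with hDdef
  have hDp : 0 < D := by linarith
  set θ := (d:ℝ)^((1:ℝ)/6) * D^(-(r/(d:ℝ))) with hθdef
  have hd6 : 1 ≤ (d:ℝ)^((1:ℝ)/6) := Real.one_le_rpow (by linarith) (by norm_num)
  have hDr : 0 < D^(-(r/(d:ℝ))) := Real.rpow_pos_of_pos hDp _
  have hDr1 : D^(-(r/(d:ℝ))) ≤ 1 := Real.rpow_le_one_of_one_le_of_nonpos hD1 (by rw [neg_nonpos]; positivity)
  have hθ0 : 0 < θ := by positivity
  have hθ : θ ≤ (d:ℝ)^((1:ℝ)/6) := mul_le_of_le_one_right (by positivity) hDr1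
  have hLg := Lg_nonneg hd hD1 hε hε1
  have hnum := num_bound hd hap hbp hK hDp hKD hLg hM
  have hun := union_num hd hD1 hε hε1
  have hprob := tau_prob f₀ hc h0 hint
  refine prob_final _ N (fun x => {ys | M * ((Cv r * Real.exp 128 + 1) * θ * b) ≤ |∑ j, f (ys j) * (phiY d n r).eval ((1 - ip x (ys j))/2)
        - M * ∫ y : Sph d, f₀ y * f y * (phiY d n r).eval ((1 - ip x y)/2) ∂sphMeasure d|}) ?_ _ ?_ ?_ hNc ?_ hun hε1
  · intro x
    have hip := ip_cont x
    refine measurableSet_le measurable_const ?_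
    refine Continuous.measurable ?_
    have : Continuous fun y => f y * (phiY d n r).eval ((1 - ip x y)/2) := by fun_prop
    have h2 : Continuous fun ys : Fin M → Sph d => ∑ j, f (ys j) * (phiY d n r).eval ((1 - ip x (ys j))/2) :=
      continuous_finsetSum _ fun j _ => this.comp (continuous_apply j)
    exact (h2.sub continuous_const).abs
  · intro ys hys
    have hA : 0 ≤ b + L := by linarith
    refine supNorm_le (by positivity) fun x => ?_
    have hT := error_split hr hd hn hrn (by omega) f₀ f hc hf hδ0 hδ hL hP N hN hb ys (T := (Cv r * Real.exp 128 + 1) * θ * b) (fun x hx => by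
      have := hys x hx
      simp only [mem_ofPred_eq, not_le] at this
      exact this.le) x
    refine hT.trans ?_
    have h1 : Ca r * 2^r * (Cg r + 1) * (b + L) * (n:ℝ)^(-r) ≤ Ca r * 2^r * (Cg r + 1) * (b + L) * ((4 * Real.exp 4)^r * θ) := by
      refine mul_le_mul_of_nonneg_left (hrate.trans ?_) (by positivity)
      refine mul_le_mul_of_nonneg_left ?_ (by positivity)
      exact le_mul_of_one_le_left hDr.le hd6
    have h2 : (Cv r * Real.exp 128 + 1) * θ * b ≤ (Cv r * Real.exp 128 + 1) * θ * (b + L) :=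
      mul_le_mul_of_nonneg_left (by linarith) (by positivity)
    have h3 : (Ca r * 2^r * (Cg r + 1) * (4 * Real.exp 4)^r + 2 * (Cv r * Real.exp 128 + 1)) * (d:ℝ)^((1:ℝ)/6) * D^(-(r/(d:ℝ))) * (b + L) =
        Ca r * 2^r * (Cg r + 1) * (b + L) * ((4 * Real.exp 4)^r * θ) + 2 * ((Cv r * Real.exp 128 + 1) * θ * (b + L)) := by
      rw [hθdef]; ring
    rw [h3]
    linarith
  · positivity
  · intro x
    refine (one_point hr hd hn x f₀ f hc h0 hint hf hap hbp ha hb hθ0.le hθ).trans ?_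
    refine mul_le_mul_of_nonneg_left (Real.exp_le_exp.2 ?_) (by norm_num)
    linarith

end
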